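/- Let n ≥ 2, let Ω ⊂ ℝⁿ be a bounded open set with smooth boundary, let x₀ ∈ ∂Ω, and let Γ = ∂Ω ∖ Σ where Σ is an open neighbourhood of x₀ in ∂Ω. Then there exists δ > 0 (depending only on Ω, x₀ and Γ) such that for every f ∈ L^∞(Ω): if ∫_Ω f u v dx = 0 for every pair of functions u, v ∈ C^∞(Ω̄) that are harmonic in Ω and vanish identically on Γ, then f = 0 almost everywhere on B(x₀, δ) ∩ Ω. -/

import Mathlib

open MeasureTheory

noncomputable section

/-- The Laplacian of `u : ℝⁿ → ℝ`, as the sum of the second partial derivatives. -/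
def lap {n : ℕ} (u : EuclideanSpace ℝ (Fin n) → ℝ) (x : EuclideanSpace ℝ (Fin n)) : ℝ :=
  ∑ i, iteratedFDeriv ℝ 2 u x ![EuclideanSpace.single i 1, EuclideanSpace.single i 1]

/-- `u` is harmonic on `s`: twice continuously differentiable with vanishing Laplacian. -/
def IsHarmonicOn {n : ℕ} (u : EuclideanSpace ℝ (Fin n) → ℝ)
    (s : Set (EuclideanSpace ℝ (Fin n))) : Prop :=
  ContDiffOn ℝ 2 u s ∧ ∀ x ∈ s, lap u x = 0

/-- `Ω` has smooth boundary: near each boundary point there is a smooth local defining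
function with nonvanishing differential. -/
def HasSmoothBoundary {n : ℕ} (Ω : Set (EuclideanSpace ℝ (Fin n))) : Prop :=
  ∀ x ∈ frontier Ω, ∃ (U : Set (EuclideanSpace ℝ (Fin n))) (ρ : EuclideanSpace ℝ (Fin n) → ℝ),
    IsOpen U ∧ x ∈ U ∧ ContDiffOn ℝ (⊤ : ℕ∞) ρ U ∧ (∀ y ∈ U, fderiv ℝ ρ y ≠ 0) ∧
    Ω ∩ U = {y ∈ U | ρ y < 0} ∧ frontier Ω ∩ U = {y ∈ U | ρ y = 0}


open Set Filter Topology
open scoped ContDiff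

/-- Partial derivative. -/
def pd {n : ℕ} (k : Fin n) (g : EuclideanSpace ℝ (Fin n) → ℝ) (x : EuclideanSpace ℝ (Fin n)) : ℝ :=
  fderiv ℝ g x (EuclideanSpace.single k 1)

theorem two_le_infty : (2 : WithTop ℕ∞) ≤ ∞ := ENat.LEInfty.out

theorem one_le_infty : (1 : WithTop ℕ∞) ≤ ∞ := ENat.LEInfty.out

theorem nat_le_infty (m : ℕ) : (m : WithTop ℕ∞) ≤ ∞ := ENat.LEInfty.out

theorem one_add_one_le_infty : (1 + 1 : WithTop ℕ∞) ≤ ∞ := by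
  rw [one_add_one_eq_two]; exact two_le_infty

theorem lap_eq_pd {n : ℕ} {u : EuclideanSpace ℝ (Fin n) → ℝ} {x : EuclideanSpace ℝ (Fin n)}
    (h : ContDiffAt ℝ 2 u x) : lap u x = ∑ i, pd i (pd i u) x := by
  unfold lap
  refine Finset.sum_congr rfl fun i _ => ?_
  have h1 : DifferentiableAt ℝ (fderiv ℝ u) x :=
    (h.fderiv_right (m := 1) (by norm_num)).differentiableAt (by norm_num)
  rw [iteratedFDeriv_two_apply]
  simp only [Matrix.cons_val_zero, Matrix.cons_val_one]
  have : pd i u = fun y => fderiv ℝ u y (EuclideanSpace.single i 1) := rfl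
  rw [this, pd, fderiv_clm_apply h1 (differentiableAt_const _)]
  simp

theorem fderiv_eq_pd {n : ℕ} (g : EuclideanSpace ℝ (Fin n) → ℝ) (x v : EuclideanSpace ℝ (Fin n)) :
    fderiv ℝ g x v = ∑ k, v k * pd k g x := by
  have hv : v = ∑ k, v k • (EuclideanSpace.single k (1:ℝ)) := by
    ext j
    simp [Finset.sum_apply, Pi.single_apply]
  conv_lhs => rw [hv]
  simp [pd]

theorem contDiffOn_pd {n : ℕ} {g : EuclideanSpace ℝ (Fin n) → ℝ} {s : Set (EuclideanSpace ℝ (Fin n))}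
    (hs : IsOpen s) (hg : ContDiffOn ℝ ∞ g s) (k : Fin n) : ContDiffOn ℝ ∞ (pd k g) s := by
  have := hg.fderiv_of_isOpen hs (m := ∞) (by simp)
  exact this.clm_apply contDiffOn_const

theorem pd_comm {n : ℕ} {g : EuclideanSpace ℝ (Fin n) → ℝ} {x : EuclideanSpace ℝ (Fin n)}
    (hg : ContDiffAt ℝ ∞ g x) (j k : Fin n) : pd j (pd k g) x = pd k (pd j g) x := by
  have h1 : DifferentiableAt ℝ (fderiv ℝ g) x :=
    (hg.fderiv_right (m := 1) (one_add_one_le_infty)).differentiableAt (by norm_num)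
  have key : ∀ a b : Fin n, pd a (pd b g) x = fderiv ℝ (fderiv ℝ g) x (EuclideanSpace.single a 1) (EuclideanSpace.single b 1) := by
    intro a b
    have : pd b g = fun y => fderiv ℝ g y (EuclideanSpace.single b 1) := rfl
    rw [this, pd, fderiv_clm_apply h1 (differentiableAt_const _)]
    simp
  rw [key, key]
  exact (hg.isSymmSndFDerivAt (by simpa [minSmoothness_of_isRCLikeNormedField] using two_le_infty)).eq _ _

theorem pd_mul {n : ℕ} {f g : EuclideanSpace ℝ (Fin n) → ℝ} {x : EuclideanSpace ℝ (Fin n)}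
    (hf : DifferentiableAt ℝ f x) (hg : DifferentiableAt ℝ g x) (k : Fin n) :
    pd k (fun y => f y * g y) x = f x * pd k g x + pd k f x * g x := by
  unfold pd
  rw [fderiv_fun_mul hf hg]
  simp; ring

theorem pd_add {n : ℕ} {f g : EuclideanSpace ℝ (Fin n) → ℝ} {x : EuclideanSpace ℝ (Fin n)}
    (hf : DifferentiableAt ℝ f x) (hg : DifferentiableAt ℝ g x) (k : Fin n) :
    pd k (fun y => f y + g y) x = pd k f x + pd k g x := by
  unfold pd
  rw [fderiv_fun_add hf hg]
  simp

theorem pd_congr {n : ℕ} {f g : EuclideanSpace ℝ (Fin n) → ℝ} {s : Set (EuclideanSpace ℝ (Fin n))}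
    (hs : IsOpen s) (h : EqOn f g s) (k : Fin n) : EqOn (pd k f) (pd k g) s := by
  intro x hx
  unfold pd
  rw [(h.eventuallyEq_of_mem (hs.mem_nhds hx)).fderiv_eq]

section LemG
variable {d : ℕ} {X F : Type*} [NormedAddCommGroup X] [NormedSpace ℝ X] [NormedAddCommGroup F]
  [NormedSpace ℝ F]
open scoped BoundedContinuousFunction

theorem bcf_exists {b : EuclideanSpace ℝ (Fin d) → X → F}
    (hb : Continuous (Function.uncurry b)) {K : Set X} (hK : IsCompact K)
    (h0 : ∀ s x, x ∉ K → b s x = 0) :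
    ∃ B : EuclideanSpace ℝ (Fin d) → (X →ᵇ F), ∀ s x, B s x = b s x := by
  have : ∀ s, ∃ B : X →ᵇ F, ∀ x, B x = b s x := by
    intro s
    have hc : Continuous (b s) := hb.comp (Continuous.prodMk_right s)
    obtain ⟨C, hC⟩ := hK.exists_bound_of_continuousOn hc.continuousOn
    refine ⟨BoundedContinuousFunction.ofNormedAddCommGroup (b s) hc (max C 0) ?_, fun x => rfl⟩
    intro x
    by_cases hx : x ∈ K
    · exact (hC x hx).trans (le_max_left _ _)
    · rw [h0 s x hx]; simp
  choose B hB using this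
  exact ⟨B, hB⟩

theorem bcf_hasFDerivAt {b : EuclideanSpace ℝ (Fin d) → X → F}
    (hb : ContDiff ℝ ∞ (Function.uncurry b)) {K : Set X} (hK : IsCompact K)
    (h0 : ∀ s x, x ∉ K → b s x = 0)
    {B : EuclideanSpace ℝ (Fin d) → (X →ᵇ F)} (hB : ∀ s x, B s x = b s x)
    {B' : Fin d → EuclideanSpace ℝ (Fin d) → (X →ᵇ F)}
    (hB' : ∀ i s x, B' i s x = fderiv ℝ (fun s' => b s' x) s (EuclideanSpace.single i 1))
    (s : EuclideanSpace ℝ (Fin d)) :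
    HasFDerivAt B (∑ i, (EuclideanSpace.proj i : EuclideanSpace ℝ (Fin d) →L[ℝ] ℝ).smulRight (B' i s)) s := by
  have hD : ContDiff ℝ ∞ (fun q : EuclideanSpace ℝ (Fin d) × X => fderiv ℝ (fun s' => b s' q.2) q.1) := by
    apply ContDiff.fderiv (m := ∞) (n := ∞) (f := fun (q : EuclideanSpace ℝ (Fin d) × X) s' => b s' q.2)
    · exact hb.comp (contDiff_snd.prodMk (contDiff_snd.comp contDiff_fst))
    · exact contDiff_fst
    · simp
  have hdiff : ∀ s x, HasFDerivAt (fun s' => b s' x) (fderiv ℝ (fun s' => b s' x) s) s := by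
    intro s x
    have : ContDiff ℝ ∞ (fun s' => b s' x) := hb.comp (contDiff_id.prodMk contDiff_const)
    exact (this.differentiable (by simp) s).hasFDerivAt
  have hsum : ∀ x h, (∑ i, (EuclideanSpace.proj i : EuclideanSpace ℝ (Fin d) →L[ℝ] ℝ).smulRight (B' i s)) h x
      = fderiv ℝ (fun s' => b s' x) s h := by
    intro x h
    have hv : h = ∑ k, h k • (EuclideanSpace.single k (1:ℝ)) := by
      ext j
      simp [Finset.sum_apply, Pi.single_apply]
    conv_rhs => rw [hv]
    simp [hB']
  rw [hasFDerivAt_iff_isLittleO, Asymptotics.isLittleO_iff]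
  intro ε hε
  have hopen : IsOpen {q : EuclideanSpace ℝ (Fin d) × X |
      ‖fderiv ℝ (fun s' => b s' q.2) q.1 - fderiv ℝ (fun s' => b s' q.2) s‖ < ε} := by
    apply isOpen_lt _ continuous_const
    apply Continuous.norm
    refine hD.continuous.sub ?_
    exact hD.continuous.comp (Continuous.prodMk_right s |>.comp continuous_snd)
  obtain ⟨U, V, hU, hV, hsU, hKV, hUV⟩ := generalized_tube_lemma (isCompact_singleton (x := s)) hK hopen
    (by rintro ⟨a, x⟩ ⟨ha, hx⟩; simp only [mem_singleton_iff] at ha; subst ha; simpa using hε)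
  obtain ⟨δ, hδ, hball⟩ := Metric.isOpen_iff.1 hU s (hsU rfl)
  filter_upwards [Metric.ball_mem_nhds s hδ] with s' hs'
  rw [BoundedContinuousFunction.norm_le (by positivity)]
  intro x
  have : (B s' - B s - (∑ i, (EuclideanSpace.proj i : EuclideanSpace ℝ (Fin d) →L[ℝ] ℝ).smulRight (B' i s)) (s' - s)) x
      = b s' x - b s x - fderiv ℝ (fun s' => b s' x) s (s' - s) := by
    rw [BoundedContinuousFunction.sub_apply, BoundedContinuousFunction.sub_apply, hsum, hB, hB]
  rw [this]
  by_cases hx : x ∈ K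
  · refine (convex_ball s δ).norm_image_sub_le_of_norm_hasFDerivWithin_le'
      (f := fun s' => b s' x) (f' := fun a => fderiv ℝ (fun s' => b s' x) a)
      (fun a _ => (hdiff a x).hasFDerivWithinAt) ?_ (Metric.mem_ball_self hδ) hs'
    intro a ha
    have hh := hUV (mk_mem_prod (hball ha) (hKV hx))
    rw [mem_setOf_eq] at hh
    exact hh.le
  · have : (fun s' => b s' x) = fun _ => 0 := by ext a; exact h0 a x hx
    rw [this, h0 _ x hx, h0 _ x hx]; simp; positivity

theorem bcf_contDiff {b : EuclideanSpace ℝ (Fin d) → X → F}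
    (hb : ContDiff ℝ ∞ (Function.uncurry b)) {K : Set X} (hK : IsCompact K)
    (h0 : ∀ s x, x ∉ K → b s x = 0)
    {B : EuclideanSpace ℝ (Fin d) → (X →ᵇ F)} (hB : ∀ s x, B s x = b s x) :
    ContDiff ℝ ∞ B := by
  rw [contDiff_infty]
  intro m
  induction m generalizing b B with
  | zero =>
    have : ∀ i : Fin d, ∃ B' : EuclideanSpace ℝ (Fin d) → (X →ᵇ F), ∀ s x, B' s x =
        (fun s x => fderiv ℝ (fun s' => b s' x) s (EuclideanSpace.single i 1)) s x := by
      intro i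
      refine bcf_exists ?_ hK ?_
      · have hD : ContDiff ℝ ∞ (fun q : EuclideanSpace ℝ (Fin d) × X => fderiv ℝ (fun s' => b s' q.2) q.1) := by
          apply ContDiff.fderiv (m := ∞) (n := ∞) (f := fun (q : EuclideanSpace ℝ (Fin d) × X) s' => b s' q.2)
          · exact hb.comp (contDiff_snd.prodMk (contDiff_snd.comp contDiff_fst))
          · exact contDiff_fst
          · simp
        exact (hD.clm_apply contDiff_const).continuous
      · intro s x hx
        have : (fun s' => b s' x) = fun _ => 0 := by ext a; exact h0 a x hx
        simp [this]
    choose B' hB' using this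
    simp only [Nat.cast_zero, contDiff_zero]
    exact continuous_iff_continuousAt.2 fun s => (bcf_hasFDerivAt hb hK h0 hB hB' s).continuousAt
  | succ m ih =>
    have hDi : ∀ i : Fin d, ContDiff ℝ ∞ (Function.uncurry
        (fun s x => fderiv ℝ (fun s' => b s' x) s (EuclideanSpace.single i 1))) := by
      intro i
      have hD : ContDiff ℝ ∞ (fun q : EuclideanSpace ℝ (Fin d) × X => fderiv ℝ (fun s' => b s' q.2) q.1) := by
        apply ContDiff.fderiv (m := ∞) (n := ∞) (f := fun (q : EuclideanSpace ℝ (Fin d) × X) s' => b s' q.2)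
        · exact hb.comp (contDiff_snd.prodMk (contDiff_snd.comp contDiff_fst))
        · exact contDiff_fst
        · simp
      exact hD.clm_apply contDiff_const
    have h0i : ∀ i : Fin d, ∀ s x, x ∉ K → 
        (fun s x => fderiv ℝ (fun s' => b s' x) s (EuclideanSpace.single i 1)) s x = 0 := by
      intro i s x hx
      have : (fun s' => b s' x) = fun _ => 0 := by ext a; exact h0 a x hx
      simp [this]
    have := fun i => bcf_exists (hDi i).continuous hK (h0i i)
    choose B' hB' using this
    have h1 := fun i => ih (hDi i) (h0i i) (hB' i)
    push_cast
    rw [contDiff_succ_iff_hasFDerivAt]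
    refine ⟨_, ?_, fun s => bcf_hasFDerivAt hb hK h0 hB hB' s⟩
    refine ContDiff.sum fun i _ => ?_
    exact (ContinuousLinearMap.smulRightL ℝ (EuclideanSpace ℝ (Fin d)) (X →ᵇ F)
      (EuclideanSpace.proj i)).contDiff.comp (h1 i)
end LemG

section A3a
variable {n : ℕ}
local notation "𝔼" => EuclideanSpace ℝ (Fin n)

theorem contDiff_det : ContDiff ℝ ∞ (fun L : 𝔼 →L[ℝ] 𝔼 => L.det) := by
  have : (fun L : 𝔼 →L[ℝ] 𝔼 => L.det) = fun L => ∑ σ : Equiv.Perm (Fin n),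
      (Equiv.Perm.sign σ : ℤ) • ∏ i, (L (EuclideanSpace.single i 1)) (σ i) := by
    ext L
    rw [ContinuousLinearMap.det, ← LinearMap.det_toMatrix (EuclideanSpace.basisFun (Fin n) ℝ).toBasis,
      Matrix.det_apply]
    refine Finset.sum_congr rfl fun σ _ => ?_
    simp only [LinearMap.toMatrix_apply, OrthonormalBasis.coe_toBasis, EuclideanSpace.basisFun_apply,
      OrthonormalBasis.coe_toBasis_repr_apply, EuclideanSpace.basisFun_repr]
    rfl
  rw [this]
  refine ContDiff.sum fun σ _ => ?_
  simp only [zsmul_eq_mul]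
  refine contDiff_const.mul (contDiff_prod fun i _ => ?_)
  have h : ContDiff ℝ ∞ (fun L : 𝔼 →L[ℝ] 𝔼 => L (EuclideanSpace.single i 1)) :=
    contDiff_id.clm_apply contDiff_const
  exact (EuclideanSpace.proj (𝕜 := ℝ) (σ i)).contDiff.comp h

/-- test functions -/
def TestF (Ω : Set 𝔼) (φ : 𝔼 → ℝ) : Prop :=
  ContDiff ℝ ∞ φ ∧ HasCompactSupport φ ∧ tsupport φ ⊆ Ω

theorem gradient_inner (h : 𝔼 → ℝ) (x v : 𝔼) : inner ℝ (gradient h x) v = fderiv ℝ h x v := by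
  unfold gradient; rw [InnerProductSpace.toDual_symm_apply]

theorem gradient_inner' (h : 𝔼 → ℝ) (x v : 𝔼) : inner ℝ v (gradient h x) = fderiv ℝ h x v := by
  rw [real_inner_comm, gradient_inner]

theorem norm_gradient (h : 𝔼 → ℝ) (x : 𝔼) : ‖gradient h x‖ = ‖fderiv ℝ h x‖ := by
  unfold gradient; exact LinearIsometryEquiv.norm_map _ _

theorem TestF.grad {Ω : Set 𝔼} {φ : 𝔼 → ℝ} (h : TestF Ω φ) :
    Continuous (gradient φ) ∧ HasCompactSupport (gradient φ) := by
  constructor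
  · unfold gradient
    exact (LinearIsometryEquiv.continuous _).comp (h.1.continuous_fderiv (by simp))
  · have : HasCompactSupport (fderiv ℝ φ) := h.2.1.fderiv (𝕜 := ℝ)
    exact this.comp_left (g := (InnerProductSpace.toDual ℝ 𝔼).symm) (map_zero _)

theorem memLp_of_cont {Ω : Set 𝔼} {F : Type*} [NormedAddCommGroup F] {g : 𝔼 → F}
    (hg : Continuous g) (hc : HasCompactSupport g) (p : ENNReal) : MemLp g p (volume.restrict Ω) :=
  (hg.memLp_of_hasCompactSupport hc).restrict Ω

theorem TestF.memLp {Ω : Set 𝔼} {φ : 𝔼 → ℝ} (h : TestF Ω φ) :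
    MemLp (gradient φ) 2 (volume.restrict Ω) := memLp_of_cont h.grad.1 h.grad.2 2

/-- gradients of test functions in L2 -/
def KK0 (Ω : Set 𝔼) : Submodule ℝ (Lp 𝔼 2 (volume.restrict Ω)) where
  carrier := {q | ∃ φ, TestF Ω φ ∧ q =ᵐ[volume.restrict Ω] gradient φ}
  zero_mem' := by
    refine ⟨0, ⟨contDiff_const, HasCompactSupport.zero, by simp [tsupport]⟩, ?_⟩
    filter_upwards [Lp.coeFn_zero 𝔼 2 (volume.restrict Ω)] with x hx
    rw [hx]; simp [gradient]
  add_mem' := by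
    rintro a b ⟨φ, h1, h2⟩ ⟨ψ, h3, h4⟩
    refine ⟨φ + ψ, ⟨h1.1.add h3.1, h1.2.1.add h3.2.1, (tsupport_add φ ψ).trans (union_subset h1.2.2 h3.2.2)⟩, ?_⟩
    filter_upwards [Lp.coeFn_add a b, h2, h4] with x e1 e2 e3
    rw [e1, Pi.add_apply, e2, e3]
    unfold gradient
    rw [fderiv_add (h1.1.differentiable (by simp) x) (h3.1.differentiable (by simp) x), map_add]
  smul_mem' := by
    rintro c a ⟨φ, h1, h2⟩
    refine ⟨fun x => c * φ x, ⟨contDiff_const.mul h1.1, h1.2.1.mul_left (f := fun _ => c),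
      (tsupport_mul_subset_right (f := fun _ => c) (g := φ)).trans h1.2.2⟩, ?_⟩
    filter_upwards [Lp.coeFn_smul c a, h2] with x e1 e2
    rw [e1, Pi.smul_apply, e2]
    unfold gradient
    rw [fderiv_const_mul (h1.1.differentiable (by simp) x) c, map_smulₛₗ]
    rfl

def KK (Ω : Set 𝔼) : Submodule ℝ (Lp 𝔼 2 (volume.restrict Ω)) := (KK0 Ω).topologicalClosure

instance (Ω : Set 𝔼) : CompleteSpace (KK Ω) := by
  unfold KK; exact (Submodule.isClosed_topologicalClosure _).completeSpace_coe

theorem TestF.toLp_mem {Ω : Set 𝔼} {φ : 𝔼 → ℝ} (h : TestF Ω φ) : h.memLp.toLp ∈ KK Ω :=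
  (KK0 Ω).le_topologicalClosure ⟨φ, h, h.memLp.coeFn_toLp⟩

theorem proj_eq_zero {Ω : Set 𝔼} {q : Lp 𝔼 2 (volume.restrict Ω)}
    (h : ∀ φ, TestF Ω φ → ∫ x in Ω, inner ℝ (q x) (gradient φ x) = 0) :
    (KK Ω).orthogonalProjectionOnto q = 0 := by
  rw [Submodule.orthogonalProjectionOnto_eq_zero_iff]
  have : q ∈ (KK0 Ω)ᗮ := by
    rw [Submodule.mem_orthogonal']
    rintro u ⟨φ, h1, h2⟩
    rw [L2.inner_def, ← h φ h1]
    refine integral_congr_ae ?_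
    filter_upwards [h2] with x hx
    rw [hx]
  unfold KK
  rwa [Submodule.orthogonal_closure]
end A3a

section A3b
variable {n : ℕ}
local notation "𝔼" => EuclideanSpace ℝ (Fin n)

/-- A smooth family of diffeomorphisms `x + η s x` preserving `Ω`. -/
structure DF (Ω C : Set 𝔼) (η : 𝔼 → 𝔼 → 𝔼) : Prop where
  smooth : ContDiff ℝ ∞ (Function.uncurry η)
  comp : IsCompact C
  off : ∀ s x, x ∉ C → η s x = 0
  zero : ∀ x, η 0 x = 0
  lip : ∀ s x, ‖fderiv ℝ (η s) x‖ ≤ 1 / 2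
  inv : ∀ s x, x ∈ Ω ↔ x + η s x ∈ Ω

/-- derivative of the diffeo -/
def DP (η : 𝔼 → 𝔼 → 𝔼) (s x : 𝔼) : 𝔼 →L[ℝ] 𝔼 := 1 + fderiv ℝ (η s) x

variable {Ω C : Set (EuclideanSpace ℝ (Fin n))} {η : EuclideanSpace ℝ (Fin n) → EuclideanSpace ℝ (Fin n) → EuclideanSpace ℝ (Fin n)}

theorem DF.smooth_s (h : DF Ω C η) (s : 𝔼) : ContDiff ℝ ∞ (η s) :=
  h.smooth.comp (contDiff_const.prodMk contDiff_id)

theorem DF.smoothP (h : DF Ω C η) : ContDiff ℝ ∞ (fun q : 𝔼 × 𝔼 => q.2 + η q.1 q.2) :=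
  contDiff_snd.add h.smooth

theorem DF.smoothP_s (h : DF Ω C η) (s : 𝔼) : ContDiff ℝ ∞ (fun x => x + η s x) :=
  contDiff_id.add (h.smooth_s s)

theorem DF.hasFDerivAt (h : DF Ω C η) (s x : 𝔼) :
    HasFDerivAt (fun x => x + η s x) (DP η s x) x :=
  (hasFDerivAt_id x).add ((h.smooth_s s).differentiable (by simp) x).hasFDerivAt

theorem DF.smoothD (h : DF Ω C η) : ContDiff ℝ ∞ (fun q : 𝔼 × 𝔼 => DP η q.1 q.2) := by
  refine contDiff_const.add ?_
  apply ContDiff.fderiv (m := ∞) (n := ∞) (f := fun (q : 𝔼 × 𝔼) x => η q.1 x)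
  · exact h.smooth.comp ((contDiff_fst.comp contDiff_fst).prodMk contDiff_snd)
  · exact contDiff_snd
  · simp

theorem DF.isUnit (h : DF Ω C η) (s x : 𝔼) : IsUnit (DP η s x) := by
  have := isUnit_one_sub_of_norm_lt_one (x := - fderiv ℝ (η s) x)
    (by rw [norm_neg]; linarith [h.lip s x])
  rwa [sub_neg_eq_add] at this

theorem DF.det_ne (h : DF Ω C η) (s x : 𝔼) : (DP η s x).det ≠ 0 := by
  obtain ⟨u, hu⟩ := h.isUnit s x
  rw [← hu]
  have h1 : (u : 𝔼 →L[ℝ] 𝔼).det * (↑u⁻¹ : 𝔼 →L[ℝ] 𝔼).det = 1 := by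
    have h2 : (u : 𝔼 →L[ℝ] 𝔼) * (↑u⁻¹ : 𝔼 →L[ℝ] 𝔼) = 1 := u.mul_inv
    have h3 := congrArg (fun L : 𝔼 →L[ℝ] 𝔼 => LinearMap.det (L : 𝔼 →ₗ[ℝ] 𝔼)) h2
    simp only [ContinuousLinearMap.toLinearMap_mul, map_mul] at h3
    unfold ContinuousLinearMap.det
    rw [h3]; exact LinearMap.det_id
  exact left_ne_zero_of_mul_eq_one h1

theorem DF.off_D (h : DF Ω C η) (s x : 𝔼) (hx : x ∉ C) : DP η s x = 1 := by
  have : η s =ᶠ[𝓝 x] fun _ => 0 := by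
    filter_upwards [h.comp.isClosed.isOpen_compl.mem_nhds hx] with y hy
    exact h.off s y hy
  unfold DP
  rw [this.fderiv_eq]; simp

theorem DF.exists_inv (h : DF Ω C η) (s : 𝔼) : ∃ Ψ : 𝔼 → 𝔼, ContDiff ℝ ∞ Ψ ∧
    (∀ x, Ψ (x + η s x) = x) ∧ (∀ x, Ψ x + η s (Ψ x) = x) := by
  have hl : LipschitzWith (1/2) (η s) :=
    lipschitzWith_of_nnnorm_fderiv_le ((h.smooth_s s).differentiable (by simp)) fun x => by
      rw [← NNReal.coe_le_coe]; simpa using h.lip s x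
  have ha : ApproximatesLinearOn (fun x => x + η s x) ((ContinuousLinearEquiv.refl ℝ 𝔼 : 𝔼 ≃L[ℝ] 𝔼) : 𝔼 →L[ℝ] 𝔼) univ (1/2) := by
    intro x _ y _
    have := hl.norm_sub_le x y
    simp only [ContinuousLinearEquiv.coe_coe, ContinuousLinearEquiv.coe_refl', id]
    have e : x + η s x - (y + η s y) - (x - y) = η s x - η s y := by abel
    simpa [e] using this
  have hc : Subsingleton 𝔼 ∨ (1/2 : NNReal) < ‖((ContinuousLinearEquiv.refl ℝ 𝔼).symm : 𝔼 →L[ℝ] 𝔼)‖₊⁻¹ := by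
    rcases subsingleton_or_nontrivial 𝔼 with h1 | h1
    · exact Or.inl h1
    · right
      have : ‖((ContinuousLinearEquiv.refl ℝ 𝔼).symm : 𝔼 →L[ℝ] 𝔼)‖₊ = 1 := by
        rw [← NNReal.coe_inj]
        exact ContinuousLinearMap.norm_id
      rw [this, ← NNReal.coe_lt_coe]; norm_num
  let H := ha.toHomeomorph _ hc
  have hH : ∀ x, H x = x + η s x := fun x => rfl
  refine ⟨H.symm, ?_, fun x => by rw [← hH, H.symm_apply_apply], fun x => by rw [← hH, H.apply_symm_apply]⟩
  refine H.contDiff_symm (f₀' := fun x => ContinuousLinearEquiv.ofUnit (h.isUnit s x).unit) ?_ (h.smoothP_s s)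
  intro x
  exact h.hasFDerivAt s x

theorem DF.injective (h : DF Ω C η) (s : 𝔼) : Function.Injective (fun x => x + η s x) := by
  obtain ⟨Ψ, _, h1, _⟩ := h.exists_inv s
  exact Function.LeftInverse.injective h1

theorem DF.image (h : DF Ω C η) (s : 𝔼) : (fun x => x + η s x) '' Ω = Ω := by
  obtain ⟨Ψ, _, h1, h2⟩ := h.exists_inv s
  ext y; constructor
  · rintro ⟨x, hx, rfl⟩; exact (h.inv s x).1 hx
  · intro hy
    refine ⟨Ψ y, ?_, h2 y⟩
    rw [h.inv s, h2]; exact hy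

/-- change of variables -/
theorem DF.cov (h : DF Ω C η) (hΩ : MeasurableSet Ω) (s : 𝔼) (g : 𝔼 → ℝ) :
    ∫ x in Ω, |(DP η s x).det| * g (x + η s x) = ∫ x in Ω, g x := by
  have := integral_image_eq_integral_abs_det_fderiv_smul volume hΩ
    (fun x _ => (h.hasFDerivAt s x).hasFDerivWithinAt) ((h.injective s).injOn) g
  rw [h.image s] at this
  rw [this]; rfl

theorem DF.lcov (h : DF Ω C η) (hΩ : MeasurableSet Ω) (s : 𝔼) (g : 𝔼 → ENNReal) :
    ∫⁻ x in Ω, ENNReal.ofReal |(DP η s x).det| * g (x + η s x) = ∫⁻ x in Ω, g x := by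
  have := lintegral_image_eq_lintegral_abs_det_fderiv_mul volume hΩ
    (fun x _ => (h.hasFDerivAt s x).hasFDerivWithinAt) ((h.injective s).injOn) g
  rw [h.image s] at this
  rw [this]

theorem DF.det_lower (h : DF Ω C η) (s : 𝔼) : ∃ c > 0, ∀ x, c ≤ |(DP η s x).det| := by
  have hc : Continuous (fun x => |(DP η s x).det|) := by
    have h1 := h.smoothD.continuous.comp (Continuous.prodMk_right s)
    exact (contDiff_det.continuous.comp h1).abs
  rcases C.eq_empty_or_nonempty with hC | hC
  · refine ⟨1, one_pos, fun x => ?_⟩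
    rw [h.off_D s x (by simp [hC])]
    change 1 ≤ |LinearMap.det LinearMap.id|
    simp
  · obtain ⟨x0, hx0, hmin⟩ := h.comp.exists_isMinOn hC hc.continuousOn
    refine ⟨min 1 |(DP η s x0).det|, lt_min one_pos (abs_pos.2 (h.det_ne s x0)), fun x => ?_⟩
    by_cases hx : x ∈ C
    · exact (min_le_right _ _).trans (hmin hx)
    · rw [h.off_D s x hx]
      refine (min_le_left _ _).trans ?_
      change 1 ≤ |LinearMap.det LinearMap.id|
      simp

theorem DF.lcov_le (h : DF Ω C η) (hΩ : MeasurableSet Ω) (s : 𝔼) : ∃ c : ENNReal, c ≠ ⊤ ∧ ∀ g : 𝔼 → ENNReal,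
    ∫⁻ x in Ω, g (x + η s x) ≤ c * ∫⁻ x in Ω, g x := by
  obtain ⟨c, hc, hcx⟩ := h.det_lower s
  refine ⟨(ENNReal.ofReal c)⁻¹, by simpa using hc, fun g => ?_⟩
  have hc0 : ENNReal.ofReal c ≠ 0 := by simpa using hc
  calc ∫⁻ x in Ω, g (x + η s x) = (ENNReal.ofReal c)⁻¹ * (ENNReal.ofReal c * ∫⁻ x in Ω, g (x + η s x)) := by
        rw [← mul_assoc, ENNReal.inv_mul_cancel hc0 (by simp), one_mul]
    _ ≤ _ := by
        rw [← h.lcov hΩ s g]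
        gcongr
        rw [← lintegral_const_mul' _ _ (by simp)]
        refine lintegral_mono fun x => ?_
        gcongr
        exact hcx x

theorem DF.testF (h : DF Ω C η) (s : 𝔼) {φ : 𝔼 → ℝ} (hφ : TestF Ω φ) :
    TestF Ω (fun x => φ (x + η s x)) := by
  have hcont : Continuous (fun x => x + η s x) := (h.smoothP_s s).continuous
  have hsub : tsupport (fun x => φ (x + η s x)) ⊆ (fun x => x + η s x) ⁻¹' tsupport φ :=
    tsupport_comp_subset_preimage φ hcont
  refine ⟨hφ.1.comp (h.smoothP_s s), ?_, ?_⟩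
  · refine HasCompactSupport.of_support_subset_isCompact (hφ.2.1.union h.comp) ?_
    intro x hx
    by_cases hxC : x ∈ C
    · exact Or.inr hxC
    · left
      rw [Function.mem_support, h.off s x hxC, add_zero] at hx
      exact subset_tsupport _ hx
  · intro x hx
    rw [h.inv s]; exact hφ.2.2 (hsub hx)

theorem DF.testF_inv (h : DF Ω C η) (s : 𝔼) {φ : 𝔼 → ℝ} (hφ : TestF Ω φ) :
    ∃ φ', TestF Ω φ' ∧ φ = fun x => φ' (x + η s x) := by
  obtain ⟨Ψ, h0, h1, h2⟩ := h.exists_inv s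
  have hsub : tsupport (fun x => φ (Ψ x)) ⊆ Ψ ⁻¹' tsupport φ :=
    tsupport_comp_subset_preimage φ h0.continuous
  refine ⟨fun x => φ (Ψ x), ⟨hφ.1.comp h0, ?_, ?_⟩, by ext x; simp only [h1]⟩
  · refine HasCompactSupport.of_support_subset_isCompact
      (hφ.2.1.image (h.smoothP_s s).continuous) ?_
    intro x hx
    exact ⟨Ψ x, subset_tsupport _ hx, h2 x⟩
  · intro x hx
    rw [← h2 x, ← h.inv s]; exact hφ.2.2 (hsub hx)
end A3b

section A3c
variable {n : ℕ}
local notation "𝔼" => EuclideanSpace ℝ (Fin n)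
variable {Ω C : Set (EuclideanSpace ℝ (Fin n))} {η : EuclideanSpace ℝ (Fin n) → EuclideanSpace ℝ (Fin n) → EuclideanSpace ℝ (Fin n)}

/-- columns of the inverse -/
def XI (η : 𝔼 → 𝔼 → 𝔼) (m : Fin n) (s x : 𝔼) : 𝔼 :=
  Ring.inverse (DP η s x) (EuclideanSpace.single m 1)

/-- transported coefficient matrix -/
def AM (η : 𝔼 → 𝔼 → 𝔼) (s x : 𝔼) : 𝔼 →L[ℝ] 𝔼 :=
  |(DP η s x).det| • ∑ m, (innerSL ℝ (XI η m s x)).smulRight (XI η m s x)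

theorem DF.D_XI (h : DF Ω C η) (m : Fin n) (s x : 𝔼) :
    DP η s x (XI η m s x) = EuclideanSpace.single m 1 := by
  have := Ring.mul_inverse_cancel _ (h.isUnit s x)
  unfold XI
  rw [← mul_apply_eq_comp, this]; rfl

theorem inner_gradient_eq (h1 h2 : 𝔼 → ℝ) (y : 𝔼) :
    inner ℝ (gradient h1 y) (gradient h2 y) = ∑ m, pd m h1 y * pd m h2 y := by
  rw [← OrthonormalBasis.sum_inner_mul_inner (EuclideanSpace.basisFun (Fin n) ℝ)]
  refine Finset.sum_congr rfl fun m _ => ?_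
  rw [gradient_inner, gradient_inner', EuclideanSpace.basisFun_apply]; rfl

theorem DF.inner_XI (h : DF Ω C η) (m : Fin n) (s x : 𝔼) {u : 𝔼 → ℝ}
    (hu : DifferentiableAt ℝ u (x + η s x)) :
    inner ℝ (XI η m s x) (gradient (fun x => u (x + η s x)) x) = pd m u (x + η s x) := by
  have e : fderiv ℝ (fun x => u (x + η s x)) x = (fderiv ℝ u (x + η s x)).comp (DP η s x) :=
    (hu.hasFDerivAt.comp x (h.hasFDerivAt s x)).fderiv
  rw [gradient_inner', e, ContinuousLinearMap.comp_apply, h.D_XI]; rfl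

theorem DF.AM_inner (h : DF Ω C η) (s x : 𝔼) {u φ : 𝔼 → ℝ}
    (hu : DifferentiableAt ℝ u (x + η s x)) (hφ : DifferentiableAt ℝ φ (x + η s x)) :
    inner ℝ (AM η s x (gradient (fun x => u (x + η s x)) x)) (gradient (fun x => φ (x + η s x)) x)
      = |(DP η s x).det| * inner ℝ (gradient u (x + η s x)) (gradient φ (x + η s x)) := by
  unfold AM
  rw [smul_apply, real_inner_smul_left, sum_apply, sum_inner,
    inner_gradient_eq]
  congr 1
  refine Finset.sum_congr rfl fun m _ => ?_
  rw [ContinuousLinearMap.smulRight_apply, real_inner_smul_left, innerSL_apply_apply, h.inner_XI m s x hu, h.inner_XI m s x hφ]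

theorem DF.AM_off (h : DF Ω C η) (s x : 𝔼) (hx : DP η s x = 1) : AM η s x = 1 := by
  unfold AM XI
  rw [hx]
  have h1 : (1 : 𝔼 →L[ℝ] 𝔼).det = 1 := LinearMap.det_id
  rw [h1, abs_one, one_smul, Ring.inverse_one]
  ext1 v
  rw [sum_apply]
  simp only [ContinuousLinearMap.smulRight_apply, innerSL_apply_apply, one_apply_eq_self]
  have := (EuclideanSpace.basisFun (Fin n) ℝ).sum_repr' v
  simpa only [EuclideanSpace.basisFun_apply] using this

theorem DF.AM_smooth (h : DF Ω C η) : ContDiff ℝ ∞ (fun q : 𝔼 × 𝔼 => AM η q.1 q.2) := by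
  have hXI : ∀ m, ContDiff ℝ ∞ (fun q : 𝔼 × 𝔼 => XI η m q.1 q.2) := by
    intro m
    rw [contDiff_iff_contDiffAt]
    intro q
    obtain ⟨u, hu⟩ := h.isUnit q.1 q.2
    have h1 : ContDiffAt ℝ ∞ (fun q : 𝔼 × 𝔼 => Ring.inverse (DP η q.1 q.2)) q := by
      have h2 := contDiffAt_ringInverse ℝ (n := ∞) u
      rw [hu] at h2
      exact h2.comp q h.smoothD.contDiffAt
    exact h1.clm_apply contDiffAt_const
  have hdet : ContDiff ℝ ∞ (fun q : 𝔼 × 𝔼 => |(DP η q.1 q.2).det|) := by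
    rw [contDiff_iff_contDiffAt]
    intro q
    exact (contDiffAt_abs (h.det_ne q.1 q.2)).comp q (contDiff_det.comp h.smoothD).contDiffAt
  unfold AM
  refine hdet.smul (ContDiff.sum fun m _ => ?_)
  exact ContDiff.smulRight ((innerSL ℝ).contDiff.comp (hXI m)) (hXI m)

theorem DF.eLpNorm_le (h : DF Ω C η) (hΩ : IsOpen Ω) (s : 𝔼) : ∃ c : ENNReal, c ≠ ⊤ ∧
    ∀ u : 𝔼 → ℝ, DifferentiableOn ℝ u Ω →
    eLpNorm (gradient (fun x => u (x + η s x))) 2 (volume.restrict Ω) ≤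
      c * eLpNorm (gradient u) 2 (volume.restrict Ω) := by
  obtain ⟨c, hc, hcx⟩ := h.lcov_le hΩ.measurableSet s
  refine ⟨2 * c ^ (1/2 : ℝ), ENNReal.mul_ne_top (by simp) (ENNReal.rpow_ne_top_of_nonneg (by norm_num) hc), fun u hu => ?_⟩
  have h1 : eLpNorm (gradient (fun x => u (x + η s x))) 2 (volume.restrict Ω) ≤
      2 * eLpNorm (fun x => gradient u (x + η s x)) 2 (volume.restrict Ω) := by
    have := eLpNorm_le_nnreal_smul_eLpNorm_of_ae_le_mul (c := 2) (f := gradient (fun x => u (x + η s x)))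
      (g := fun x => gradient u (x + η s x)) (μ := volume.restrict Ω) ?_ 2
    · simpa [ENNReal.smul_def] using this
    · filter_upwards [ae_restrict_mem hΩ.measurableSet] with x hx
      rw [← NNReal.coe_le_coe]
      push_cast
      rw [norm_gradient, norm_gradient]
      have hux := (hu _ ((h.inv s x).1 hx)).differentiableAt (hΩ.mem_nhds ((h.inv s x).1 hx))
      have e : fderiv ℝ (fun x => u (x + η s x)) x = (fderiv ℝ u (x + η s x)).comp (DP η s x) :=
        (hux.hasFDerivAt.comp x (h.hasFDerivAt s x)).fderiv
      rw [e]
      refine (ContinuousLinearMap.opNorm_comp_le _ _).trans ?_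
      rw [mul_comm]
      gcongr
      unfold DP
      refine (norm_add_le _ _).trans ?_
      have := h.lip s x
      have h2 : ‖(1 : 𝔼 →L[ℝ] 𝔼)‖ ≤ 1 := ContinuousLinearMap.norm_id_le
      linarith
  refine h1.trans ?_
  rw [mul_assoc]
  gcongr
  rw [eLpNorm_eq_lintegral_rpow_enorm_toReal (by simp) (by simp), eLpNorm_eq_lintegral_rpow_enorm_toReal (by simp) (by simp)]
  simp only [ENNReal.toReal_ofNat]
  rw [← ENNReal.mul_rpow_of_nonneg _ _ (by norm_num)]
  gcongr
  exact hcx (fun y => ‖gradient u y‖ₑ ^ (2:ℝ))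

theorem gradient_continuousOn {u : 𝔼 → ℝ} (hΩ : IsOpen Ω) (hu : ContDiffOn ℝ ∞ u Ω) : ContinuousOn (gradient u) Ω := by
  unfold gradient
  exact (LinearIsometryEquiv.continuous _).comp_continuousOn (hu.continuousOn_fderiv_of_isOpen hΩ (by simp))

/-- `h` is in the energy space -/
def InV (Ω : Set 𝔼) (u : 𝔼 → ℝ) : Prop := ∃ q ∈ KK Ω, q =ᵐ[volume.restrict Ω] gradient u

theorem DF.inV (h : DF Ω C η) (hΩ : IsOpen Ω) (s : 𝔼) {v : 𝔼 → ℝ} (hv : ContDiffOn ℝ ∞ v Ω)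
    (hV : InV Ω v) : InV Ω (fun x => v (x + η s x)) := by
  obtain ⟨q, hq, hqv⟩ := hV
  obtain ⟨c, hc, hcx⟩ := h.eLpNorm_le hΩ s
  have hv1 : ContDiffOn ℝ ∞ (fun x => v (x + η s x)) Ω :=
    hv.comp (h.smoothP_s s).contDiffOn fun x hx => (h.inv s x).1 hx
  have hmem : MemLp (gradient (fun x => v (x + η s x))) 2 (volume.restrict Ω) := by
    refine ⟨(gradient_continuousOn hΩ hv1).aestronglyMeasurable hΩ.measurableSet, ?_⟩
    refine (hcx v (hv.differentiableOn (by simp))).trans_lt ?_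
    rw [← eLpNorm_congr_ae hqv]
    exact ENNReal.mul_lt_top hc.lt_top (Lp.eLpNorm_lt_top q)
  refine ⟨hmem.toLp, ?_, hmem.coeFn_toLp⟩
  change hmem.toLp ∈ closure (KK0 Ω : Set (Lp 𝔼 2 (volume.restrict Ω)))
  have hq' : q ∈ closure (KK0 Ω : Set (Lp 𝔼 2 (volume.restrict Ω))) := hq
  rw [EMetric.mem_closure_iff] at hq' ⊢
  intro ε hε
  have hc1 : c + 1 ≠ ⊤ := by simp [hc]
  obtain ⟨q0, ⟨φ, hφ, hq0⟩, hd⟩ := hq' (ε / (c + 1)) (ENNReal.div_pos hε.ne' hc1)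
  have hT := h.testF s hφ
  refine ⟨hT.memLp.toLp, ⟨_, hT, hT.memLp.coeFn_toLp⟩, ?_⟩
  rw [Lp.edist_toLp_toLp]
  have hdif : DifferentiableOn ℝ (v - φ) Ω := (hv.differentiableOn (by simp)).sub (hφ.1.differentiable (by simp)).differentiableOn
  have key := hcx (v - φ) hdif
  have sub_grad : ∀ (a b : 𝔼 → ℝ) (x : 𝔼), DifferentiableAt ℝ a x → DifferentiableAt ℝ b x →
      gradient (a - b) x = gradient a x - gradient b x := by
    intro a b x ha hb
    unfold gradient
    rw [fderiv_sub ha hb, map_sub]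
  have e1 : eLpNorm (gradient (v - φ)) 2 (volume.restrict Ω) = edist q q0 := by
    rw [Lp.edist_def]
    refine eLpNorm_congr_ae ?_
    filter_upwards [ae_restrict_mem hΩ.measurableSet, hqv, hq0] with x hx h1 h2
    rw [Pi.sub_apply, h1, h2]
    exact sub_grad v φ x ((hv.differentiableOn (by simp) x hx).differentiableAt (hΩ.mem_nhds hx)) (hφ.1.differentiable (by simp) x)
  have e2 : eLpNorm (gradient (fun x => v (x + η s x)) - gradient (fun x => φ (x + η s x))) 2 (volume.restrict Ω)
      = eLpNorm (gradient (fun x => (v - φ) (x + η s x))) 2 (volume.restrict Ω) := by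
    refine eLpNorm_congr_ae ?_
    filter_upwards [ae_restrict_mem hΩ.measurableSet] with x hx
    rw [Pi.sub_apply, ← sub_grad _ _ x ((hv1.differentiableOn (by simp) x hx).differentiableAt (hΩ.mem_nhds hx)) (hT.1.differentiable (by simp) x)]
    rfl
  rw [e2]
  refine key.trans_lt ?_
  rw [e1]
  calc c * edist q q0 ≤ (c + 1) * edist q q0 := by gcongr; exact le_self_add
    _ < (c + 1) * (ε / (c + 1)) := by
        refine ENNReal.mul_lt_mul_right (by simp) hc1 hd
    _ = ε := ENNReal.mul_div_cancel (by simp) hc1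
end A3c

section A3d
variable {n : ℕ}
local notation "𝔼" => EuclideanSpace ℝ (Fin n)
variable {Ω C : Set (EuclideanSpace ℝ (Fin n))} {η : EuclideanSpace ℝ (Fin n) → EuclideanSpace ℝ (Fin n) → EuclideanSpace ℝ (Fin n)}

theorem DF.exists_M (h : DF Ω C η) [IsFiniteMeasure (volume.restrict Ω)] :
    ∃ M : 𝔼 → (Lp 𝔼 2 (volume.restrict Ω) →L[ℝ] Lp 𝔼 2 (volume.restrict Ω)), ContDiff ℝ ∞ M ∧
      (∀ s q, M s q =ᵐ[volume.restrict Ω] fun x => AM η s x (q x)) ∧ M 0 = 1 := by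
  have hs : ContDiff ℝ ∞ (Function.uncurry (fun s x => AM η s x - 1)) := h.AM_smooth.sub contDiff_const
  have h0 : ∀ s x, x ∉ C → (fun s x => AM η s x - 1) s x = 0 := by
    intro s x hx
    simp only [h.AM_off s x (h.off_D s x hx), sub_self]
  obtain ⟨B, hB⟩ := bcf_exists hs.continuous h.comp h0
  have hBs := bcf_contDiff hs h.comp h0 hB
  let L := (ContinuousLinearMap.holderL (volume.restrict Ω) ⊤ 2 2 (ContinuousLinearMap.id ℝ (𝔼 →L[ℝ] 𝔼))).comp
    (BoundedContinuousFunction.toLp (α := 𝔼) (E := 𝔼 →L[ℝ] 𝔼) ⊤ (volume.restrict Ω) ℝ)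
  have hM : ∀ s q, (1 + L (B s)) q =ᵐ[volume.restrict Ω] fun x => AM η s x (q x) := by
    intro s q
    have e1 := ContinuousLinearMap.coeFn_holder (r := 2) (ContinuousLinearMap.id ℝ (𝔼 →L[ℝ] 𝔼))
      (BoundedContinuousFunction.toLp (α := 𝔼) (E := 𝔼 →L[ℝ] 𝔼) ⊤ (volume.restrict Ω) ℝ (B s)) q
    have e2 := BoundedContinuousFunction.coeFn_toLp (α := 𝔼) (E := 𝔼 →L[ℝ] 𝔼) ⊤ (volume.restrict Ω) ℝ (B s)
    have e3 := Lp.coeFn_add q (L (B s) q)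
    filter_upwards [e1, e2, e3] with x h1 h2 h3
    change (q + L (B s) q : Lp 𝔼 2 (volume.restrict Ω)) x = _
    rw [h3, Pi.add_apply]
    change q x + (ContinuousLinearMap.holder 2 (ContinuousLinearMap.id ℝ (𝔼 →L[ℝ] 𝔼))
      (BoundedContinuousFunction.toLp (α := 𝔼) (E := 𝔼 →L[ℝ] 𝔼) ⊤ (volume.restrict Ω) ℝ (B s)) q) x = _
    rw [h1, h2, hB]
    simp
  refine ⟨fun s => 1 + L (B s), contDiff_const.add (L.contDiff.comp hBs), hM, ?_⟩
  ext1 q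
  refine Lp.ext ((hM 0 q).trans ?_)
  refine Eventually.of_forall fun x => ?_
  have : DP η 0 x = 1 := by
    have : η 0 = fun _ => 0 := by ext1 y; exact h.zero y
    unfold DP; rw [this]; simp
  simp only [h.AM_off 0 x this]; rfl

theorem DF.exists_g (h : DF Ω C η) [IsFiniteMeasure (volume.restrict Ω)] {G : 𝔼 → ℝ}
    (hG : ContDiff ℝ ∞ G) (hGc : HasCompactSupport G) :
    ∃ g : 𝔼 → Lp 𝔼 2 (volume.restrict Ω), ContDiff ℝ ∞ g ∧
      (∀ s, g s =ᵐ[volume.restrict Ω] gradient (fun x => G (x + η s x))) := by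
  have hs : ContDiff ℝ ∞ (Function.uncurry (fun s x => gradient (fun x => G (x + η s x)) x)) := by
    unfold gradient
    refine (InnerProductSpace.toDual ℝ 𝔼).symm.contDiff.comp (g := (InnerProductSpace.toDual ℝ 𝔼).symm) 
      (f := fun q : 𝔼 × 𝔼 => fderiv ℝ (fun x => G (x + η q.1 x)) q.2) ?_
    apply ContDiff.fderiv (m := ∞) (n := ∞) (f := fun (q : 𝔼 × 𝔼) x => G (x + η q.1 x))
    · exact hG.comp (h.smoothP.comp ((contDiff_fst.comp contDiff_fst).prodMk contDiff_snd))
    · exact contDiff_snd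
    · simp
  have hK : IsCompact (tsupport G ∪ C) := IsCompact.union hGc h.comp
  have h0 : ∀ s x, x ∉ tsupport G ∪ C → (fun s x => gradient (fun x => G (x + η s x)) x) s x = 0 := by
    intro s x hx
    have : (fun x => G (x + η s x)) =ᶠ[𝓝 x] fun _ => 0 := by
      filter_upwards [hK.isClosed.isOpen_compl.mem_nhds hx] with y hy
      rw [h.off s y (fun h => hy (Or.inr h)), add_zero]
      exact image_eq_zero_of_notMem_tsupport (fun h => hy (Or.inl h))
    simp only [gradient]
    rw [this.fderiv_eq]
    simp
  obtain ⟨B, hB⟩ := bcf_exists hs.continuous hK h0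
  have hBs := bcf_contDiff hs hK h0 hB
  refine ⟨fun s => BoundedContinuousFunction.toLp 2 (volume.restrict Ω) ℝ (B s),
    (ContinuousLinearMap.contDiff _).comp hBs, fun s => ?_⟩
  filter_upwards [BoundedContinuousFunction.coeFn_toLp 2 (volume.restrict Ω) ℝ (B s)] with x hx
  rw [hx, hB]

set_option maxHeartbeats 1000000 in
theorem DF.core (h : DF Ω C η) (hΩ : IsOpen Ω) (hb : Bornology.IsBounded Ω) {v G : 𝔼 → ℝ}
    (hv : ContDiffOn ℝ ∞ v Ω) (hV : InV Ω v) (hG : ContDiff ℝ ∞ G) (hGc : HasCompactSupport G)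
    (hw : ∀ φ, TestF Ω φ → ∫ x in Ω, inner ℝ (gradient v x + gradient G x) (gradient φ x) = 0) :
    ∃ S : Set 𝔼, IsOpen S ∧ 0 ∈ S ∧ ∃ P : 𝔼 → Lp 𝔼 2 (volume.restrict Ω), ContDiffOn ℝ ∞ P S ∧
      ∀ s ∈ S, P s =ᵐ[volume.restrict Ω] gradient (fun x => v (x + η s x)) := by
  haveI : IsFiniteMeasure (volume.restrict Ω) := ⟨by
    rw [Measure.restrict_apply_univ]; exact hb.measure_lt_top⟩
  obtain ⟨M, hMs, hM, hM0⟩ := h.exists_M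
  obtain ⟨g, hgs, hg⟩ := h.exists_g hG hGc
  have hp := fun s => h.inV hΩ s hv hV
  choose p hpK hp using hp
  let T : 𝔼 → (KK Ω →L[ℝ] KK Ω) := fun s =>
    ((KK Ω).orthogonalProjectionOnto.comp (M s)).comp (KK Ω).subtypeL
  let R : 𝔼 → KK Ω := fun s => - (KK Ω).orthogonalProjectionOnto (M s (g s))
  have hT : ContDiff ℝ ∞ T := (contDiff_const.clm_comp hMs).clm_comp contDiff_const
  have hR : ContDiff ℝ ∞ R := ((KK Ω).orthogonalProjectionOnto.contDiff.comp (hMs.clm_apply hgs)).neg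
  have hT0 : T 0 = 1 := by
    ext1 q
    simp only [T, hM0]
    exact Submodule.orthogonalProjectionOnto_mem_subspace_eq_self q
  have hTp : ∀ s, T s ⟨p s, hpK s⟩ = R s := by
    intro s
    have : (KK Ω).orthogonalProjectionOnto (M s (p s + g s)) = 0 := by
      refine proj_eq_zero fun φ hφ => ?_
      obtain ⟨φ', hφ', rfl⟩ := h.testF_inv s hφ
      rw [← hw φ' hφ', ← h.cov hΩ.measurableSet s (fun x => inner ℝ (gradient v x + gradient G x) (gradient φ' x))]
      refine integral_congr_ae ?_
      filter_upwards [ae_restrict_mem hΩ.measurableSet, hM s (p s + g s), Lp.coeFn_add (p s) (g s), hp s, hg s]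
        with x hx h1 h2 h3 h4
      have hx' := (h.inv s x).1 hx
      have hvx : DifferentiableAt ℝ v (x + η s x) := (hv.differentiableOn (by simp) _ hx').differentiableAt (hΩ.mem_nhds hx')
      have hGx : DifferentiableAt ℝ G (x + η s x) := hG.differentiable (by simp) _
      have hφx : DifferentiableAt ℝ φ' (x + η s x) := hφ'.1.differentiable (by simp) _
      rw [h1, h2, Pi.add_apply, h3, h4, map_add, inner_add_left, h.AM_inner s x hvx hφx, h.AM_inner s x hGx hφx,
        inner_add_left]
      ring
    rw [map_add, map_add] at this
    exact eq_neg_of_add_eq_zero_left this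
  refine ⟨T ⁻¹' {L | IsUnit L}, (Units.isOpen (R := KK Ω →L[ℝ] KK Ω)).preimage hT.continuous, ?_,
    fun s => (Ring.inverse (T s) (R s) : KK Ω), ?_, ?_⟩
  · rw [mem_preimage, hT0]; exact isUnit_one
  · intro s hs
    obtain ⟨u, hu⟩ := hs
    have h2 := contDiffAt_ringInverse ℝ (n := ∞) (R := KK Ω →L[ℝ] KK Ω) u
    rw [hu] at h2
    have h3 := (h2.comp s hT.contDiffAt).clm_apply hR.contDiffAt
    exact ((KK Ω).subtypeL.contDiff.contDiffAt.comp s h3).contDiffWithinAt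
  · intro s hs
    have : Ring.inverse (T s) (R s) = ⟨p s, hpK s⟩ := by
      have h5 : Ring.inverse (T s) * T s = 1 := Ring.inverse_mul_cancel (T s) hs
      rw [← hTp s]
      exact congrArg (fun L : KK Ω →L[ℝ] KK Ω => L ⟨p s, hpK s⟩) h5
    have h6 : ((Ring.inverse (T s) (R s) : KK Ω) : Lp 𝔼 2 (volume.restrict Ω)) = p s := by rw [this]
    have h7 := hp s
    rw [← h6] at h7
    exact h7
end A3d

section Chart
variable {n : ℕ}
local notation "𝔼" => EuclideanSpace ℝ (Fin n)
variable {Ω C : Set (EuclideanSpace ℝ (Fin n))} {η : EuclideanSpace ℝ (Fin n) → EuclideanSpace ℝ (Fin n) → EuclideanSpace ℝ (Fin n)}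

/-- boundary chart -/
structure BChart (Ω : Set 𝔼) (x₀ : 𝔼) (i : Fin n) (e : OpenPartialHomeomorph 𝔼 𝔼) : Prop where
  mem : x₀ ∈ e.source
  zero : e x₀ = 0
  smooth : ContDiffOn ℝ ∞ e e.source
  smooth_symm : ContDiffOn ℝ ∞ e.symm e.target
  inside : ∀ x ∈ e.source, x ∈ Ω ↔ e x i < 0
  front : ∀ x ∈ e.source, x ∈ frontier Ω ↔ e x i = 0

theorem euclid_decomp (v : 𝔼) : v = ∑ k, v k • (EuclideanSpace.single k (1:ℝ)) := by
  ext j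
  simp [Finset.sum_apply, Pi.single_apply]

theorem exists_bchart (hs : HasSmoothBoundary Ω) {x₀ : 𝔼} (hx₀ : x₀ ∈ frontier Ω) :
    ∃ i e, BChart Ω x₀ i e := by
  obtain ⟨U, ρ, hU, hxU, hρ, hd, h1, h2⟩ := hs x₀ hx₀
  obtain ⟨i, hi⟩ : ∃ i, pd i ρ x₀ ≠ 0 := by
    by_contra hcon
    push Not at hcon
    refine hd x₀ hxU ?_
    ext v
    rw [fderiv_eq_pd]; simp [hcon]
  let κ : 𝔼 → 𝔼 := fun x => x - x₀ + (ρ x - (x - x₀) i) • EuclideanSpace.single i 1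
  have hκi : ∀ x, κ x i = ρ x := by intro x; simp [κ]
  let V : Set 𝔼 := {x ∈ U | pd i ρ x ≠ 0}
  have hVo : IsOpen V := by
    have : ContinuousOn (pd i ρ) U := (contDiffOn_pd hU hρ i).continuousOn
    exact this.isOpen_inter_preimage hU isOpen_ne
  have hκs : ContDiffOn ℝ ∞ κ U := by
    refine (contDiffOn_id.sub contDiffOn_const).add (ContDiffOn.smul (hρ.sub ?_) contDiffOn_const)
    exact ((EuclideanSpace.proj (𝕜 := ℝ) i).contDiff.comp (contDiff_id.sub contDiff_const)).contDiffOn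
  let L : 𝔼 → (𝔼 →L[ℝ] 𝔼) := fun x => ContinuousLinearMap.id ℝ 𝔼 +
    (fderiv ℝ ρ x - EuclideanSpace.proj i).smulRight (EuclideanSpace.single i 1)
  have hκd : ∀ x ∈ U, HasFDerivAt κ (L x) x := by
    intro x hx
    have hρd : HasFDerivAt ρ (fderiv ℝ ρ x) x :=
      ((hρ.differentiableOn (by simp) x hx).differentiableAt (hU.mem_nhds hx)).hasFDerivAt
    have h3 : HasFDerivAt (fun x : 𝔼 => (x - x₀) i) (EuclideanSpace.proj (𝕜 := ℝ) i) x := 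
      (EuclideanSpace.proj (𝕜 := ℝ) i).hasFDerivAt.comp x ((hasFDerivAt_id x).sub_const x₀)
    exact ((hasFDerivAt_id x).sub_const x₀).add ((hρd.sub h3).smul_const _)
  have hLi : ∀ x ∈ V, Function.Injective (L x) := by
    intro x hx
    rw [injective_iff_map_eq_zero]
    intro v hv
    have hv' : ∀ j, (L x v) j = 0 := by intro j; rw [hv]; rfl
    have hj : ∀ j ≠ i, v j = 0 := by
      intro j hj
      have := hv' j
      simpa [L, Pi.single_apply, hj] using this
    have hi0 : v i = 0 := by
      have h3 := hv' i
      simp only [L] at h3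
      simp at h3
      rw [fderiv_eq_pd, Finset.sum_eq_single i] at h3
      · rcases mul_eq_zero.1 h3 with h | h
        · exact h
        · exact absurd h hx.2
      · intro b _ hb; rw [hj b hb, zero_mul]
      · simp
    ext j
    by_cases h : j = i
    · rw [h, hi0]; rfl
    · rw [hj j h]; rfl
  have hLe : ∀ x ∈ V, ∃ L' : 𝔼 ≃L[ℝ] 𝔼, (L' : 𝔼 →L[ℝ] 𝔼) = L x := by
    intro x hx
    refine ⟨(LinearEquiv.ofInjectiveEndo (L x : 𝔼 →ₗ[ℝ] 𝔼) (hLi x hx)).toContinuousLinearEquiv, ?_⟩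
    ext1 v; rfl
  have hxV : x₀ ∈ V := ⟨hxU, hi⟩
  obtain ⟨L0, hL0⟩ := hLe x₀ hxV
  have hca : ContDiffAt ℝ ∞ κ x₀ := hκs.contDiffAt (hU.mem_nhds hxU)
  have hda : HasFDerivAt κ (L0 : 𝔼 →L[ℝ] 𝔼) x₀ := by rw [hL0]; exact hκd x₀ hxU
  let e0 := hca.toOpenPartialHomeomorph κ hda (by simp)
  have he0 : ∀ x, e0 x = κ x := fun x => rfl
  have hm0 : x₀ ∈ e0.source := hca.mem_toOpenPartialHomeomorph_source hda (by simp)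
  let e := e0.restrOpen V hVo
  have hes : e.source = e0.source ∩ V := e0.restrOpen_source V hVo
  have he : ∀ x, e x = κ x := fun x => rfl
  have hsV : ∀ x ∈ e.source, x ∈ V := fun x hx => by rw [hes] at hx; exact hx.2
  refine ⟨i, e, ⟨by rw [hes]; exact ⟨hm0, hxV⟩, ?_, ?_, ?_, ?_, ?_⟩⟩
  · rw [he]
    have : ρ x₀ = 0 := by
      have : x₀ ∈ frontier Ω ∩ U := ⟨hx₀, hxU⟩
      rw [h2] at this; exact this.2
    simp [κ, this]
  · exact hκs.mono fun x hx => (hsV x hx).1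
  · intro y hy
    have hx := e.map_target hy
    obtain ⟨L', hL'⟩ := hLe _ (hsV _ hx)
    refine (e.contDiffAt_symm (f₀' := L') hy ?_ ?_).contDiffWithinAt
    · rw [hL']; exact hκd _ (hsV _ hx).1
    · exact hκs.contDiffAt (hU.mem_nhds (hsV _ hx).1)
  · intro x hx
    rw [he, hκi]
    have hxU := (hsV x hx).1
    have : x ∈ Ω ∩ U ↔ x ∈ {y ∈ U | ρ y < 0} := by rw [h1]
    constructor
    · intro h; exact (this.1 ⟨h, hxU⟩).2
    · intro h; exact (this.2 ⟨hxU, h⟩).1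
  · intro x hx
    rw [he, hκi]
    have hxU := (hsV x hx).1
    have : x ∈ frontier Ω ∩ U ↔ x ∈ {y ∈ U | ρ y = 0} := by rw [h2]
    constructor
    · intro h; exact (this.1 ⟨h, hxU⟩).2
    · intro h; exact (this.2 ⟨hxU, h⟩).1

theorem exists_trunc {R : ℝ} (hR : 0 < R) : ∃ θ : 𝔼 → 𝔼, ContDiff ℝ ∞ θ ∧ (∀ s, ‖θ s‖ < R) ∧
    ∀ s, ‖s‖ < R / 4 → θ s = s := by
  let b : ContDiffBump (0 : 𝔼) := ⟨R / 4, R / 2, by positivity, by linarith⟩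
  refine ⟨fun s => b s • s, b.contDiff.smul contDiff_id, ?_, ?_⟩
  · intro s
    by_cases hs : ‖s‖ < R / 2
    · rw [norm_smul, Real.norm_of_nonneg b.nonneg]
      calc b s * ‖s‖ ≤ 1 * ‖s‖ := by gcongr; exact b.le_one
        _ < R := by linarith
    · simp only
      rw [b.zero_of_le_dist (by simpa [b] using hs)]; simpa using hR
  · intro s hs
    simp only
    rw [b.one_of_mem_closedBall (by simpa [b] using hs.le), one_smul]

/-- projection killing coordinate i -/
def Prj (i : Fin n) : 𝔼 →L[ℝ] 𝔼 :=
  ContinuousLinearMap.id ℝ 𝔼 - (EuclideanSpace.proj i).smulRight (EuclideanSpace.single i 1)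

theorem Prj_apply (i : Fin n) (s : 𝔼) : Prj i s = s - s i • EuclideanSpace.single i 1 := rfl

theorem Prj_i (i : Fin n) (s : 𝔼) : Prj i s i = 0 := by simp [Prj_apply]

theorem Prj_j {i j : Fin n} (h : j ≠ i) (s : 𝔼) : Prj i s j = s j := by simp [Prj_apply, h]

theorem Prj_norm (i : Fin n) (s : 𝔼) : ‖Prj i s‖ ≤ ‖s‖ := by
  rw [EuclideanSpace.norm_eq, EuclideanSpace.norm_eq]
  gcongr with j
  by_cases h : j = i
  · subst h; rw [Prj_i]; simp
  · rw [Prj_j h]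

end Chart

section ExDF
variable {n : ℕ}
local notation "𝔼" => EuclideanSpace ℝ (Fin n)

theorem BChart.exDF {Ω : Set 𝔼} {x₀ : 𝔼} {i : Fin n} {e : OpenPartialHomeomorph 𝔼 𝔼} (h : BChart Ω x₀ i e) :
    ∃ C η r, DF Ω C η ∧ 0 < r ∧ ∀ s : 𝔼, ‖s‖ < r → ∀ x ∈ e.source, ‖e x‖ < r →
      x + η s x = e.symm (e x + Prj i s) := by
  classical
  obtain ⟨R2, hR2, hball⟩ := Metric.isOpen_iff.1 e.open_target 0 (by rw [← h.zero]; exact e.map_source h.mem)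
  obtain ⟨R, hR, rfl⟩ : ∃ R : ℝ, 0 < R ∧ R2 = 2 * R := ⟨R2 / 2, by positivity, by ring⟩
  obtain ⟨θ, hθs, hθR, hθ⟩ := exists_trunc (n := n) hR
  let b : ContDiffBump (0 : 𝔼) := ⟨R / 2, R, by positivity, by linarith⟩
  let η : 𝔼 → 𝔼 → 𝔼 := fun s x => if x ∈ e.source then e.symm (e x + b (e x) • Prj i (θ s)) - x else 0
  let C : Set 𝔼 := e.symm '' Metric.closedBall 0 R
  have hCb : Metric.closedBall (0 : 𝔼) R ⊆ e.target := (Metric.closedBall_subset_ball (by linarith)).trans hball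
  have hC : IsCompact C := (isCompact_closedBall _ _).image_of_continuousOn (e.continuousOn_symm.mono hCb)
  have hCs : C ⊆ e.source := by
    rintro _ ⟨y, hy, rfl⟩; exact e.map_target (hCb hy)
  have hCe : ∀ x ∈ e.source, x ∉ C → R < ‖e x‖ := by
    intro x hx hxC
    by_contra hcon
    exact hxC ⟨e x, by simpa using hcon, e.left_inv hx⟩
  have hCe' : ∀ x ∈ C, ‖e x‖ ≤ R := by
    rintro _ ⟨y, hy, rfl⟩
    rw [e.right_inv (hCb hy)]; simpa using hy
  have hb0 : ∀ x ∈ e.source, x ∉ C → b (e x) = 0 := by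
    intro x hx hxC
    exact b.zero_of_le_dist (by simpa [b] using (hCe x hx hxC).le)
  have harg : ∀ s x, ‖e x‖ ≤ R → e x + b (e x) • Prj i (θ s) ∈ e.target := by
    intro s x hx
    apply hball
    rw [mem_ball_zero_iff]
    have h1 : ‖b (e x) • Prj i (θ s)‖ < R := by
      rw [norm_smul, Real.norm_of_nonneg b.nonneg]
      calc b (e x) * ‖Prj i (θ s)‖ ≤ 1 * ‖θ s‖ := by
            gcongr
            · exact b.le_one
            · exact Prj_norm _ _
        _ < R := by linarith [hθR s]
    calc _ ≤ ‖e x‖ + ‖b (e x) • Prj i (θ s)‖ := norm_add_le _ _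
      _ < 2 * R := by linarith
  have hoff : ∀ s x, x ∉ C → η s x = 0 := by
    intro s x hx
    simp only [η]
    split_ifs with hxs
    · rw [hb0 x hxs hx]; simp [e.left_inv hxs]
    · rfl
  have hsm : ContDiff ℝ ∞ (Function.uncurry η) := by
    rw [contDiff_iff_contDiffAt]
    rintro ⟨s, x⟩
    by_cases hx : x ∈ C
    · have hxs := hCs hx
      have heq : Function.uncurry η =ᶠ[𝓝 (s, x)] fun q => e.symm (e q.2 + b (e q.2) • Prj i (θ q.1)) - q.2 := by
        have : {q : 𝔼 × 𝔼 | q.2 ∈ e.source} ∈ 𝓝 (s, x) :=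
          (e.open_source.preimage continuous_snd).mem_nhds hxs
        filter_upwards [this] with q hq
        simp only [Function.uncurry, η]
        rw [if_pos hq]
      refine ContDiffAt.congr_of_eventuallyEq ?_ heq
      have he : ContDiffAt ℝ ∞ (fun q : 𝔼 × 𝔼 => e q.2) (s, x) :=
        ContDiffAt.comp (s, x) (g := e) (h.smooth.contDiffAt (e.open_source.mem_nhds hxs)) contDiffAt_snd
      have hin : ContDiffAt ℝ ∞ (fun q : 𝔼 × 𝔼 => e q.2 + b (e q.2) • Prj i (θ q.1)) (s, x) := by
        refine he.add (ContDiffAt.smul (b.contDiff.contDiffAt.comp _ he) ?_)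
        exact ((Prj i).contDiff.comp (hθs.comp contDiff_fst)).contDiffAt
      refine ContDiffAt.sub ?_ contDiffAt_snd
      exact ContDiffAt.comp (s, x) (g := e.symm)
        (h.smooth_symm.contDiffAt (e.open_target.mem_nhds (harg s x (hCe' x hx)))) hin
    · have heq : Function.uncurry η =ᶠ[𝓝 (s, x)] fun q => 0 := by
        have : {q : 𝔼 × 𝔼 | q.2 ∈ Cᶜ} ∈ 𝓝 (s, x) :=
          (hC.isClosed.isOpen_compl.preimage continuous_snd).mem_nhds hx
        filter_upwards [this] with q hq
        exact hoff _ _ hq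
      exact contDiffAt_const.congr_of_eventuallyEq heq
  have hη0 : ∀ x, η 0 x = 0 := by
    intro x
    simp only [η]
    rw [hθ 0 (by simpa using hR)]
    split_ifs with hxs
    · simp [e.left_inv hxs]
    · rfl
  have hinv : ∀ s x, x ∈ Ω ↔ x + η s x ∈ Ω := by
    intro s x
    by_cases hx : x ∈ C
    · have hxs := hCs hx
      have ht := harg s x (hCe' x hx)
      have : x + η s x = e.symm (e x + b (e x) • Prj i (θ s)) := by
        simp only [η]; rw [if_pos hxs]; abel
      rw [this, h.inside x hxs, h.inside _ (e.map_target ht), e.right_inv ht]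
      simp [Prj_i]
    · rw [hoff s x hx, add_zero]
  -- small Lipschitz constant
  have hD : ContDiff ℝ ∞ (Function.uncurry (fun s x => fderiv ℝ (η s) x)) := by
    apply ContDiff.fderiv (m := ∞) (n := ∞) (f := fun (q : 𝔼 × 𝔼) x => η q.1 x)
    · exact hsm.comp ((contDiff_fst.comp contDiff_fst).prodMk contDiff_snd)
    · exact contDiff_snd
    · simp
  have hD0 : ∀ s x, x ∉ C → (fun s x => fderiv ℝ (η s) x) s x = 0 := by
    intro s x hx
    have : η s =ᶠ[𝓝 x] fun _ => 0 := by
      filter_upwards [hC.isClosed.isOpen_compl.mem_nhds hx] with y hy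
      exact hoff s y hy
    simp only [this.fderiv_eq]; simp
  obtain ⟨B, hB⟩ := bcf_exists hD.continuous hC hD0
  have hBc := (bcf_contDiff hD hC hD0 hB).continuous
  have hB0 : B 0 = 0 := by
    ext1 x
    have : η 0 = fun _ => 0 := by ext1 y; exact hη0 y
    rw [hB, this]; simp
  obtain ⟨r, hr, hrB⟩ : ∃ r > 0, ∀ s, ‖s‖ < r → ‖B s‖ < 1 / 2 := by
    have := Metric.continuous_iff.1 hBc 0 (1/2) (by norm_num)
    obtain ⟨r, hr, h1⟩ := this
    refine ⟨r, hr, fun s hs => ?_⟩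
    simpa [hB0] using h1 s (by simpa using hs)
  obtain ⟨θ2, hθ2s, hθ2R, hθ2⟩ := exists_trunc (n := n) hr
  refine ⟨C, fun s => η (θ2 s), min (r / 4) (R / 4), ⟨?_, hC, fun s x hx => hoff _ x hx, ?_, ?_, fun s x => hinv _ x⟩,
    by positivity, ?_⟩
  · exact hsm.comp ((hθ2s.comp contDiff_fst).prodMk contDiff_snd)
  · intro x
    rw [hθ2 0 (by simpa using hr)]; exact hη0 x
  · intro s x
    have := (B (θ2 s)).norm_coe_le_norm x
    rw [hB] at this
    exact this.trans (hrB _ (hθ2R s)).le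
  · intro s hs x hx hex
    simp only [η]
    rw [if_pos hx, hθ2 s (hs.trans_le (min_le_left _ _)), hθ s (hs.trans_le (min_le_right _ _)), b.one_of_mem_closedBall, one_smul]
    · abel
    · have := hex.trans_le (min_le_right _ _)
      simp only [b, mem_closedBall_zero_iff]
      linarith
end ExDF

section Rec
variable {n : ℕ} {Ω : Set (EuclideanSpace ℝ (Fin n))} {i : Fin n}
local notation "𝔼" => EuclideanSpace ℝ (Fin n)

def pdL : List (Fin n) → (𝔼 → ℝ) → 𝔼 → ℝ
  | [], h => h
  | k :: L, h => pdL L (pd k h)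

def TC (μ : Measure 𝔼) (κ : 𝔼 → 𝔼) (S : Set 𝔼) (i : Fin n) (h : 𝔼 → ℝ) : Prop :=
  ∃ P : 𝔼 → Lp ℝ 2 μ, ContDiffOn ℝ ∞ P S ∧ ∀ s ∈ S, P s =ᵐ[μ] fun x => h (κ x + Prj i s)

theorem TC.pd {μ : Measure 𝔼} {κ : 𝔼 → 𝔼} {S D : Set 𝔼} (hS : IsOpen S) {h : 𝔼 → ℝ} (hD : IsOpen D)
    (hh : DifferentiableOn ℝ h D) (hm : ∀ᵐ x ∂μ, ∀ s ∈ S, κ x + Prj i s ∈ D) (hT : TC μ κ S i h)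
    {j : Fin n} (hj : j ≠ i) : TC μ κ S i (pd j h) := by
  obtain ⟨P, hP, hPe⟩ := hT
  refine ⟨fun s => fderiv ℝ P s (EuclideanSpace.single j 1),
    (hP.fderiv_of_isOpen hS (m := ∞) (by simp)).clm_apply contDiffOn_const, fun s hs => ?_⟩
  have hPs : HasFDerivAt P (fderiv ℝ P s) s :=
    ((hP.differentiableOn (by simp) s hs).differentiableAt (hS.mem_nhds hs)).hasFDerivAt
  let t : ℕ → ℝ := fun m => 1 / ((m:ℝ) + 1)
  have ht : Tendsto t atTop (𝓝 0) := tendsto_one_div_add_atTop_nhds_zero_nat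
  have htp : ∀ m, t m ≠ 0 := fun m => by positivity
  let ej : 𝔼 := EuclideanSpace.single j 1
  have hPrj : Prj i ej = ej := by
    rw [Prj_apply]; simp [ej, hj]
  have ht' : Tendsto t atTop (𝓝[≠] 0) := tendsto_nhdsWithin_iff.2 ⟨ht, Eventually.of_forall htp⟩
  have slope : ∀ {F : Type} [NormedAddCommGroup F] [NormedSpace ℝ F] (f : 𝔼 → F) (y : 𝔼), DifferentiableAt ℝ f y →
      Tendsto (fun m => (t m)⁻¹ • (f (y + t m • ej) - f y)) atTop (𝓝 (fderiv ℝ f y ej)) := by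
    intro F _ _ f y hf
    have := (hf.hasFDerivAt.hasLineDerivAt ej).tendsto_slope_zero
    exact this.comp ht'
  have h1 := slope P s hPs.differentiableAt
  have h2 := tendstoInMeasure_of_tendsto_Lp h1
  obtain ⟨ns, hns, h3⟩ := h2.exists_seq_tendsto_ae
  have hev : ∀ᶠ m in atTop, s + t m • ej ∈ S := by
    have : Tendsto (fun m => s + t m • ej) atTop (𝓝 (s + (0:ℝ) • ej)) := (ht.smul_const ej).const_add s
    rw [zero_smul, add_zero] at this
    exact this (hS.mem_nhds hs)
  have h4 : ∀ᵐ x ∂μ, ∀ m, s + t m • ej ∈ S → ((t m)⁻¹ • (P (s + t m • ej) - P s) : Lp ℝ 2 μ) x =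
      (t m)⁻¹ • (h (κ x + Prj i s + t m • ej) - h (κ x + Prj i s)) := by
    rw [ae_all_iff]
    intro m
    by_cases hmS : s + t m • ej ∈ S
    · filter_upwards [hPe _ hmS, hPe s hs, Lp.coeFn_smul (t m)⁻¹ (P (s + t m • ej) - P s),
        Lp.coeFn_sub (P (s + t m • ej)) (P s)] with x a1 a2 a3 a4 _
      rw [a3, Pi.smul_apply, a4, Pi.sub_apply, a1, a2, map_add, map_smul, hPrj, add_assoc]
    · exact Eventually.of_forall fun x hx => absurd hx hmS
  filter_upwards [h3, h4, hm] with x a3 a4 a5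
  have hd : DifferentiableAt ℝ h (κ x + Prj i s) := (hh _ (a5 s hs)).differentiableAt (hD.mem_nhds (a5 s hs))
  refine tendsto_nhds_unique a3 ?_
  refine ((slope h _ hd).comp hns.tendsto_atTop).congr' ?_
  filter_upwards [hns.tendsto_atTop.eventually hev] with m hmS
  exact (a4 _ hmS).symm

theorem TC.pdL {μ : Measure 𝔼} {κ : 𝔼 → 𝔼} {S D : Set 𝔼} (hS : IsOpen S) (hD : IsOpen D)
    (hm : ∀ᵐ x ∂μ, ∀ s ∈ S, κ x + Prj i s ∈ D) (L : List (Fin n)) (hL : i ∉ L) : ∀ {h : 𝔼 → ℝ},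
    ContDiffOn ℝ ∞ h D → TC μ κ S i h → TC μ κ S i (pdL L h) := by
  induction L with
  | nil => intro h _ hT; exact hT
  | cons k L ih =>
    intro h hh hT
    simp only [List.mem_cons, not_or] at hL
    exact ih hL.2 (contDiffOn_pd hD hh k) (hT.pd hS hD (hh.differentiableOn (by simp)) hm (Ne.symm hL.1))

def Box (i : Fin n) (a : ℝ) : Set 𝔼 := {y | ∀ j, y j ∈ Ioo (-a) (if j = i then 0 else a)}

theorem isOpen_Box (i : Fin n) (a : ℝ) : IsOpen (Box i a) := by
  have : Box i a = ⋂ j, (fun y : 𝔼 => y j) ⁻¹' Ioo (-a) (if j = i then 0 else a) := by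
    ext y; simp [Box]
  rw [this]
  exact isOpen_iInter_of_finite fun j => isOpen_Ioo.preimage (by fun_prop)

theorem convex_Box (i : Fin n) (a : ℝ) : Convex ℝ (Box i a) := by
  have : Box i a = ⋂ j, (EuclideanSpace.proj j : 𝔼 →L[ℝ] ℝ) ⁻¹' Ioo (-a) (if j = i then 0 else a) := by
    ext y; simp [Box]
  rw [this]
  exact convex_iInter fun j => (convex_Ioo _ _).linear_preimage (EuclideanSpace.proj j : 𝔼 →L[ℝ] ℝ).toLinearMap

theorem Box_neg {i : Fin n} {a : ℝ} {y : 𝔼} (hy : y ∈ Box i a) : y i < 0 := by simpa using (hy i).2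


theorem BChart.tc {x₀ : 𝔼} {e : OpenPartialHomeomorph 𝔼 𝔼} (hc : BChart Ω x₀ i e)
    (hΩ : IsOpen Ω) (hb : Bornology.IsBounded Ω) {v G : 𝔼 → ℝ} (hv : ContDiffOn ℝ ∞ v Ω) (hV : InV Ω v)
    (hG : ContDiff ℝ ∞ G) (hGc : HasCompactSupport G)
    (hw : ∀ φ, TestF Ω φ → ∫ x in Ω, inner ℝ (gradient v x + gradient G x) (gradient φ x) = 0) :
    ∃ R > 0, Metric.closedBall 0 (2 * R) ⊆ e.target ∧ ∃ S, IsOpen S ∧ (0:𝔼) ∈ S ∧ S ⊆ Metric.ball 0 R ∧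
      ∀ k, TC ((volume.restrict Ω).restrict (e.source ∩ e ⁻¹' (Metric.ball 0 R ∩ {y | y i < 0}))) e S i
        (pd k (v ∘ e.symm)) := by
  obtain ⟨C, η, r, hDF, hr, hη⟩ := hc.exDF
  obtain ⟨S, hS, h0, P, hP, hPe⟩ := hDF.core hΩ hb hv hV hG hGc hw
  have h0t : (0:𝔼) ∈ e.target := hc.zero ▸ e.map_source hc.mem
  obtain ⟨r2, hr2, hr2t⟩ := Metric.isOpen_iff.1 e.open_target 0 h0t
  set R := min r r2 / 4 with hR
  have hRp : 0 < R := by positivity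
  have hR1 : 4 * R ≤ r := by rw [hR]; linarith [min_le_left r r2]
  have hR2 : 4 * R ≤ r2 := by rw [hR]; linarith [min_le_right r r2]
  have ht : Metric.closedBall (0:𝔼) (2 * R) ⊆ e.target :=
    (Metric.closedBall_subset_ball (by linarith)).trans hr2t
  refine ⟨R, hRp, ht, S ∩ Metric.ball 0 R, hS.inter Metric.isOpen_ball, ⟨h0, by simpa using hRp⟩, inter_subset_right, ?_⟩
  intro k
  set N := e.source ∩ e ⁻¹' (Metric.ball 0 R ∩ {y | y i < 0}) with hN
  have hNo : IsOpen N := e.isOpen_inter_preimage (Metric.isOpen_ball.inter (isOpen_lt (by fun_prop) continuous_const))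
  set μ := (volume.restrict Ω).restrict N
  let b : 𝔼 → 𝔼 := fun x => fderiv ℝ e.symm (e x) (EuclideanSpace.single k 1)
  have hsymc : ContinuousOn (fun y => fderiv ℝ e.symm y (EuclideanSpace.single k 1)) e.target :=
    ((hc.smooth_symm.fderiv_of_isOpen e.open_target (m := ∞) (by simp)).clm_apply contDiffOn_const).continuousOn
  obtain ⟨B, hB⟩ := (isCompact_closedBall (0:𝔼) (2 * R)).exists_bound_of_continuousOn (hsymc.mono ht)
  have hbm : MemLp b ⊤ μ := by
    refine memLp_top_of_bound (C := B) ?_ ?_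
    · refine ContinuousOn.aestronglyMeasurable ?_ hNo.measurableSet
      refine hsymc.comp (e.continuousOn.mono inter_subset_left) fun x hx => e.map_source hx.1
    · filter_upwards [ae_restrict_mem hNo.measurableSet] with x hx
      refine hB _ ?_
      have := hx.2.1
      rw [Metric.mem_ball] at this
      rw [Metric.mem_closedBall]; linarith
  let Λ : Lp 𝔼 2 (volume.restrict Ω) →L[ℝ] Lp ℝ 2 μ :=
    ((ContinuousLinearMap.holderL μ ⊤ 2 2 (innerSL ℝ)) (hbm.toLp b)).comp
      (LpToLpRestrictCLM 𝔼 𝔼 ℝ (volume.restrict Ω) 2 N)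
  have hΛ : ∀ q : Lp 𝔼 2 (volume.restrict Ω), Λ q =ᵐ[μ] fun x => inner ℝ (b x) (q x) := by
    intro q
    filter_upwards [ContinuousLinearMap.coeFn_holder (r := 2) (innerSL ℝ) (hbm.toLp b)
      (LpToLpRestrictCLM 𝔼 𝔼 ℝ (volume.restrict Ω) 2 N q), hbm.coeFn_toLp,
      LpToLpRestrictCLM_coeFn ℝ N q] with x h1 h2 h3
    change (ContinuousLinearMap.holder 2 (innerSL ℝ) (hbm.toLp b)
      (LpToLpRestrictCLM 𝔼 𝔼 ℝ (volume.restrict Ω) 2 N q)) x = _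
    rw [h1, h2, h3]; rfl
  refine ⟨fun s => Λ (P s), Λ.contDiff.comp_contDiffOn (hP.mono inter_subset_left), fun s hs => ?_⟩
  filter_upwards [hΛ (P s), ae_restrict_of_ae (hPe s hs.1), ae_restrict_mem hNo.measurableSet] with x h1 h2 h3
  rw [h1, h2, real_inner_comm, gradient_inner]
  have hsR : ‖s‖ < R := by simpa using hs.2
  have hxR : ‖e x‖ < R := by simpa using h3.2.1
  have hxt : e x + Prj i s ∈ Metric.closedBall (0:𝔼) (2 * R) := by
    rw [mem_closedBall_zero_iff]
    have := norm_add_le (e x) (Prj i s)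
    have := Prj_norm i s
    linarith
  have hev : (fun x => v (x + η s x)) =ᶠ[𝓝 x] fun x => (v ∘ e.symm) (e x + Prj i s) := by
    filter_upwards [hNo.mem_nhds h3] with z hz
    have hzR : ‖e z‖ < R := by simpa using hz.2.1
    rw [Function.comp_apply, hη s (by linarith) z hz.1 (by linarith)]
  rw [hev.fderiv_eq]
  have hneg : (e x + Prj i s) i < 0 := by
    have := h3.2.2
    simpa [Prj_i] using this
  have hsd : DifferentiableAt ℝ e.symm (e x + Prj i s) :=
    (hc.smooth_symm.differentiableOn (by simp) _ (ht hxt)).differentiableAt (e.open_target.mem_nhds (ht hxt))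
  have hin : e.symm (e x + Prj i s) ∈ Ω := by
    rw [hc.inside _ (e.map_target (ht hxt)), e.right_inv (ht hxt)]; exact hneg
  have hvd : DifferentiableAt ℝ v (e.symm (e x + Prj i s)) :=
    (hv.differentiableOn (by simp) _ hin).differentiableAt (hΩ.mem_nhds hin)
  have hwd : DifferentiableAt ℝ (v ∘ e.symm) (e x + Prj i s) := hvd.comp _ hsd
  have hed : DifferentiableAt ℝ e x := (hc.smooth.differentiableOn (by simp) x h3.1).differentiableAt (e.open_source.mem_nhds h3.1)
  have hext : e x ∈ e.target := e.map_source h3.1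
  have hsd0 : DifferentiableAt ℝ e.symm (e x) :=
    (hc.smooth_symm.differentiableOn (by simp) _ hext).differentiableAt (e.open_target.mem_nhds hext)
  have hcomp : HasFDerivAt (fun x => (v ∘ e.symm) (e x + Prj i s))
      ((fderiv ℝ (v ∘ e.symm) (e x + Prj i s)).comp (fderiv ℝ e x)) x :=
    HasFDerivAt.comp (g := v ∘ e.symm) (f := fun x => e x + Prj i s) x hwd.hasFDerivAt (hed.hasFDerivAt.add_const _)
  rw [hcomp.fderiv, ContinuousLinearMap.comp_apply, pd]
  congr 1
  have hid : HasFDerivAt (fun y => e (e.symm y)) ((fderiv ℝ e x).comp (fderiv ℝ e.symm (e x))) (e x) := by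
    have hed' : HasFDerivAt e (fderiv ℝ e x) (e.symm (e x)) := by rw [e.left_inv h3.1]; exact hed.hasFDerivAt
    exact hed'.comp (e x) hsd0.hasFDerivAt
  have hid2 : HasFDerivAt (fun y => e (e.symm y)) (ContinuousLinearMap.id ℝ 𝔼) (e x) := by
    refine (hasFDerivAt_id (e x)).congr_of_eventuallyEq ?_
    filter_upwards [e.open_target.mem_nhds hext] with y hy
    exact e.right_inv hy
  exact congrArg (fun A : 𝔼 →L[ℝ] 𝔼 => A (EuclideanSpace.single k 1)) (hid.unique hid2)

theorem BChart.integrable {x₀ : 𝔼} {e : OpenPartialHomeomorph 𝔼 𝔼} (hc : BChart Ω x₀ i e)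
    (hΩ : IsOpen Ω) (hb : Bornology.IsBounded Ω) {v G : 𝔼 → ℝ} (hv : ContDiffOn ℝ ∞ v Ω) (hV : InV Ω v)
    (hG : ContDiff ℝ ∞ G) (hGc : HasCompactSupport G)
    (hw : ∀ φ, TestF Ω φ → ∫ x in Ω, inner ℝ (gradient v x + gradient G x) (gradient φ x) = 0) :
    ∃ R > 0, Metric.closedBall 0 (2 * R) ⊆ e.target ∧ 
      ∀ L : List (Fin n), i ∉ L → ∀ k, IntegrableOn (pdL L (pd k (v ∘ e.symm))) (Metric.ball 0 R ∩ {y | y i < 0}) := by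
  obtain ⟨R, hR, ht, S, hS, h0, hSR, hT⟩ := hc.tc hΩ hb hv hV hG hGc hw
  refine ⟨R, hR, ht, fun L hL k => ?_⟩
  set D : Set 𝔼 := Metric.ball 0 (2 * R) ∩ {y | y i < 0} with hD
  have hDo : IsOpen D := Metric.isOpen_ball.inter (isOpen_lt (by fun_prop) continuous_const)
  set Q : Set 𝔼 := Metric.ball 0 R ∩ {y | y i < 0} with hQ
  have hQo : IsOpen Q := Metric.isOpen_ball.inter (isOpen_lt (by fun_prop) continuous_const)
  have hQt : Q ⊆ e.target := fun y hy => ht (Metric.ball_subset_closedBall (Metric.ball_subset_ball (by linarith) hy.1))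
  have hDt : D ⊆ e.target := fun y hy => ht (Metric.ball_subset_closedBall hy.1)
  set N := e.source ∩ e ⁻¹' Q with hN
  have hNo : IsOpen N := e.isOpen_inter_preimage hQo
  have hNΩ : N ⊆ Ω := fun x hx => (hc.inside x hx.1).2 hx.2.2
  have hμ : (volume.restrict Ω).restrict N = volume.restrict N := by
    rw [Measure.restrict_restrict hNo.measurableSet, inter_eq_left.2 hNΩ]
  have hwD : ContDiffOn ℝ ∞ (v ∘ e.symm) D := by
    refine hv.comp (hc.smooth_symm.mono hDt) fun y hy => ?_
    rw [hc.inside _ (e.map_target (hDt hy)), e.right_inv (hDt hy)]; exact hy.2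
  have hm : ∀ᵐ x ∂((volume.restrict Ω).restrict N), ∀ s ∈ S, e x + Prj i s ∈ D := by
    filter_upwards [ae_restrict_mem hNo.measurableSet] with x hx s hs
    refine ⟨?_, ?_⟩
    · rw [mem_ball_zero_iff]
      have h1 : ‖e x‖ < R := by simpa using hx.2.1
      have h2 : ‖s‖ < R := by simpa using hSR hs
      have := norm_add_le (e x) (Prj i s)
      have := Prj_norm i s
      linarith
    · have := hx.2.2
      simpa [Prj_i] using this
  obtain ⟨P, -, hPe⟩ := (hT k).pdL hS hDo hm L hL (contDiffOn_pd hDo hwD k)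
  set h := pdL L (pd k (v ∘ e.symm))
  have hh : IntegrableOn (fun x => h (e x)) N := by
    have h1 : MemLp (fun x => h (e x)) 2 (volume.restrict N) := by
      rw [← hμ]
      refine (memLp_congr_ae ?_).1 (Lp.memLp (P 0))
      filter_upwards [hPe 0 h0] with x hx
      rw [hx, map_zero, add_zero]
    have : IsFiniteMeasure (volume.restrict N) := 
      ⟨by rw [Measure.restrict_apply_univ]; exact (hb.subset hNΩ).measure_lt_top⟩
    exact h1.integrable (by norm_num)
  have him : e.symm '' Q = N := by
    rw [e.symm_image_eq_source_inter_preimage hQt]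
  have hinj : InjOn e.symm Q := e.symm.injOn.mono hQt
  have hder : ∀ y ∈ Q, HasFDerivWithinAt e.symm (fderiv ℝ e.symm y) Q y := fun y hy =>
    ((hc.smooth_symm.differentiableOn (by simp) _ (hQt hy)).differentiableAt (e.open_target.mem_nhds (hQt hy))).hasFDerivAt.hasFDerivWithinAt
  rw [← him, integrableOn_image_iff_integrableOn_abs_det_fderiv_smul volume hQo.measurableSet hder hinj] at hh
  have hh2 : IntegrableOn (fun y => |(fderiv ℝ e.symm y).det| • h y) Q := by
    refine (integrableOn_congr_fun ?_ hQo.measurableSet).1 hh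
    intro y hy
    simp only [e.right_inv (hQt hy)]
  have hne : ∀ y ∈ Metric.closedBall (0:𝔼) (2 * R), (fderiv ℝ e.symm y).det ≠ 0 := by
    intro y hy
    have hyt := ht hy
    have hxs := e.map_target hyt
    have hid : HasFDerivAt (fun y => e (e.symm y)) ((fderiv ℝ e (e.symm y)).comp (fderiv ℝ e.symm y)) y :=
      ((hc.smooth.differentiableOn (by simp) _ hxs).differentiableAt (e.open_source.mem_nhds hxs)).hasFDerivAt.comp y
        ((hc.smooth_symm.differentiableOn (by simp) _ hyt).differentiableAt (e.open_target.mem_nhds hyt)).hasFDerivAt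
    have hid2 : HasFDerivAt (fun y => e (e.symm y)) (ContinuousLinearMap.id ℝ 𝔼) y := by
      refine (hasFDerivAt_id y).congr_of_eventuallyEq ?_
      filter_upwards [e.open_target.mem_nhds hyt] with z hz
      exact e.right_inv hz
    have h2 := congrArg ContinuousLinearMap.det (hid.unique hid2)
    have h3 : (fderiv ℝ e (e.symm y)).det * (fderiv ℝ e.symm y).det = 1 := by
      rw [← LinearMap.det_id (A := ℝ) (M := 𝔼), ← ContinuousLinearMap.coe_id, ← ContinuousLinearMap.det, ← h2]
      simp only [ContinuousLinearMap.det, ContinuousLinearMap.toLinearMap_comp, LinearMap.det_comp]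
    intro h0
    rw [h0, mul_zero] at h3
    exact zero_ne_one h3
  have hdc : ContinuousOn (fun y => |(fderiv ℝ e.symm y).det|⁻¹) (Metric.closedBall 0 (2 * R)) := by
    have h1 : ContinuousOn (fun y => (fderiv ℝ e.symm y).det) (Metric.closedBall 0 (2 * R)) :=
      contDiff_det.continuous.comp_continuousOn ((hc.smooth_symm.fderiv_of_isOpen e.open_target (m := ∞) (by simp)).continuousOn.mono ht)
    exact h1.abs.inv₀ fun y hy => abs_ne_zero.2 (hne y hy)
  obtain ⟨B, hB⟩ := (isCompact_closedBall (0:𝔼) (2 * R)).exists_bound_of_continuousOn hdc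
  have hQc : Q ⊆ Metric.closedBall 0 (2 * R) := fun y hy => Metric.ball_subset_closedBall (Metric.ball_subset_ball (by linarith) hy.1)
  have h5 : IntegrableOn (fun y => |(fderiv ℝ e.symm y).det|⁻¹ * (|(fderiv ℝ e.symm y).det| • h y)) Q := by
    refine Integrable.bdd_mul (c := B) hh2 ((hdc.mono hQc).aestronglyMeasurable hQo.measurableSet) ?_
    filter_upwards [ae_restrict_mem hQo.measurableSet] with y hy using hB y (hQc hy)
  refine (integrableOn_congr_fun ?_ hQo.measurableSet).1 h5
  intro y hy
  have := abs_ne_zero.2 (hne y (hQc hy))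
  simp only [smul_eq_mul]
  field_simp

end Rec

section A4
variable {n : ℕ} {i : Fin n} {Q O K : Set (EuclideanSpace ℝ (Fin n))}
local notation "𝔼" => EuclideanSpace ℝ (Fin n)

theorem pdL_congr (hQ : IsOpen Q) (L : List (Fin n)) : ∀ {f g : 𝔼 → ℝ}, EqOn f g Q → EqOn (pdL L f) (pdL L g) Q := by
  induction L with
  | nil => exact fun h => h
  | cons k L ih => exact fun h => ih (pd_congr hQ h k)

theorem contDiffOn_pdL (hQ : IsOpen Q) (L : List (Fin n)) : ∀ {f : 𝔼 → ℝ}, ContDiffOn ℝ ∞ f Q →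
    ContDiffOn ℝ ∞ (pdL L f) Q := by
  induction L with
  | nil => exact fun h => h
  | cons k L ih => exact fun h => ih (contDiffOn_pd hQ h k)

theorem cd_diff {f : 𝔼 → ℝ} (hQ : IsOpen Q) (hf : ContDiffOn ℝ ∞ f Q) {y : 𝔼} (hy : y ∈ Q) : DifferentiableAt ℝ f y :=
  (hf.differentiableOn (by simp) y hy).differentiableAt (hQ.mem_nhds hy)

theorem pdL_add (hQ : IsOpen Q) (L : List (Fin n)) : ∀ {f g : 𝔼 → ℝ}, ContDiffOn ℝ ∞ f Q → ContDiffOn ℝ ∞ g Q →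
    EqOn (pdL L (fun y => f y + g y)) (fun y => pdL L f y + pdL L g y) Q := by
  induction L with
  | nil => exact fun _ _ => fun _ _ => rfl
  | cons k L ih =>
    intro f g hf hg
    have h1 : EqOn (pd k (fun y => f y + g y)) (fun y => pd k f y + pd k g y) Q := fun y hy =>
      pd_add (cd_diff hQ hf hy) (cd_diff hQ hg hy) k
    exact (pdL_congr hQ L h1).trans (ih (contDiffOn_pd hQ hf k) (contDiffOn_pd hQ hg k))

theorem pdL_perm (hQ : IsOpen Q) {L L' : List (Fin n)} (hp : L.Perm L') : ∀ {f : 𝔼 → ℝ}, ContDiffOn ℝ ∞ f Q →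
    EqOn (pdL L f) (pdL L' f) Q := by
  induction hp with
  | nil => exact fun _ _ _ => rfl
  | cons k _ ih => exact fun hf => ih (contDiffOn_pd hQ hf k)
  | swap a b L => exact fun hf => pdL_congr hQ L fun y hy => pd_comm (hf.contDiffAt (hQ.mem_nhds hy)) _ _
  | trans _ _ h1 h2 => exact fun hf => (h1 hf).trans (h2 hf)

def WW (Q : Set 𝔼) (i : Fin n) (m : ℕ) (h : 𝔼 → ℝ) : Prop :=
  ContDiffOn ℝ ∞ h Q ∧ ∀ L : List (Fin n), L.count i ≤ m → IntegrableOn (pdL L h) Q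

theorem WW.congr {m : ℕ} {h g : 𝔼 → ℝ} (hW : WW Q i m h) (hQ : IsOpen Q) (e : EqOn g h Q) : WW Q i m g :=
  ⟨hW.1.congr e, fun L hL => (integrableOn_congr_fun (pdL_congr hQ L e) hQ.measurableSet).2 (hW.2 L hL)⟩

theorem WW.mono {m m' : ℕ} {h : 𝔼 → ℝ} (hW : WW Q i m h) (hm : m' ≤ m) : WW Q i m' h :=
  ⟨hW.1, fun L hL => hW.2 L (hL.trans hm)⟩

theorem WW.pd_ne {m : ℕ} {h : 𝔼 → ℝ} (hW : WW Q i m h) (hQ : IsOpen Q) {j : Fin n} (hj : j ≠ i) : WW Q i m (pd j h) :=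
  ⟨contDiffOn_pd hQ hW.1 j, fun L hL => hW.2 (j :: L) (by rwa [List.count_cons_of_ne hj])⟩

theorem WW.pd_i {m : ℕ} {h : 𝔼 → ℝ} (hW : WW Q i (m+1) h) (hQ : IsOpen Q) : WW Q i m (pd i h) :=
  ⟨contDiffOn_pd hQ hW.1 i, fun L hL => hW.2 (i :: L) (by rw [List.count_cons_self]; omega)⟩

theorem WW.add {m : ℕ} {h g : 𝔼 → ℝ} (hW : WW Q i m h) (hW' : WW Q i m g) (hQ : IsOpen Q) :
    WW Q i m (fun y => h y + g y) :=
  ⟨hW.1.add hW'.1, fun L hL => (integrableOn_congr_fun (pdL_add hQ L hW.1 hW'.1) hQ.measurableSet).2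
    ((hW.2 L hL).add (hW'.2 L hL))⟩

theorem pd_zero (k : Fin n) : pd k (fun _ : 𝔼 => (0:ℝ)) = fun _ => 0 := by
  funext x; simp [pd]

theorem pdL_zero (L : List (Fin n)) : pdL L (fun _ : 𝔼 => (0:ℝ)) = fun _ => 0 := by
  induction L with
  | nil => rfl
  | cons k L ih => rw [pdL, pd_zero, ih]

theorem WW.sum {ι : Type*} {m : ℕ} {h : ι → 𝔼 → ℝ} (s : Finset ι) (hQ : IsOpen Q) (hW : ∀ a ∈ s, WW Q i m (h a)) :
    WW Q i m (fun y => ∑ a ∈ s, h a y) := by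
  classical
  induction s using Finset.induction_on with
  | empty => 
    refine ⟨by simpa using contDiffOn_const, fun L _ => ?_⟩
    simp only [Finset.sum_empty, pdL_zero]
    exact integrableOn_zero
  | insert a s ha ih =>
    simp only [Finset.sum_insert ha]
    exact (hW a (by simp)).add (ih fun b hb => hW b (by simp [hb])) hQ

theorem WW.mul_aux (hQ : IsOpen Q) (hO : IsOpen O) (hK : IsCompact K) (hQK : Q ⊆ K) (hKO : K ⊆ O) (L : List (Fin n)) :
    ∀ (m : ℕ) {c h : 𝔼 → ℝ}, ContDiffOn ℝ ∞ c O → WW Q i m h → L.count i ≤ m →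
    IntegrableOn (pdL L (fun y => c y * h y)) Q := by
  induction L with
  | nil =>
    intro m c h hc hW _
    obtain ⟨B, hB⟩ := hK.exists_bound_of_continuousOn (hc.continuousOn.mono hKO)
    refine Integrable.bdd_mul (c := B) (hW.2 [] (by simp)) ((hc.continuousOn.mono (hQK.trans hKO)).aestronglyMeasurable hQ.measurableSet) ?_
    filter_upwards [ae_restrict_mem hQ.measurableSet] with y hy using hB y (hQK hy)
  | cons k L ih =>
    intro m c h hc hW hm
    have hcQ := hc.mono (hQK.trans hKO)
    have h1 : EqOn (pd k (fun y => c y * h y)) (fun y => c y * pd k h y + pd k c y * h y) Q := fun y hy =>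
      pd_mul (cd_diff hQ hcQ hy) (cd_diff hQ hW.1 hy) k
    have h2 := (pdL_congr hQ L h1).trans (pdL_add hQ L (hcQ.mul (contDiffOn_pd hQ hW.1 k)) ((contDiffOn_pd hQ hcQ k).mul hW.1))
    refine (integrableOn_congr_fun h2 hQ.measurableSet).2 ?_
    by_cases hk : k = i
    · subst hk
      rw [List.count_cons_self] at hm
      obtain ⟨m', rfl⟩ : ∃ m', m = m' + 1 := ⟨m - 1, by omega⟩
      exact (ih m' hc (hW.pd_i hQ) (by omega)).add (ih m' (contDiffOn_pd hO hc k) (hW.mono (by omega)) (by omega))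
    · rw [List.count_cons_of_ne hk] at hm
      exact (ih m hc (hW.pd_ne hQ hk) hm).add (ih m (contDiffOn_pd hO hc k) hW hm)

theorem WW.mul (hQ : IsOpen Q) (hO : IsOpen O) (hK : IsCompact K) (hQK : Q ⊆ K) (hKO : K ⊆ O) 
    {m : ℕ} {c h : 𝔼 → ℝ} (hc : ContDiffOn ℝ ∞ c O) (hW : WW Q i m h) : WW Q i m (fun y => c y * h y) :=
  ⟨(hc.mono (hQK.trans hKO)).mul hW.1, fun L hL => WW.mul_aux hQ hO hK hQK hKO L m hc hW hL⟩

theorem WW.good (hO : IsOpen O) (hK : IsCompact K) (hQK : Q ⊆ K) (hKO : K ⊆ O) 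
    {m : ℕ} {c : 𝔼 → ℝ} (hc : ContDiffOn ℝ ∞ c O) : WW Q i m c :=
  ⟨hc.mono (hQK.trans hKO), fun L _ =>
    (((contDiffOn_pdL hO L hc).continuousOn.mono hKO).integrableOn_compact hK).mono_set hQK⟩

theorem WW.succ {m : ℕ} {h : 𝔼 → ℝ} (hQ : IsOpen Q) (hW : WW Q i m h) (hW' : WW Q i m (pd i h)) : WW Q i (m+1) h := by
  refine ⟨hW.1, fun L hL => ?_⟩
  by_cases hm : L.count i ≤ m
  · exact hW.2 L hm
  · have hi : i ∈ L := List.count_pos_iff.1 (by omega)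
    refine (integrableOn_congr_fun (pdL_perm hQ (List.perm_cons_erase hi) hW.1) hQ.measurableSet).2 (hW'.2 _ ?_)
    rw [List.count_erase_self]; omega

theorem WW.all (hQ : IsOpen Q) (hO : IsOpen O) (hK : IsCompact K) (hQK : Q ⊆ K) (hKO : K ⊆ O) {w F : 𝔼 → ℝ}
    {c : Fin n → Fin n → 𝔼 → ℝ} {d : Fin n → 𝔼 → ℝ} (hw : ContDiffOn ℝ ∞ w Q) (hF : ContDiffOn ℝ ∞ F O)
    (hc : ∀ a b, ContDiffOn ℝ ∞ (c a b) O) (hd : ∀ a, ContDiffOn ℝ ∞ (d a) O) (hcii : ∀ y, c i i y = 0)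
    (hPDE : ∀ y ∈ Q, pd i (pd i w) y = ∑ a, ∑ b, c a b y * pd a (pd b w) y + ∑ a, d a y * pd a w y + F y)
    (h0 : ∀ L : List (Fin n), i ∉ L → ∀ k, IntegrableOn (pdL L (pd k w)) Q) (m : ℕ) :
    ∀ k, WW Q i m (pd k w) := by
  induction m with
  | zero => exact fun k => ⟨contDiffOn_pd hQ hw k, fun L hL => h0 L (List.count_eq_zero.1 (by omega)) k⟩
  | succ m ih =>
    have h1 : ∀ k, k ≠ i → WW Q i m (pd i (pd k w)) := fun k hk =>
      ((ih i).pd_ne hQ hk).congr hQ fun y hy => pd_comm (hw.contDiffAt (hQ.mem_nhds hy)) _ _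
    intro k
    refine (ih k).succ hQ ?_
    by_cases hk : k = i
    · subst hk
      refine WW.congr ?_ hQ hPDE
      refine ((WW.sum _ hQ fun a _ => WW.sum _ hQ fun b _ => ?_).add (WW.sum _ hQ fun a _ => ?_) hQ).add (WW.good hO hK hQK hKO hF) hQ
      · by_cases ha : a = k
        · subst ha
          by_cases hb : b = a
          · subst hb
            simp only [hcii, zero_mul]
            exact WW.good hO hK hQK hKO contDiffOn_const
          · exact WW.mul hQ hO hK hQK hKO (hc _ _) (h1 b hb)
        · exact WW.mul hQ hO hK hQK hKO (hc _ _) ((ih b).pd_ne hQ ha)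
      · exact WW.mul hQ hO hK hQK hKO (hd _) (ih a)
    · exact h1 k hk

theorem BChart.pde {Ω : Set 𝔼} {x₀ : 𝔼} {e : OpenPartialHomeomorph 𝔼 𝔼} (hc : BChart Ω x₀ i e)
    {v G : 𝔼 → ℝ} (hΩ : IsOpen Ω) (hv : ContDiffOn ℝ ∞ v Ω) (hG : ContDiff ℝ ∞ G)
    (hl : ∀ x ∈ Ω, ∑ k, pd k (pd k v) x + ∑ k, pd k (pd k G) x = 0) :
    ∃ (c : Fin n → Fin n → 𝔼 → ℝ) (d : Fin n → 𝔼 → ℝ) (F : 𝔼 → ℝ), ContDiffOn ℝ ∞ F e.target ∧ 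
    (∀ a b, ContDiffOn ℝ ∞ (c a b) e.target) ∧ (∀ a, ContDiffOn ℝ ∞ (d a) e.target) ∧ (∀ y, c i i y = 0) ∧
    ∀ y ∈ e.target, y i < 0 → pd i (pd i (v ∘ e.symm)) y = 
      ∑ a, ∑ b, c a b y * pd a (pd b (v ∘ e.symm)) y + ∑ a, d a y * pd a (v ∘ e.symm) y + F y := by
  have hea : ∀ a, ContDiffOn ℝ ∞ (fun x => e x a) e.source := fun a =>
    (EuclideanSpace.proj a : 𝔼 →L[ℝ] ℝ).contDiff.comp_contDiffOn hc.smooth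
  have hes : ∀ {g : 𝔼 → ℝ}, ContDiffOn ℝ ∞ g e.source → ContDiffOn ℝ ∞ (fun y => g (e.symm y)) e.target :=
    fun hg => hg.comp hc.smooth_symm e.symm.mapsTo
  let A : Fin n → Fin n → 𝔼 → ℝ := fun a b x => ∑ k, pd k (fun x => e x a) x * pd k (fun x => e x b) x
  let B : Fin n → 𝔼 → ℝ := fun a x => ∑ k, pd k (pd k (fun x => e x a)) x
  have hA : ∀ a b, ContDiffOn ℝ ∞ (A a b) e.source := fun a b => ContDiffOn.sum fun k _ =>
    (contDiffOn_pd e.open_source (hea a) k).mul (contDiffOn_pd e.open_source (hea b) k)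
  have hB : ∀ a, ContDiffOn ℝ ∞ (B a) e.source := fun a => ContDiffOn.sum fun k _ =>
    contDiffOn_pd e.open_source (contDiffOn_pd e.open_source (hea a) k) k
  have hF : ContDiffOn ℝ ∞ (fun x => ∑ k, pd k (pd k G) x) e.source := ContDiffOn.sum fun k _ =>
    contDiffOn_pd e.open_source (contDiffOn_pd e.open_source hG.contDiffOn k) k
  have hpos : ∀ x ∈ e.source, A i i x ≠ 0 := by
    intro x hx h0
    have h1 : ∀ k, pd k (fun x => e x i) x = 0 := by
      intro k
      have := (Finset.sum_eq_zero_iff_of_nonneg (fun k _ => mul_self_nonneg _)).1 h0 k (Finset.mem_univ _)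
      exact mul_self_eq_zero.1 this
    have h2 : fderiv ℝ (fun x => e x i) x = 0 := by
      ext1 u
      rw [fderiv_eq_pd]; simp [h1]
    have hid2 : HasFDerivAt (fun y : 𝔼 => y i) (EuclideanSpace.proj i : 𝔼 →L[ℝ] ℝ) (e x) :=
      (EuclideanSpace.proj i : 𝔼 →L[ℝ] ℝ).hasFDerivAt
    have ht := e.map_source hx
    have hs : DifferentiableAt ℝ e.symm (e x) := (hc.smooth_symm.differentiableOn (by simp) _ ht).differentiableAt (e.open_target.mem_nhds ht)
    have h3 : HasFDerivAt (fun x => e x i) (0 : 𝔼 →L[ℝ] ℝ) (e.symm (e x)) := by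
      rw [e.left_inv hx, ← h2]; exact (cd_diff e.open_source (hea i) hx).hasFDerivAt
    have h4 : HasFDerivAt (fun y => e (e.symm y) i) _ (e x) := h3.comp (e x) hs.hasFDerivAt
    have h5 := h4.unique (hid2.congr_of_eventuallyEq (by
      filter_upwards [e.open_target.mem_nhds ht] with y hy
      rw [e.right_inv hy]))
    have h6 := congrArg (fun A : 𝔼 →L[ℝ] ℝ => A (EuclideanSpace.single i 1)) h5
    simp at h6
  refine ⟨fun a b y => if a = i ∧ b = i then 0 else -(A a b (e.symm y) / A i i (e.symm y)),
    fun a y => - (B a (e.symm y) / A i i (e.symm y)), 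
    fun y => - ((∑ k, pd k (pd k G) (e.symm y)) / A i i (e.symm y)), 
    ((hes hF).div (hes (hA i i)) fun y hy => hpos _ (e.map_target hy)).neg, ?_, fun a =>
    ((hes (hB a)).div (hes (hA i i)) fun y hy => hpos _ (e.map_target hy)).neg, by simp, ?_⟩
  · intro a b
    beta_reduce
    split_ifs
    · exact contDiffOn_const
    · exact ((hes (hA a b)).div (hes (hA i i)) fun y hy => hpos _ (e.map_target hy)).neg
  intro y hy hneg
  set x := e.symm y with hx
  have hxs : x ∈ e.source := e.map_target hy
  have hexy : e x = y := e.right_inv hy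
  set w := v ∘ e.symm with hw
  set D := e.target ∩ {y | y i < 0} with hD
  have hDo : IsOpen D := e.open_target.inter (isOpen_lt (by fun_prop) continuous_const)
  have hwD : ContDiffOn ℝ ∞ w D := by
    refine hv.comp (hc.smooth_symm.mono inter_subset_left) fun y hy => ?_
    rw [hc.inside _ (e.map_target hy.1), e.right_inv hy.1]; exact hy.2
  set N := e.source ∩ e ⁻¹' D with hN
  have hNo : IsOpen N := e.isOpen_inter_preimage hDo
  have hNs : N ⊆ e.source := inter_subset_left
  have hxN : x ∈ N := ⟨hxs, by rw [mem_preimage, hexy]; exact ⟨hy, hneg⟩⟩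
  have chain : ∀ {g : 𝔼 → ℝ}, ContDiffOn ℝ ∞ g D → ∀ k, ∀ z ∈ N, 
      pd k (fun z => g (e z)) z = ∑ a, pd a g (e z) * pd k (fun x => e x a) z := by
    intro g hg k z hz
    have h1 := (cd_diff hDo hg hz.2).hasFDerivAt.comp z 
      ((hc.smooth.differentiableOn (by simp) _ hz.1).differentiableAt (e.open_source.mem_nhds hz.1)).hasFDerivAt
    have h2 : pd k (fun z => g (e z)) z = fderiv ℝ g (e z) (fderiv ℝ e z (EuclideanSpace.single k 1)) := by
      change fderiv ℝ (g ∘ e) z _ = _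
      rw [h1.fderiv]; rfl
    rw [h2, fderiv_eq_pd]
    refine Finset.sum_congr rfl fun a _ => ?_
    rw [mul_comm]
    congr 1
    have h3 : HasFDerivAt (fun x => e x a) ((EuclideanSpace.proj a : 𝔼 →L[ℝ] ℝ).comp (fderiv ℝ e z)) z :=
      (EuclideanSpace.proj a : 𝔼 →L[ℝ] ℝ).hasFDerivAt.comp z ((hc.smooth.differentiableOn (by simp) _ hz.1).differentiableAt (e.open_source.mem_nhds hz.1)).hasFDerivAt
    rw [pd, h3.fderiv]; rfl
  have hsecond : ∀ k, pd k (pd k v) x = ∑ a, ((∑ b, pd b (pd a w) y * pd k (fun x => e x b) x) * pd k (fun x => e x a) x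
      + pd a w y * pd k (pd k (fun x => e x a)) x) := by
    intro k
    have e1 : EqOn v (fun z => w (e z)) N := fun z hz => by simp only [hw, Function.comp_apply, e.left_inv hz.1]
    have e2 : EqOn (pd k v) (fun z => ∑ a, pd a w (e z) * pd k (fun x => e x a) z) N :=
      (pd_congr hNo e1 k).trans (chain hwD k)
    rw [pd_congr hNo e2 k hxN]
    have hda : ∀ a, DifferentiableAt ℝ (fun z => pd a w (e z)) x := fun a =>
      cd_diff hNo ((contDiffOn_pd hDo hwD a).comp (hc.smooth.mono hNs) fun z hz => hz.2) hxN
    have hdb : ∀ a, DifferentiableAt ℝ (pd k (fun x => e x a)) x := fun a =>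
      cd_diff e.open_source (contDiffOn_pd e.open_source (hea a) k) hxs
    have e3 : pd k (fun z => ∑ a, pd a w (e z) * pd k (fun x => e x a) z) x =
        ∑ a, pd k (fun z => pd a w (e z) * pd k (fun x => e x a) z) x := by
      have := fderiv_fun_sum (u := Finset.univ) (A := fun a z => pd a w (e z) * pd k (fun x => e x a) z)
        (x := x) (𝕜 := ℝ) fun a _ => (hda a).mul (hdb a)
      rw [pd, this, sum_apply]
      rfl
    rw [e3]
    refine Finset.sum_congr rfl fun a _ => ?_
    rw [pd_mul (hda a) (hdb a), chain (contDiffOn_pd hDo hwD a) k x hxN, hexy]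
    ring
  have hmain := hl x ((hc.inside x hxs).2 (by rw [hexy]; exact hneg))
  have e4 : ∑ k, pd k (pd k v) x = ∑ a, ∑ b, A a b x * pd a (pd b w) y + ∑ a, B a x * pd a w y := by
    simp only [hsecond, A, B, Finset.sum_mul, Finset.sum_add_distrib]
    congr 1
    · rw [Finset.sum_comm]
      conv_rhs => rw [Finset.sum_comm]
      refine Finset.sum_congr rfl fun a _ => ?_
      rw [Finset.sum_comm]
      refine Finset.sum_congr rfl fun b _ => Finset.sum_congr rfl fun k _ => ?_
      ring
    · rw [Finset.sum_comm]
      refine Finset.sum_congr rfl fun a _ => Finset.sum_congr rfl fun k _ => ?_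
      ring
  have e5 : ∑ a, ∑ b, A a b x * pd a (pd b w) y = A i i x * pd i (pd i w) y - A i i x *
      ∑ a, ∑ b, (if a = i ∧ b = i then 0 else -(A a b x / A i i x)) * pd a (pd b w) y := by
    have e6 : ∀ a b, (if a = i ∧ b = i then 0 else -(A a b x / A i i x)) * pd a (pd b w) y = 
      (if a = i then (if b = i then pd i (pd i w) y else 0) else 0) - A a b x * pd a (pd b w) y / A i i x := by
      intro a b
      by_cases ha : a = i
      · subst ha
        by_cases hb : b = a
        · subst hb
          have := hpos x hxs
          simp; field_simp; ring
        · simp [hb]; ring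
      · simp [ha]; ring
    simp only [e6, Finset.sum_sub_distrib]
    simp only [← Finset.sum_div]
    have := hpos x hxs
    simp
    field_simp
    ring
  rw [e4, e5] at hmain
  have hp := hpos x hxs
  have e7 : ∑ a, -(B a x / A i i x) * pd a w y = - (∑ a, B a x * pd a w y) / A i i x := by
    rw [← Finset.sum_neg_distrib, Finset.sum_div]
    refine Finset.sum_congr rfl fun a _ => ?_
    ring
  simp only [e7]
  set T := ∑ a, ∑ b, (if a = i ∧ b = i then 0 else -(A a b x / A i i x)) * pd a (pd b w) y
  have e8 : A i i x * pd i (pd i w) y = A i i x * T + - (∑ a, B a x * pd a w y) - ∑ k, pd k (pd k G) x := by linarith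
  have e9 : pd i (pd i w) y = (A i i x * T + - (∑ a, B a x * pd a w y) - ∑ k, pd k (pd k G) x) / A i i x := by
    rw [← e8]; field_simp
  have key : ∀ {α t b f : ℝ}, α ≠ 0 → (α * t + -b - f) / α = t + -b / α + -(f / α) := by
    intro α t b f h; field_simp; ring
  rw [e9, key hp, ← e7]
end A4

section A5
open scoped ENNReal
variable {n : ℕ} {i : Fin n} {Q : Set (EuclideanSpace ℝ (Fin n))}
local notation "𝔼" => EuclideanSpace ℝ (Fin n)

theorem one_dim {l r : ℝ} (hlr : l < r) {g g' : ℝ → ℝ} (hg : ∀ t ∈ Ioo l r, HasDerivAt g (g' t) t)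
    (hc : ContinuousOn g' (Ioo l r)) {x : ℝ} (hx : x ∈ Ioo l r) :
    ‖g x‖ₑ ≤ ENNReal.ofReal (r - l)⁻¹ * (∫⁻ t in Ioo l r, ‖g t‖ₑ) + ∫⁻ t in Ioo l r, ‖g' t‖ₑ := by
  have h1 : ∀ y ∈ Ioo l r, ‖g x‖ₑ ≤ ‖g y‖ₑ + ∫⁻ t in Ioo l r, ‖g' t‖ₑ := by
    intro y hy
    have hsub : uIcc y x ⊆ Ioo l r := ordConnected_Ioo.uIcc_subset hy hx
    have h2 := intervalIntegral.integral_eq_sub_of_hasDerivAt (a := y) (b := x) (fun t ht => hg t (hsub ht))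
      ((hc.mono hsub).intervalIntegrable)
    have h3 : g x = g y + ∫ t in y..x, g' t := by rw [h2]; ring
    rw [h3]
    refine (enorm_add_le _ _).trans ?_
    gcongr
    rw [intervalIntegral.intervalIntegral_eq_integral_uIoc, enorm_smul]
    have : ‖(if y ≤ x then (1:ℝ) else -1)‖ₑ = 1 := by split_ifs <;> simp
    rw [this, one_mul]
    refine (enorm_integral_le_lintegral_enorm _).trans ?_
    exact lintegral_mono_set (uIoc_subset_uIcc.trans hsub)
  have h4 : ∫⁻ y in Ioo l r, ‖g x‖ₑ ≤ ∫⁻ y in Ioo l r, (‖g y‖ₑ + ∫⁻ t in Ioo l r, ‖g' t‖ₑ) :=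
    setLIntegral_mono' measurableSet_Ioo h1
  rw [lintegral_add_right _ measurable_const] at h4
  simp only [lintegral_const, Measure.restrict_apply_univ, Real.volume_Ioo] at h4
  set d := ENNReal.ofReal (r - l) with hd
  have hd0 : d ≠ 0 := by simp [hd, hlr]
  have hdt : d ≠ ⊤ := by simp [hd]
  have hdi : ENNReal.ofReal (r - l)⁻¹ = d⁻¹ := ENNReal.ofReal_inv_of_pos (by linarith)
  rw [hdi]
  calc ‖g x‖ₑ = d⁻¹ * (‖g x‖ₑ * d) := by
        rw [mul_comm _ d, ← mul_assoc, ENNReal.inv_mul_cancel hd0 hdt, one_mul]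
    _ ≤ d⁻¹ * ((∫⁻ t in Ioo l r, ‖g t‖ₑ) + (∫⁻ t in Ioo l r, ‖g' t‖ₑ) * d) := by gcongr
    _ = _ := by
        rw [mul_add, mul_comm _ d, ← mul_assoc, ENNReal.inv_mul_cancel hd0 hdt, one_mul]

def FH (i : Fin n) (a : ℝ) (h : 𝔼 → ℝ) : (Fin n → ℝ) → ℝ≥0∞ := fun x =>
  (Box i a).indicator (fun y => ‖h y‖ₑ) (WithLp.toLp 2 x)

theorem FH_meas {a : ℝ} {h : 𝔼 → ℝ} (hh : ContDiffOn ℝ ∞ h (Box i a)) : Measurable (FH i a h) := by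
  have h1 : Measurable ((Box i a).indicator (fun y => ‖h y‖ₑ)) := by
    classical
    rw [← piecewise_eq_indicator]
    exact ContinuousOn.measurable_piecewise hh.continuousOn.enorm continuousOn_const (isOpen_Box i a).measurableSet
  exact h1.comp (PiLp.continuous_toLp 2 _).measurable

theorem FH_le {a : ℝ} (ha : 0 < a) {h : 𝔼 → ℝ} (hh : ContDiffOn ℝ ∞ h (Box i a)) (k : Fin n) (x : Fin n → ℝ) :
    FH i a h x ≤ ENNReal.ofReal a⁻¹ * (∫⁻ t, FH i a h (Function.update x k t)) +
      ∫⁻ t, FH i a (pd k h) (Function.update x k t) := by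
  by_cases hx : WithLp.toLp 2 x ∈ Box i a
  swap
  · have : FH i a h x = 0 := indicator_of_notMem hx _
    rw [this]; exact zero_le
  set r : ℝ := if k = i then 0 else a with hr
  have hmem : ∀ t, (WithLp.toLp 2 (Function.update x k t) : 𝔼) ∈ Box i a ↔ t ∈ Ioo (-a) r := by
    intro t
    constructor
    · intro h; simpa using h k
    · intro h j
      by_cases hj : j = k
      · subst hj; simpa using h
      · have := hx j
        simpa [hj] using this
  have hlin : ∀ t, (WithLp.toLp 2 (Function.update x k t) : 𝔼) = WithLp.toLp 2 x + (t - x k) • EuclideanSpace.single k (1:ℝ) := by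
    intro t; ext j
    by_cases hj : j = k
    · subst hj; simp
    · simp [hj]
  have hal : a ≤ r - (-a) := by rw [hr]; split_ifs <;> linarith
  have hF : ∀ g : 𝔼 → ℝ, ∫⁻ t, FH i a g (Function.update x k t) = ∫⁻ t in Ioo (-a) r, ‖g (WithLp.toLp 2 (Function.update x k t))‖ₑ := by
    intro g
    rw [← lintegral_indicator measurableSet_Ioo]
    refine lintegral_congr fun t => ?_
    by_cases ht : t ∈ Ioo (-a) r
    · rw [indicator_of_mem ht]; exact indicator_of_mem ((hmem t).2 ht) _
    · rw [indicator_of_notMem ht]; exact indicator_of_notMem (fun h => ht ((hmem t).1 h)) _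
  rw [hF, hF]
  have hcurve : ∀ t, HasDerivAt (fun t => (WithLp.toLp 2 (Function.update x k t) : 𝔼)) (EuclideanSpace.single k (1:ℝ)) t := by
    intro t
    simp only [hlin]
    have := (((hasDerivAt_id t).sub_const (x k)).smul_const (EuclideanSpace.single k (1:ℝ) : 𝔼)).const_add (WithLp.toLp 2 x : 𝔼)
    simpa using this
  have h1 := one_dim (l := -a) (r := r) (by linarith) (g := fun t => h (WithLp.toLp 2 (Function.update x k t)))
    (g' := fun t => pd k h (WithLp.toLp 2 (Function.update x k t))) (fun t ht => ?_) ?_ (x := x k) (by simpa using hx k)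
  · have h2 : FH i a h x = ‖h (WithLp.toLp 2 (Function.update x k (x k)))‖ₑ := by
      rw [Function.update_eq_self]; exact indicator_of_mem hx _
    rw [h2]
    refine h1.trans ?_
    gcongr
  · exact (cd_diff (isOpen_Box i a) hh ((hmem t).2 ht)).hasFDerivAt.comp_hasDerivAt t (hcurve t)
  · refine (contDiffOn_pd (isOpen_Box i a) hh k).continuousOn.comp ?_ fun t ht => (hmem t).2 ht
    exact fun t _ => (hcurve t).continuousAt.continuousWithinAt

theorem sup_bound {a : ℝ} (ha : 0 < a) {h : 𝔼 → ℝ} (hh : ContDiffOn ℝ ∞ h (Box i a))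
    (hL : ∀ L, IntegrableOn (pdL L h) (Box i a)) : ∃ M : ℝ, ∀ y ∈ Box i a, |h y| ≤ M := by
  have main : ∀ T : Finset (Fin n), ∀ h : 𝔼 → ℝ, ContDiffOn ℝ ∞ h (Box i a) → (∀ L, IntegrableOn (pdL L h) (Box i a)) →
      ∃ M : ℝ≥0∞, M ≠ ⊤ ∧ ∀ x, lmarginal (fun _ => (volume : Measure ℝ)) Tᶜ (FH i a h) x ≤ M := by
    intro T
    induction T using Finset.induction_on with
    | empty =>
      intro h hh hL
      refine ⟨∫⁻ x, FH i a h x ∂(Measure.pi fun _ => volume), ?_, fun x => ?_⟩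
      · have h1 := (hL []).2
        rw [HasFiniteIntegral, ← lintegral_indicator (isOpen_Box i a).measurableSet,
          ← (PiLp.volume_preserving_toLp (Fin n)).lintegral_comp_emb (MeasurableEquiv.toLp 2 (Fin n → ℝ)).measurableEmbedding] at h1
        exact h1.ne
      · rw [Finset.compl_empty, lmarginal_univ]
    | insert k T hk ih =>
      intro h hh hL
      obtain ⟨M1, hM1, h1⟩ := ih h hh hL
      obtain ⟨M2, hM2, h2⟩ := ih (pd k h) (contDiffOn_pd (isOpen_Box i a) hh k) fun L => hL (k :: L)
      refine ⟨ENNReal.ofReal a⁻¹ * M1 + M2, by finiteness, fun x => ?_⟩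
      have hT : Tᶜ = insert k (insert k T)ᶜ := by
        ext j; by_cases hj : j = k
        · subst hj; simp [hk]
        · simp [hj]
      have hk' : k ∉ (insert k T)ᶜ := by simp
      have m1 := FH_meas hh
      have m2 := FH_meas (contDiffOn_pd (isOpen_Box i a) hh k)
      have e1 := lmarginal_insert' (μ := fun _ => (volume : Measure ℝ)) (FH i a h) m1 hk'
      have e2 := lmarginal_insert' (μ := fun _ => (volume : Measure ℝ)) (FH i a (pd k h)) m2 hk'
      rw [← hT] at e1 e2
      have h1x := h1 x
      have h2x := h2 x
      rw [e1] at h1x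
      rw [e2] at h2x
      refine le_trans (lmarginal_mono (fun x => FH_le ha hh k x) x) ?_
      refine le_trans ?_ (add_le_add (mul_le_mul_right h1x (ENNReal.ofReal a⁻¹)) h2x)
      simp only [lmarginal]
      have hmeas : Measurable (fun p : ((j : ↥((insert k T)ᶜ)) → ℝ) × ℝ =>
          FH i a h (Function.update (Function.updateFinset x (insert k T)ᶜ p.1) k p.2)) :=
        m1.comp (measurable_update'.comp ((measurable_updateFinset.comp measurable_fst).prodMk measurable_snd))
      rw [lintegral_add_left, lintegral_const_mul]
      · exact hmeas.lintegral_prod_right'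
      · exact hmeas.lintegral_prod_right'.const_mul _
  obtain ⟨M, hM, h1⟩ := main Finset.univ h hh hL
  refine ⟨M.toReal, fun y hy => ?_⟩
  have h2 := h1 y.ofLp
  rw [Finset.compl_univ, lmarginal_empty] at h2
  have h3 : FH i a h y.ofLp = ‖h y‖ₑ := indicator_of_mem hy _
  rw [h3] at h2
  have := ENNReal.toReal_mono hM h2
  simpa using this
end A5

section A5b
variable {n : ℕ} {i : Fin n} {Q : Set (EuclideanSpace ℝ (Fin n))}
local notation "𝔼" => EuclideanSpace ℝ (Fin n)

def BD (Q : Set 𝔼) (h : 𝔼 → ℝ) : Prop :=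
  ContDiffOn ℝ ∞ h Q ∧ ∀ L, L ≠ [] → ∃ M : ℝ, ∀ y ∈ Q, |pdL L h y| ≤ M

theorem BD.pd {h : 𝔼 → ℝ} (hQ : IsOpen Q) (hB : BD Q h) (k : Fin n) : BD Q (pd k h) :=
  ⟨contDiffOn_pd hQ hB.1 k, fun L _ => hB.2 (k :: L) (by simp)⟩

theorem fderiv_eq_sum (g : 𝔼 → ℝ) (x : 𝔼) :
    fderiv ℝ g x = ∑ k, pd k g x • (EuclideanSpace.proj k : 𝔼 →L[ℝ] ℝ) := by
  ext1 v
  rw [fderiv_eq_pd, sum_apply]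
  refine Finset.sum_congr rfl fun k _ => ?_
  simp [mul_comm]

theorem BD.bound {h : 𝔼 → ℝ} (hB : BD Q h) : ∃ M : ℝ, 0 ≤ M ∧ ∀ y ∈ Q, ‖fderiv ℝ h y‖ ≤ M := by
  choose M hM using fun k : Fin n => hB.2 [k] (by simp)
  refine ⟨∑ k, |M k| * ‖(EuclideanSpace.proj k : 𝔼 →L[ℝ] ℝ)‖, by positivity, fun y hy => ?_⟩
  rw [fderiv_eq_sum]
  refine (norm_sum_le _ _).trans (Finset.sum_le_sum fun k _ => ?_)
  rw [norm_smul]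
  gcongr
  exact (hM k y hy).trans (le_abs_self _)

theorem BD.ext {h : 𝔼 → ℝ} (hQ : IsOpen Q) (hcv : Convex ℝ Q) (hB : BD Q h) : ∃ H : 𝔼 → ℝ, Continuous H ∧ EqOn H h Q := by
  obtain ⟨M, hM0, hM⟩ := hB.bound
  have : LipschitzOnWith ⟨M, hM0⟩ h Q :=
    hcv.lipschitzOnWith_of_nnnorm_fderiv_le (fun y hy => cd_diff hQ hB.1 hy) (fun y hy => hM y hy)
  obtain ⟨H, hH, he⟩ := this.extend_real
  exact ⟨H, hH.continuous, he.symm⟩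

theorem BD.contDiffOn_nat (hQ : IsOpen Q) (hcv : Convex ℝ Q) (m : ℕ) : ∀ {h H : 𝔼 → ℝ}, BD Q h → Continuous H → EqOn H h Q →
    ContDiffOn ℝ m H (closure Q) := by
  induction m with
  | zero => intro h H _ hH _; exact contDiffOn_zero.2 hH.continuousOn
  | succ m ih =>
    intro h H hB hH he
    choose Hk hHk hHke using fun k => (hB.pd hQ k).ext hQ hcv
    have hd : ∀ x ∈ closure Q, HasFDerivWithinAt H (∑ k, Hk k x • (EuclideanSpace.proj k : 𝔼 →L[ℝ] ℝ)) (closure Q) x := by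
      intro x hx
      refine hasFDerivWithinAt_closure_of_tendsto_fderiv ((hB.1.differentiableOn (by simp)).congr he) hcv hQ
        (fun y _ => hH.continuousAt.continuousWithinAt) ?_
      have h1 : Tendsto (fun y => ∑ k, Hk k y • (EuclideanSpace.proj k : 𝔼 →L[ℝ] ℝ)) (𝓝[Q] x)
          (𝓝 (∑ k, Hk k x • (EuclideanSpace.proj k : 𝔼 →L[ℝ] ℝ))) := by
        have : Continuous (fun y => ∑ k, Hk k y • (EuclideanSpace.proj k : 𝔼 →L[ℝ] ℝ)) :=
          continuous_finsetSum _ fun k _ => (hHk k).smul continuous_const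
        exact this.continuousAt.continuousWithinAt
      refine h1.congr' ?_
      filter_upwards [self_mem_nhdsWithin] with y hy
      rw [(he.eventuallyEq_of_mem (hQ.mem_nhds hy)).fderiv_eq, fderiv_eq_sum]
      exact Finset.sum_congr rfl fun k _ => by rw [hHke k hy]
    have hcs : ContDiffOn ℝ m (fun x => ∑ k, Hk k x • (EuclideanSpace.proj k : 𝔼 →L[ℝ] ℝ)) (closure Q) :=
      ContDiffOn.sum fun k _ => (ih (hB.pd hQ k) (hHk k) (hHke k)).smul contDiffOn_const
    push_cast
    rw [contDiffOn_succ_iff_hasFDerivWithinAt (by simp)]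
    intro x hx
    refine ⟨closure Q, by rw [insert_eq_of_mem hx]; exact self_mem_nhdsWithin, by simp,
      fun x => ∑ k, Hk k x • (EuclideanSpace.proj k : 𝔼 →L[ℝ] ℝ), hd, hcs⟩

theorem BD.exists_ext {h : 𝔼 → ℝ} (hQ : IsOpen Q) (hcv : Convex ℝ Q) (hB : BD Q h) :
    ∃ H : 𝔼 → ℝ, ContDiffOn ℝ ∞ H (closure Q) ∧ EqOn H h Q := by
  obtain ⟨H, hH, he⟩ := hB.ext hQ hcv
  exact ⟨H, contDiffOn_infty.2 fun m => hB.contDiffOn_nat hQ hcv m hH he, he⟩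

theorem mem_closure_Box {a : ℝ} {y : 𝔼} (h1 : ∀ j, |y j| < a) (h2 : y i ≤ 0) : y ∈ closure (Box i a) := by
  have ht : Tendsto (fun t : ℝ => y - t • EuclideanSpace.single i (1:ℝ)) (𝓝[>] 0) (𝓝 y) := by
    have : Continuous (fun t : ℝ => y - t • (EuclideanSpace.single i (1:ℝ) : 𝔼)) := by fun_prop
    have := this.tendsto 0
    rw [zero_smul, sub_zero] at this
    exact this.mono_left nhdsWithin_le_nhds
  refine mem_closure_of_tendsto ht ?_
  have hp : 0 < y i + a := by linarith [(abs_lt.1 (h1 i)).1]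
  filter_upwards [Ioo_mem_nhdsGT hp] with t ht j
  by_cases hj : j = i
  · subst hj
    simp only [PiLp.sub_apply, PiLp.smul_apply, PiLp.single_apply, if_true, smul_eq_mul, mul_one]
    constructor <;> linarith [ht.1, ht.2]
  · simpa [hj] using abs_lt.1 (h1 j)

theorem Box_subset_ball {a R : ℝ} (hR : (n : ℝ) * a < R) (ha : 0 < a) : Box i a ⊆ Metric.ball (0:𝔼) R := by
  intro y hy
  rw [mem_ball_zero_iff]
  refine lt_of_le_of_lt ?_ hR
  rw [euclid_decomp y]
  refine (norm_sum_le _ _).trans ?_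
  have : ∀ k ∈ Finset.univ, ‖y k • (EuclideanSpace.single k (1:ℝ) : 𝔼)‖ ≤ a := by
    intro k _
    rw [norm_smul]
    have := hy k
    simp only [PiLp.norm_single, norm_one, mul_one, Real.norm_eq_abs]
    rw [abs_le]
    refine ⟨this.1.le, this.2.le.trans ?_⟩
    split_ifs <;> linarith
  refine (Finset.sum_le_sum this).trans ?_
  simp

theorem BChart.extend {Ω : Set 𝔼} {x₀ : 𝔼} {e : OpenPartialHomeomorph 𝔼 𝔼} (hc : BChart Ω x₀ i e)
    (hΩ : IsOpen Ω) (hb : Bornology.IsBounded Ω) {v G : 𝔼 → ℝ} (hv : ContDiffOn ℝ ∞ v Ω) (hV : InV Ω v)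
    (hG : ContDiff ℝ ∞ G) (hGc : HasCompactSupport G)
    (hw : ∀ φ, TestF Ω φ → ∫ x in Ω, inner ℝ (gradient v x + gradient G x) (gradient φ x) = 0)
    (hl : ∀ x ∈ Ω, ∑ k, pd k (pd k v) x + ∑ k, pd k (pd k G) x = 0) :
    ∃ U, IsOpen U ∧ x₀ ∈ U ∧ (∃ V : 𝔼 → ℝ, ContDiffOn ℝ ∞ V (closure Ω ∩ U) ∧ EqOn V v (Ω ∩ U)) ∧
      ∃ M, ∀ x ∈ Ω ∩ U, ‖fderiv ℝ v x‖ ≤ M := by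
  obtain ⟨R, hR, ht, hI⟩ := hc.integrable hΩ hb hv hV hG hGc hw
  obtain ⟨c, d, F, hF, hcc, hd, hcii, hpde⟩ := hc.pde hΩ hv hG hl
  obtain ⟨a, ha, haR⟩ : ∃ a : ℝ, 0 < a ∧ (n:ℝ) * a < R := by
    refine ⟨R / (n + 1), by positivity, ?_⟩
    rw [← mul_div_assoc, div_lt_iff₀ (by positivity)]
    nlinarith
  have hBR := Box_subset_ball (i := i) haR ha
  have hBo := isOpen_Box i a
  have hBK : Box i a ⊆ Metric.closedBall 0 (2 * R) := hBR.trans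
    ((Metric.ball_subset_ball (by linarith)).trans Metric.ball_subset_closedBall)
  have hBsub : Box i a ⊆ Metric.ball 0 R ∩ {y | y i < 0} := fun y hy => ⟨hBR hy, Box_neg hy⟩
  have hwB : ContDiffOn ℝ ∞ (v ∘ e.symm) (Box i a) := by
    refine hv.comp (hc.smooth_symm.mono (hBK.trans ht)) fun y hy => ?_
    rw [hc.inside _ (e.map_target (ht (hBK hy))), e.right_inv (ht (hBK hy))]; exact Box_neg hy
  have hall := WW.all (i := i) hBo e.open_target (isCompact_closedBall (0:𝔼) (2 * R)) hBK ht hwB hF hcc hd hcii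
    (fun y hy => hpde y (ht (hBK hy)) (Box_neg hy)) (fun L hL k => (hI L hL k).mono_set hBsub)
  have hBD : BD (Box i a) (v ∘ e.symm) := by
    refine ⟨hwB, fun L hL => ?_⟩
    obtain ⟨k, L, rfl⟩ := List.exists_cons_of_ne_nil hL
    refine sup_bound ha (contDiffOn_pdL hBo _ hwB) fun L' => ?_
    have : ∀ (L L' : List (Fin n)) (h : 𝔼 → ℝ), pdL L' (pdL L h) = pdL (L ++ L') h := by
      intro L
      induction L with
      | nil => intro _ _; rfl
      | cons k L ih => intro L' h; exact ih L' (pd k h)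
    rw [this]
    exact (hall ((L ++ L').count i) k).2 (L ++ L') le_rfl
  obtain ⟨W, hW, hWe⟩ := hBD.exists_ext hBo (convex_Box i a)
  obtain ⟨M, hM0, hM⟩ := hBD.bound
  have hfc : ContinuousAt (fun x => ‖fderiv ℝ e x‖) x₀ :=
    (((hc.smooth.fderiv_of_isOpen e.open_source (m := ∞) (by simp)).continuousOn).continuousAt (e.open_source.mem_nhds hc.mem)).norm
  obtain ⟨U', hU's, hU', hxU'⟩ := mem_nhds_iff.1 (hfc.eventually_lt continuousAt_const (lt_add_one ‖fderiv ℝ e x₀‖))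
  have hcube : IsOpen {y : 𝔼 | ∀ j, |y j| < a} := by
    have : {y : 𝔼 | ∀ j, |y j| < a} = ⋂ j, {y : 𝔼 | |y j| < a} := by ext; simp
    rw [this]
    exact isOpen_iInter_of_finite fun j => isOpen_lt (by fun_prop) continuous_const
  refine ⟨(e.source ∩ e ⁻¹' {y : 𝔼 | ∀ j, |y j| < a}) ∩ U', (e.isOpen_inter_preimage hcube).inter hU',
    ⟨⟨hc.mem, by simp [hc.zero, ha]⟩, hxU'⟩, ⟨W ∘ e, ?_, ?_⟩, M * (‖fderiv ℝ e x₀‖ + 1), ?_⟩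
  · refine hW.comp (hc.smooth.mono fun x hx => hx.2.1.1) fun x hx => ?_
    refine mem_closure_Box hx.2.1.2 ?_
    have h1 := hx.1
    rw [closure_eq_self_union_frontier] at h1
    rcases h1 with h1 | h1
    · exact ((hc.inside x hx.2.1.1).1 h1).le
    · exact ((hc.front x hx.2.1.1).1 h1).le
  all_goals
    have hbox : ∀ x ∈ Ω ∩ (e.source ∩ e ⁻¹' {y : 𝔼 | ∀ j, |y j| < a} ∩ U'), e x ∈ Box i a := by
      intro x hx j
      have h1 := abs_lt.1 (hx.2.1.2 j)
      by_cases hj : j = i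
      · subst hj; rw [if_pos rfl]; exact ⟨h1.1, (hc.inside x hx.2.1.1).1 hx.1⟩
      · rw [if_neg hj]; exact h1
  · intro x hx
    rw [Function.comp_apply, hWe (hbox x hx), Function.comp_apply, e.left_inv hx.2.1.1]
  · intro x hx
    have hs := hx.2.1.1
    have hed := (hc.smooth.differentiableOn (by simp) _ hs).differentiableAt (e.open_source.mem_nhds hs)
    have h1 := (cd_diff hBo hwB (hbox x hx)).hasFDerivAt.comp x hed.hasFDerivAt
    have h2 : v =ᶠ[𝓝 x] (v ∘ e.symm) ∘ e := by
      filter_upwards [e.open_source.mem_nhds hs] with z hz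
      simp [e.left_inv hz]
    rw [h2.fderiv_eq, h1.fderiv]
    refine (ContinuousLinearMap.opNorm_comp_le _ _).trans ?_
    have h3 : ‖fderiv ℝ e x‖ ≤ ‖fderiv ℝ e x₀‖ + 1 := (hU's hx.2.2).le
    exact mul_le_mul (hM _ (hbox x hx)) h3 (norm_nonneg _) hM0
end A5b

section Weyl
variable {n : ℕ} {Ω : Set (EuclideanSpace ℝ (Fin n))}
local notation "𝔼" => EuclideanSpace ℝ (Fin n)

def HH (t : ℝ) : ℝ := - Real.smoothTransition (2 - 3 * t)
def gg : ℝ → ℝ := deriv HH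

theorem HH_smooth : ContDiff ℝ ∞ HH :=
  (Real.smoothTransition.contDiff.comp (by fun_prop : ContDiff ℝ ∞ fun t : ℝ => 2 - 3 * t)).neg

theorem HH_zero {t : ℝ} (ht : 2 / 3 < t) : HH t = 0 := by
  rw [HH, Real.smoothTransition.zero_of_nonpos (by linarith), neg_zero]

theorem deriv_zero_of {f : ℝ → ℝ} (hf : ∀ t, 2 / 3 < t → f t = 0) (t : ℝ) (ht : 2 / 3 < t) : deriv f t = 0 := by
  have : f =ᶠ[𝓝 t] fun _ => 0 := by
    filter_upwards [lt_mem_nhds ht] with z hz using hf z hz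
  rw [this.deriv_eq, deriv_const]

theorem deriv_smooth {f : ℝ → ℝ} (hf : ContDiff ℝ ∞ f) : ContDiff ℝ ∞ (deriv f) :=
  (contDiff_infty_iff_deriv.1 hf).2

theorem gg_smooth : ContDiff ℝ ∞ gg := deriv_smooth HH_smooth

theorem gg_zero {t : ℝ} (ht : 2 / 3 < t) : gg t = 0 := deriv_zero_of (fun _ => HH_zero) t ht

theorem gg_nonneg (t : ℝ) : 0 ≤ gg t := by
  have : Monotone HH := fun a b hab => neg_le_neg (Real.smoothTransition.monotone (by linarith))
  exact this.deriv_nonneg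

theorem gg_pos : ∃ t, 0 < t ∧ 0 < gg t := by
  obtain ⟨c, hc, h⟩ := exists_deriv_eq_slope HH (a := 1/3) (b := 1) (by norm_num) HH_smooth.continuous.continuousOn
    (HH_smooth.differentiable (by simp)).differentiableOn
  refine ⟨c, by linarith [hc.1], ?_⟩
  rw [gg, h, HH_zero (by norm_num), HH, Real.smoothTransition.one_of_one_le (by norm_num)]
  norm_num

theorem pd_comp {η : ℝ → ℝ} {q : 𝔼 → ℝ} {y : 𝔼} (hη : DifferentiableAt ℝ η (q y)) (hq : DifferentiableAt ℝ q y) (k : Fin n) :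
    pd k (fun y => η (q y)) y = deriv η (q y) * pd k q y := by
  have := (hη.hasDerivAt.comp_hasFDerivAt y hq.hasFDerivAt).fderiv
  unfold pd
  change fderiv ℝ (η ∘ q) y _ = _
  rw [this]; simp

theorem pd_sq (x : 𝔼) (b : ℝ) (k : Fin n) : pd k (fun y => ‖x - y‖ ^ 2 * b) = fun y => -2 * b * (x k - y k) := by
  funext y
  have h1 : HasFDerivAt (fun y => ‖x - y‖ ^ 2) (2 • (innerSL ℝ (x - y)).comp (- ContinuousLinearMap.id ℝ 𝔼)) y :=
    ((hasFDerivAt_id y).const_sub x).norm_sq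
  have h2 := (h1.mul_const b).fderiv
  rw [pd, h2]
  simp [EuclideanSpace.inner_single_right]
  ring

theorem pd_lin (x : 𝔼) (b : ℝ) (k : Fin n) (y : 𝔼) : pd k (fun y => -2 * b * (x k - y k)) y = 2 * b := by
  have h1 : HasFDerivAt (fun y : 𝔼 => y k) (EuclideanSpace.proj k : 𝔼 →L[ℝ] ℝ) y := (EuclideanSpace.proj k : 𝔼 →L[ℝ] ℝ).hasFDerivAt
  have h2 := ((h1.const_sub (x k)).const_mul (-2 * b)).fderiv
  rw [pd, h2]
  simp

theorem sq_smooth (x : 𝔼) (b : ℝ) : ContDiff ℝ ∞ (fun y : 𝔼 => ‖x - y‖ ^ 2 * b) := by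
  exact ((contDiff_const.sub contDiff_id).norm_sq ℝ).mul contDiff_const

theorem rad_lap {η : ℝ → ℝ} (hη : ContDiff ℝ ∞ η) (c b : ℝ) (x y : 𝔼) :
    ∑ k, pd k (pd k (fun y => c * η (‖x - y‖ ^ 2 * b))) y =
      c * (2 * b * (n * deriv η (‖x - y‖ ^ 2 * b) + 2 * (‖x - y‖ ^ 2 * b) * deriv (deriv η) (‖x - y‖ ^ 2 * b))) := by
  have hη' := deriv_smooth hη
  have hd : ∀ {f : ℝ → ℝ}, ContDiff ℝ ∞ f → ∀ t, DifferentiableAt ℝ f t := fun h t => h.differentiable (by simp) t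
  have hq : ∀ y, DifferentiableAt ℝ (fun y => ‖x - y‖ ^ 2 * b) y := fun y => (sq_smooth x b).differentiable (by simp) y
  have hcη : ContDiff ℝ ∞ (fun t => c * η t) := contDiff_const.mul hη
  have e1 : ∀ k, pd k (fun y => c * η (‖x - y‖ ^ 2 * b)) = fun y => (c * deriv η (‖x - y‖ ^ 2 * b)) * (-2 * b * (x k - y k)) := by
    intro k; funext y
    have := pd_comp (η := fun t => c * η t) (hd hcη _) (hq y) k
    rw [this, pd_sq, deriv_const_mul _ (hd hη _)]
  have e2 : ∀ k, pd k (pd k (fun y => c * η (‖x - y‖ ^ 2 * b))) y = c * deriv η (‖x - y‖ ^ 2 * b) * (2 * b) +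
      c * deriv (deriv η) (‖x - y‖ ^ 2 * b) * (4 * b ^ 2 * (x k - y k) ^ 2) := by
    intro k
    have hcη' : ContDiff ℝ ∞ (fun t => c * deriv η t) := contDiff_const.mul hη'
    rw [e1, pd_mul (f := fun y => c * deriv η (‖x - y‖ ^ 2 * b)) (g := fun y => -2 * b * (x k - y k))
      (DifferentiableAt.comp y (g := fun t => c * deriv η t) (hd hcη' _) (hq y)) (by fun_prop), pd_lin,
      pd_comp (η := fun t => c * deriv η t) (hd hcη' _) (hq y), pd_sq, deriv_const_mul _ (hd hη' _)]
    ring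
  simp only [e2, Finset.sum_add_distrib, ← Finset.mul_sum]
  rw [Finset.sum_const, Finset.card_univ, Fintype.card_fin, EuclideanSpace.norm_sq_eq]
  simp
  ring

theorem rad_test {η : ℝ → ℝ} (hη : ContDiff ℝ ∞ η) (hz : ∀ t, 2 / 3 < t → η t = 0) (c : ℝ) {s : ℝ} (hs : 0 < s) {x : 𝔼}
    (hx : Metric.closedBall x s ⊆ Ω) : TestF Ω (fun y => c * η (‖x - y‖ ^ 2 * (s ^ 2)⁻¹)) := by
  have hsub : tsupport (fun y => c * η (‖x - y‖ ^ 2 * (s ^ 2)⁻¹)) ⊆ Metric.closedBall x s := by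
    refine closure_minimal (fun y hy => ?_) Metric.isClosed_closedBall
    by_contra hcon
    refine hy ?_
    rw [Metric.mem_closedBall, not_le, dist_comm, dist_eq_norm] at hcon
    have : 1 < ‖x - y‖ ^ 2 * (s ^ 2)⁻¹ := by
      rw [← div_eq_mul_inv, one_lt_div (by positivity)]
      gcongr
    simp only [hz _ (by linarith : (2/3 : ℝ) < ‖x - y‖ ^ 2 * (s ^ 2)⁻¹), mul_zero]
  exact ⟨contDiff_const.mul (hη.comp (sq_smooth x _)), (isCompact_closedBall x s).of_isClosed_subset (isClosed_tsupport _) hsub,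
    hsub.trans hx⟩

def Kern (n : ℕ) (s : ℝ) (z : EuclideanSpace ℝ (Fin n)) : ℝ := (s ^ n)⁻¹ * gg (‖z‖ ^ 2 * (s ^ 2)⁻¹)

theorem Kern_smooth (s : ℝ) : ContDiff ℝ ∞ (Kern n s) :=
  contDiff_const.mul (gg_smooth.comp ((contDiff_id.norm_sq ℝ).mul contDiff_const))

theorem Kern_supp {s : ℝ} (hs : 0 < s) {z : 𝔼} (hz : s ≤ ‖z‖) : Kern n s z = 0 := by
  have : 1 ≤ ‖z‖ ^ 2 * (s ^ 2)⁻¹ := by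
    rw [← div_eq_mul_inv, one_le_div (by positivity)]
    gcongr
  rw [Kern, gg_zero (by linarith), mul_zero]

theorem Kern_cpt {s : ℝ} (hs : 0 < s) : HasCompactSupport (Kern n s) := by
  refine HasCompactSupport.intro (isCompact_closedBall 0 s) fun z hz => Kern_supp hs ?_
  simpa using (not_le.1 (fun h => hz (by simpa using h))).le

theorem bdd_of_zero {f : ℝ → ℝ} (hf : Continuous f) (hz : ∀ t, 2 / 3 < t → f t = 0) : ∃ C, ∀ t, 0 ≤ t → |f t| ≤ C := by
  obtain ⟨C, hC⟩ := isCompact_Icc.exists_bound_of_continuousOn (s := Icc (0:ℝ) 1) hf.continuousOn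
  refine ⟨C, fun t ht => ?_⟩
  by_cases h1 : t ≤ 1
  · exact hC t ⟨ht, h1⟩
  · rw [hz t (by linarith), abs_zero]
    exact (norm_nonneg _).trans (hC 0 (by simp))

theorem Kern_deriv {s : ℝ} (hs : 0 < s) (z : 𝔼) : HasDerivAt (fun s => Kern n s z)
    (-((s ^ (n+1))⁻¹ * (n * gg (‖z‖ ^ 2 * (s ^ 2)⁻¹) + 2 * (‖z‖ ^ 2 * (s ^ 2)⁻¹) * deriv gg (‖z‖ ^ 2 * (s ^ 2)⁻¹)))) s := by
  have hg : HasDerivAt gg (deriv gg (‖z‖ ^ 2 * (s ^ 2)⁻¹)) (‖z‖ ^ 2 * (s ^ 2)⁻¹) :=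
    (gg_smooth.differentiable (by simp) _).hasDerivAt
  have h1 : HasDerivAt (fun s : ℝ => (s ^ n)⁻¹) (-(n * s ^ (n - 1)) / (s ^ n) ^ 2) s := (hasDerivAt_pow n s).fun_inv (by positivity)
  have h2 : HasDerivAt (fun s : ℝ => ‖z‖ ^ 2 * (s ^ 2)⁻¹) (‖z‖ ^ 2 * (-((2:ℕ) * s ^ (2 - 1)) / (s ^ 2) ^ 2)) s :=
    ((hasDerivAt_pow 2 s).fun_inv (by positivity)).const_mul _
  have h3 := h1.mul (hg.comp s h2)
  refine h3.congr_deriv ?_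
  have h4 : (n:ℝ) * s ^ (n - 1) * s = n * s ^ n := by
    rcases n with _ | n
    · simp
    · simp; ring
  have h5 : -((n:ℝ) * s ^ (n - 1)) / (s ^ n) ^ 2 = - (n * (s ^ (n+1))⁻¹) := by
    have : (n:ℝ) * s ^ (n - 1) = n * s ^ n / s := by field_simp; linarith
    rw [this]; field_simp; ring
  rw [h5, Function.comp_apply]
  field_simp
  ring

theorem Kern_const {u : 𝔼 → ℝ} (hu : Integrable u) 
    (hw : ∀ φ, TestF Ω φ → ∫ x, u x * ∑ k, pd k (pd k φ) x = 0) {x : 𝔼} {a b : ℝ} (ha : 0 < a) (hab : a ≤ b)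
    (hx : Metric.closedBall x b ⊆ Ω) : ∫ y, u y * Kern n b (x - y) = ∫ y, u y * Kern n a (x - y) := by
  let A : ℝ → ℝ := fun t => n * gg t + 2 * t * deriv gg t
  have hAc : Continuous A := by
    have := gg_smooth.continuous
    have := (deriv_smooth gg_smooth).continuous
    fun_prop
  obtain ⟨C, hC⟩ := bdd_of_zero hAc fun t ht => by
    simp only [A, gg_zero ht, deriv_zero_of (fun _ => gg_zero) t ht, mul_zero, add_zero]
  have hcK : ∀ s, Continuous fun y => Kern n s (x - y) := fun s => (Kern_smooth s).continuous.comp (by fun_prop)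
  have hd : ∀ s ∈ Icc a b, HasDerivAt (fun s => ∫ y, u y * Kern n s (x - y)) 0 s := by
    intro s hs
    have hs0 : 0 < s := lt_of_lt_of_le ha hs.1
    have h1 := hasDerivAt_integral_of_dominated_loc_of_deriv_le (μ := volume) (F := fun s y => u y * Kern n s (x - y))
      (F' := fun s y => u y * (-((s ^ (n+1))⁻¹ * A (‖x - y‖ ^ 2 * (s ^ 2)⁻¹)))) (x₀ := s) (s := Ioi (s / 2))
      (bound := fun y => |u y| * (((s/2) ^ (n+1))⁻¹ * C)) (Ioi_mem_nhds (by linarith)) ?_ ?_ ?_ ?_ ?_ ?_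
    · refine h1.2.congr_deriv ?_
      have h2 := hw _ (rad_test HH_smooth (fun _ => HH_zero) (1 / 2 * (s ^ n)⁻¹ * s) hs0
        ((Metric.closedBall_subset_closedBall hs.2).trans hx))
      simp only [rad_lap HH_smooth] at h2
      rw [← neg_eq_zero, ← integral_neg, ← h2]
      refine integral_congr_ae (Eventually.of_forall fun y => ?_)
      simp only [A, gg]
      generalize deriv HH (‖x - y‖ ^ 2 * (s ^ 2)⁻¹) = P
      generalize deriv (deriv HH) (‖x - y‖ ^ 2 * (s ^ 2)⁻¹) = Q
      field_simp
      ring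
    · exact Eventually.of_forall fun t => hu.1.mul (hcK t).aestronglyMeasurable
    · obtain ⟨B, hB⟩ := (Kern_cpt hs0 (n := n)).exists_bound_of_continuous (Kern_smooth s).continuous
      exact hu.mul_bdd (c := B) (hcK s).aestronglyMeasurable (Eventually.of_forall fun y => hB _)
    · refine hu.1.mul (Continuous.aestronglyMeasurable ?_)
      fun_prop
    · refine Eventually.of_forall fun y t ht => ?_
      rw [norm_mul, norm_neg, norm_mul, Real.norm_eq_abs, Real.norm_eq_abs, Real.norm_eq_abs]
      have ht' : s / 2 < t := ht
      have ht0 : 0 < t := by linarith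
      rw [abs_of_pos (by positivity : 0 < (t ^ (n+1))⁻¹)]
      gcongr
      exact hC _ (by positivity)
    · exact (hu.abs).mul_const _
    · refine Eventually.of_forall fun y t ht => ?_
      have ht' : s / 2 < t := ht
      exact (Kern_deriv (by linarith) (x - y)).const_mul _
  have := constant_of_has_deriv_right_zero (f := fun s => ∫ y, u y * Kern n s (x - y)) (a := a) (b := b)
    (fun s hs => (hd s hs).continuousAt.continuousWithinAt) (fun s hs => (hd s (Ico_subset_Icc_self hs)).hasDerivWithinAt)
  exact this b ⟨hab, le_rfl⟩

end Weyl

section Weyl2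
variable {n : ℕ} {Ω : Set (EuclideanSpace ℝ (Fin n))}
local notation "𝔼" => EuclideanSpace ℝ (Fin n)

theorem cv_eq (u K : 𝔼 → ℝ) : (fun x => ∫ y, u y * K (x - y)) = convolution u K (ContinuousLinearMap.lsmul ℝ ℝ) volume := by
  funext x
  simp [convolution]

theorem cv_smooth {u K : 𝔼 → ℝ} (hu : LocallyIntegrable u) (hK : ContDiff ℝ ∞ K) (hc : HasCompactSupport K) :
    ContDiff ℝ ∞ (fun x => ∫ y, u y * K (x - y)) := by
  rw [cv_eq]
  exact hc.contDiff_convolution_right _ hu hK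

theorem cv_pd {u K : 𝔼 → ℝ} (hu : LocallyIntegrable u) (hK : ContDiff ℝ ∞ K) (hc : HasCompactSupport K) (k : Fin n) :
    pd k (fun x => ∫ y, u y * K (x - y)) = fun x => ∫ y, u y * pd k K (x - y) := by
  funext x
  have h1 := (hc.hasFDerivAt_convolution_right (ContinuousLinearMap.lsmul ℝ ℝ) hu (hK.of_le one_le_infty) x).fderiv
  rw [cv_eq, pd, h1, convolution_precompR_apply _ hu (hc.fderiv ℝ) (hK.continuous_fderiv (by simp))]
  simp [convolution, pd]

theorem pd_refl {g : 𝔼 → ℝ} (hg : Differentiable ℝ g) (x : 𝔼) (k : Fin n) :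
    pd k (fun y => g (x - y)) = fun y => - pd k g (x - y) := by
  funext y
  have h1 : HasFDerivAt (fun y => x - y) (- ContinuousLinearMap.id ℝ 𝔼) y := (hasFDerivAt_id y).const_sub x
  have := ((hg (x - y)).hasFDerivAt.comp y h1).fderiv
  rw [pd]
  change fderiv ℝ (g ∘ _) y _ = _
  rw [this]
  simp [pd]

theorem contDiff_pd {g : 𝔼 → ℝ} (hg : ContDiff ℝ ∞ g) (k : Fin n) : ContDiff ℝ ∞ (pd k g) := by
  rw [← contDiffOn_univ] at hg ⊢
  exact contDiffOn_pd isOpen_univ hg k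

theorem cpt_pd {g : 𝔼 → ℝ} (hg : HasCompactSupport g) (k : Fin n) : HasCompactSupport (pd k g) :=
  (hg.fderiv ℝ).comp_left (g := fun L : 𝔼 →L[ℝ] ℝ => L (EuclideanSpace.single k 1)) (by simp)

theorem pd_neg (g : 𝔼 → ℝ) (k : Fin n) : pd k (fun y => - g y) = fun y => - pd k g y := by
  funext y
  simp [pd, fderiv_fun_neg]

theorem cv_lap {u K : 𝔼 → ℝ} (hu : Integrable u) (hK : ContDiff ℝ ∞ K) (hc : HasCompactSupport K) (x : 𝔼) :
    ∑ k, pd k (pd k (fun x => ∫ y, u y * K (x - y))) x = ∫ y, u y * ∑ k, pd k (pd k (fun y => K (x - y))) y := by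
  have h2 : ∀ k, pd k (pd k (fun x => ∫ y, u y * K (x - y))) x = ∫ y, u y * pd k (pd k K) (x - y) := by
    intro k
    rw [cv_pd hu.locallyIntegrable hK hc, cv_pd hu.locallyIntegrable (contDiff_pd hK k) (cpt_pd hc k)]
  have h3 : ∀ k y, pd k (pd k (fun y => K (x - y))) y = pd k (pd k K) (x - y) := by
    intro k y
    rw [pd_refl (hK.differentiable (by simp)), pd_neg, pd_refl ((contDiff_pd hK k).differentiable (by simp))]; exact neg_neg _
  simp only [h2, h3, Finset.mul_sum]
  rw [integral_finsetSum]
  intro k _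
  have hC := (contDiff_pd (contDiff_pd hK k) k).continuous
  obtain ⟨B, hB⟩ := (cpt_pd (cpt_pd hc k) k).exists_bound_of_continuous hC
  exact hu.mul_bdd (c := B) (hC.comp (by fun_prop : Continuous fun y => x - y)).aestronglyMeasurable (Eventually.of_forall fun y => hB _)

def kc (n : ℕ) : ℝ := ∫ z : EuclideanSpace ℝ (Fin n), Kern n 1 z

theorem kc_pos (hn : 0 < n) : 0 < kc n := by
  obtain ⟨t, ht, hg⟩ := gg_pos
  have hc : Continuous (Kern n 1) := (Kern_smooth 1).continuous
  refine hc.integral_pos_of_hasCompactSupport_nonneg_nonzero (Kern_cpt one_pos) (fun z => ?_)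
    (x := EuclideanSpace.single ⟨0, hn⟩ (Real.sqrt t)) ?_
  · exact mul_nonneg (by positivity) (gg_nonneg _)
  · rw [Kern, PiLp.norm_single]
    simp [abs_of_nonneg (Real.sqrt_nonneg t), Real.sq_sqrt ht.le, hg.ne']

theorem Kern_int {s : ℝ} (hs : 0 < s) (x : 𝔼) : ∫ y, Kern n s (x - y) = kc n := by
  rw [integral_sub_left_eq_self (Kern n s) volume x]
  have h1 : ∀ z, Kern n s z = (s ^ n)⁻¹ * Kern n 1 (s⁻¹ • z) := by
    intro z
    simp only [Kern, norm_smul, norm_inv, Real.norm_eq_abs, abs_of_pos hs]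
    simp [mul_pow, mul_comm]
  simp only [h1, integral_const_mul]
  rw [Measure.integral_comp_smul]
  simp only [finrank_euclideanSpace, Fintype.card_fin, kc, smul_eq_mul, inv_pow, inv_inv, abs_of_pos (pow_pos hs n)]
  field_simp

theorem Kern_ae {u : 𝔼 → ℝ} (hu : Integrable u) (hn : 0 < n) :
    ∀ᵐ x, Tendsto (fun s => ∫ y, (kc n)⁻¹ * Kern n s (x - y) * u y) (𝓝[>] 0) (𝓝 (u x)) := by
  obtain ⟨B, hB⟩ := bdd_of_zero gg_smooth.continuous fun t ht => gg_zero ht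
  filter_upwards [(Besicovitch.vitaliFamily volume).ae_tendsto_average_norm_sub hu.locallyIntegrable] with x h₀
  have := (h₀.comp (Besicovitch.tendsto_filterAt volume x))
  have hv : 0 < volume.real (Metric.ball (0 : 𝔼) 1) :=
    ENNReal.toReal_pos (Metric.measure_ball_pos _ _ one_pos).ne' measure_ball_lt_top.ne
  refine tendsto_integral_smul_of_tendsto_average_norm_sub ((kc n)⁻¹ * B * volume.real (Metric.ball (0 : 𝔼) 1)) this
    (Eventually.of_forall fun i => hu.integrableOn) ?_ ?_ ?_
  · refine tendsto_const_nhds.congr' ?_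
    filter_upwards [self_mem_nhdsWithin] with s hs
    rw [integral_const_mul, Kern_int hs, inv_mul_cancel₀ (kc_pos hn).ne']
  · filter_upwards [self_mem_nhdsWithin] with s hs y hy
    by_contra hcon
    refine hy ?_
    rw [Metric.mem_closedBall, not_le, dist_comm, dist_eq_norm] at hcon
    simp only [Kern_supp hs hcon.le, mul_zero]
  · filter_upwards [self_mem_nhdsWithin] with s hs y
    have hs' : 0 < s := hs
    rw [Measure.addHaar_real_closedBall _ _ hs'.le, finrank_euclideanSpace, Fintype.card_fin, abs_mul, abs_of_pos (inv_pos.2 (kc_pos hn)),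
      Kern, abs_mul, abs_of_pos (by positivity : 0 < (s ^ n)⁻¹)]
    have hk := kc_pos hn
    have e : (kc n)⁻¹ * B * volume.real (Metric.ball (0 : 𝔼) 1) / (s ^ n * volume.real (Metric.ball (0 : 𝔼) 1)) =
      (kc n)⁻¹ * ((s ^ n)⁻¹ * B) := by field_simp
    rw [e]
    have := hB (‖x - y‖ ^ 2 * (s ^ 2)⁻¹) (by positivity)
    gcongr

theorem weyl (hn : 0 < n) (hΩ : IsOpen Ω) {u : 𝔼 → ℝ} (hu : Integrable u)
    (hw : ∀ φ, TestF Ω φ → ∫ x, u x * ∑ k, pd k (pd k φ) x = 0) :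
    ∃ w : 𝔼 → ℝ, ContDiffOn ℝ ∞ w Ω ∧ (∀ x ∈ Ω, ∑ k, pd k (pd k w) x = 0) ∧ ∀ᵐ x, x ∈ Ω → u x = w x := by
  have hr : ∀ x, ∃ r : ℝ, x ∈ Ω → 0 < r ∧ Metric.closedBall x r ⊆ Ω := by
    intro x
    by_cases hx : x ∈ Ω
    · obtain ⟨r, hr, h⟩ := Metric.nhds_basis_closedBall.mem_iff.1 (hΩ.mem_nhds hx)
      exact ⟨r, fun _ => ⟨hr, h⟩⟩
    · exact ⟨0, fun h => absurd h hx⟩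
  choose r hr using hr
  let W : ℝ → 𝔼 → ℝ := fun s x => ∫ y, (kc n)⁻¹ * u y * Kern n s (x - y)
  have hu' : Integrable (fun y => (kc n)⁻¹ * u y) := hu.const_mul _
  have hw' : ∀ φ, TestF Ω φ → ∫ x, (kc n)⁻¹ * u x * ∑ k, pd k (pd k φ) x = 0 := by
    intro φ hφ
    simp only [mul_assoc, integral_const_mul, hw φ hφ, mul_zero]
  have hWW : ∀ x a b, 0 < a → 0 < b → Metric.closedBall x a ⊆ Ω → Metric.closedBall x b ⊆ Ω → W a x = W b x := by
    intro x a b ha hb hxa hxb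
    rcases le_total a b with h | h
    · exact (Kern_const hu' hw' ha h hxb).symm
    · exact Kern_const hu' hw' hb h hxa
  have hloc : ∀ x ∈ Ω, ∃ s, 0 < s ∧ Metric.closedBall x s ⊆ Ω ∧ (fun y => W (r y) y) =ᶠ[𝓝 x] W s := by
    intro x hx
    obtain ⟨h0, h1⟩ := hr x hx
    refine ⟨r x / 2, by linarith, (Metric.closedBall_subset_closedBall (by linarith)).trans h1, ?_⟩
    filter_upwards [Metric.ball_mem_nhds x (by linarith : 0 < r x / 2)] with y hy
    have hyΩ : Metric.closedBall y (r x / 2) ⊆ Ω := by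
      refine (Metric.closedBall_subset_closedBall' ?_).trans h1
      rw [Metric.mem_ball] at hy; linarith
    have hyO : y ∈ Ω := hyΩ (Metric.mem_closedBall_self (by linarith))
    exact hWW y _ _ (hr y hyO).1 (by linarith) (hr y hyO).2 hyΩ
  refine ⟨fun y => W (r y) y, ?_, ?_, ?_⟩
  · intro x hx
    obtain ⟨s, hs, -, h⟩ := hloc x hx
    exact (((cv_smooth hu'.locallyIntegrable (Kern_smooth s) (Kern_cpt hs)).contDiffAt).congr_of_eventuallyEq h).contDiffWithinAt
  · intro x hx
    obtain ⟨s, hs, hsub, h⟩ := hloc x hx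
    obtain ⟨U, hU, hUo, hxU⟩ := eventually_nhds_iff.1 h
    have e : ∀ k, pd k (pd k (fun y => W (r y) y)) x = pd k (pd k (W s)) x := fun k =>
      pd_congr hUo (pd_congr hUo (fun y hy => hU y hy) k) k hxU
    simp only [e]
    rw [cv_lap hu' (Kern_smooth s) (Kern_cpt hs) x]
    exact hw' _ (rad_test gg_smooth (fun _ => gg_zero) _ hs hsub)
  · filter_upwards [Kern_ae hu hn] with x hx hxΩ
    refine tendsto_nhds_unique hx (tendsto_const_nhds.congr' ?_)
    filter_upwards [Ioo_mem_nhdsGT (hr x hxΩ).1] with s hs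
    rw [hWW x _ s (hr x hxΩ).1 hs.1 (hr x hxΩ).2 ((Metric.closedBall_subset_closedBall hs.2.le).trans (hr x hxΩ).2)]
    refine integral_congr_ae (Eventually.of_forall fun y => ?_)
    simp only; ring

end Weyl2

section A1
variable {n : ℕ} {Ω : Set (EuclideanSpace ℝ (Fin n))}
local notation "𝔼" => EuclideanSpace ℝ (Fin n)

theorem test_int {f g : 𝔼 → ℝ} (hΩ : IsOpen Ω) (hf : Continuous f) (hc : HasCompactSupport f) (hs : tsupport f ⊆ Ω)
    (hg : ContinuousOn g Ω) : Integrable (fun x => f x * g x) := by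
  refine Continuous.integrable_of_hasCompactSupport ?_ hc.mul_right
  refine continuous_of_tsupport fun x hx => ?_
  have hx' : x ∈ Ω := hs (tsupport_mul_subset_left hx)
  exact hf.continuousAt.mul (hg.continuousAt (hΩ.mem_nhds hx'))

theorem tsupport_pd (f : 𝔼 → ℝ) (k : Fin n) : tsupport (pd k f) ⊆ tsupport f := by
  refine (closure_mono ?_).trans (tsupport_fderiv_subset ℝ (f := f))
  intro x hx hcon
  exact hx (by simp [pd, hcon])

theorem TestF.pd {f : 𝔼 → ℝ} (hf : TestF Ω f) (k : Fin n) : TestF Ω (pd k f) :=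
  ⟨contDiff_pd hf.1 k, cpt_pd hf.2.1 k, (tsupport_pd f k).trans hf.2.2⟩

theorem ibp {f g : 𝔼 → ℝ} (hΩ : IsOpen Ω) (hf : TestF Ω f) (hg : ContDiffOn ℝ ∞ g Ω) (k : Fin n) :
    ∫ x, f x * pd k g x = - ∫ x, pd k f x * g x := by
  refine integral_mul_fderiv_eq_neg_fderiv_mul_of_integrable ?_ ?_ ?_ ?_ ?_
  · exact test_int hΩ (hf.pd k).1.continuous (hf.pd k).2.1 (hf.pd k).2.2 hg.continuousOn
  · exact test_int hΩ hf.1.continuous hf.2.1 hf.2.2 (contDiffOn_pd hΩ hg k).continuousOn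
  · exact test_int hΩ hf.1.continuous hf.2.1 hf.2.2 hg.continuousOn
  · exact fun x _ => hf.1.differentiable (by simp) x
  · exact fun x hx => (hg.contDiffAt (hΩ.mem_nhds (hf.2.2 hx))).differentiableAt (by simp)

theorem set_int {f : 𝔼 → ℝ} (hs : ∀ x, x ∉ Ω → f x = 0) : ∫ x in Ω, f x = ∫ x, f x :=
  setIntegral_eq_integral_of_forall_compl_eq_zero hs

theorem TestF.zero {f : 𝔼 → ℝ} (hf : TestF Ω f) {x : 𝔼} (hx : x ∉ Ω) : f x = 0 :=
  image_eq_zero_of_notMem_tsupport fun h => hx (hf.2.2 h)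

theorem TestF.mem0 {f : 𝔼 → ℝ} (hf : TestF Ω f) : MemLp f 2 (volume.restrict Ω) := memLp_of_cont hf.1.continuous hf.2.1 2

theorem gradient_apply (f : 𝔼 → ℝ) (x : 𝔼) (k : Fin n) : gradient f x k = pd k f x := by
  have := gradient_inner f x (EuclideanSpace.single k 1)
  rw [EuclideanSpace.inner_single_right] at this
  simpa [pd] using this

theorem norm_pd_le (f : 𝔼 → ℝ) (x : 𝔼) (k : Fin n) : ‖pd k f x‖ ≤ ‖gradient f x‖ := by
  rw [← gradient_apply]; exact PiLp.norm_apply_le _ _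

theorem poincare (hn : 0 < n) {R : ℝ} (hR : Ω ⊆ Metric.closedBall 0 R) {φ : 𝔼 → ℝ} (hφ : TestF Ω φ) :
    ‖hφ.mem0.toLp‖ ≤ 2 * R * ‖hφ.memLp.toLp‖ := by
  let k : Fin n := ⟨0, hn⟩
  let g : 𝔼 → ℝ := fun x => x k
  have hg : ContDiff ℝ ∞ g := (EuclideanSpace.proj (𝕜 := ℝ) k).contDiff
  have hg1 : ∀ x, pd k g x = 1 := by
    intro x
    have : fderiv ℝ g x = EuclideanSpace.proj (𝕜 := ℝ) k := (EuclideanSpace.proj (𝕜 := ℝ) k).fderiv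
    rw [pd, this]; simp
  have hφ' := hφ.pd k
  have hT : TestF univ (fun x => φ x * φ x) := ⟨hφ.1.mul hφ.1, hφ.2.1.mul_left, subset_univ _⟩
  have hm : MemLp (fun x => -2 * (pd k φ x * g x)) 2 (volume.restrict Ω) :=
    memLp_of_cont (contDiff_const.mul (hφ'.1.mul hg)).continuous (hφ'.2.1.mul_right.mul_left) 2
  have e1 : inner ℝ hφ.mem0.toLp hφ.mem0.toLp = inner ℝ hφ.mem0.toLp hm.toLp := by
    have key : ∀ {f : 𝔼 → ℝ} (hf : MemLp f 2 (volume.restrict Ω)), inner ℝ hφ.mem0.toLp hf.toLp = ∫ x in Ω, φ x * f x := by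
      intro f hf
      rw [L2.inner_def]
      refine integral_congr_ae ?_
      filter_upwards [hφ.mem0.coeFn_toLp, hf.coeFn_toLp] with x hx hx2
      rw [hx, hx2]; simp [mul_comm]
    rw [key, key, set_int (fun x hx => by rw [hφ.zero hx]; simp), set_int (fun x hx => by rw [hφ.zero hx]; simp)]
    have := ibp isOpen_univ hT hg.contDiffOn k
    simp only [hg1, mul_one] at this
    rw [this, ← integral_neg]
    refine integral_congr_ae (Eventually.of_forall fun x => ?_)
    have hd := hφ.1.differentiable (by simp) x
    simp only [pd_mul hd hd]
    ring
  have e2 : ‖hm.toLp‖ ≤ 2 * R * ‖hφ.memLp.toLp‖ := by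
    refine Lp.norm_le_mul_norm_of_ae_le_mul ?_
    by_cases hΩm : (volume.restrict Ω) = 0
    · rw [ae_eq_bot.2 hΩm]; exact eventually_bot
    have hR0 : 0 ≤ R := by
      by_contra hcon
      rw [Metric.closedBall_eq_empty.2 (not_le.1 hcon)] at hR
      exact hΩm (by rw [subset_empty_iff.1 hR]; simp)
    have hmem : ∀ᵐ x ∂(volume.restrict Ω), x ∈ Metric.closedBall (0:𝔼) R :=
      ae_restrict_of_ae_restrict_of_subset hR (ae_restrict_mem Metric.isClosed_closedBall.measurableSet)
    filter_upwards [hm.coeFn_toLp, hφ.memLp.coeFn_toLp, hmem] with x h1 h2 h3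
    rw [h1, h2, norm_mul, norm_mul]
    have h4 : ‖g x‖ ≤ R := (PiLp.norm_apply_le x k).trans (by simpa using h3)
    have h5 := norm_pd_le φ x k
    calc ‖(-2:ℝ)‖ * (‖pd k φ x‖ * ‖g x‖) ≤ ‖(-2:ℝ)‖ * (‖gradient φ x‖ * R) := by gcongr
      _ = _ := by simp; ring
  have e3 := (e1.symm ▸ real_inner_le_norm hφ.mem0.toLp hm.toLp : inner ℝ hφ.mem0.toLp hφ.mem0.toLp ≤ _)
  rw [real_inner_self_eq_norm_sq, sq] at e3
  by_cases h0 : ‖hφ.mem0.toLp‖ = 0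
  · rw [h0]; exact (norm_nonneg _).trans e2
  · exact (le_of_mul_le_mul_left e3 (lt_of_le_of_ne (norm_nonneg _) (Ne.symm h0))).trans e2

theorem exists_pot (hn : 0 < n) (hb : Bornology.IsBounded Ω) (p : Lp 𝔼 2 (volume.restrict Ω)) (hp : p ∈ KK Ω) :
    ∃ V : Lp ℝ 2 (volume.restrict Ω), ∀ ψ : 𝔼 → ℝ, ContDiff ℝ ∞ ψ → HasCompactSupport ψ → ∀ k,
      ∫ x in Ω, V x * pd k ψ x = - ∫ x in Ω, p x k * ψ x := by
  obtain ⟨R, hR⟩ := hb.subset_closedBall 0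
  have hp' : p ∈ closure (KK0 Ω : Set (Lp 𝔼 2 (volume.restrict Ω))) := hp
  obtain ⟨q, hq, hqp⟩ := mem_closure_iff_seq_limit.1 hp'
  choose φ hφ hφq using hq
  have hq' : ∀ j, (hφ j).memLp.toLp = q j := fun j => Lp.ext ((hφ j).memLp.coeFn_toLp.trans (hφq j).symm)
  have hsub : ∀ i j, TestF Ω (fun x => φ i x - φ j x) := fun i j =>
    ⟨(hφ i).1.sub (hφ j).1, (hφ i).2.1.sub (hφ j).2.1, (tsupport_sub _ _).trans (union_subset (hφ i).2.2 (hφ j).2.2)⟩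
  have hP : ∀ i j, ‖(hφ i).mem0.toLp - (hφ j).mem0.toLp‖ ≤ 2 * |R| * ‖q i - q j‖ := by
    intro i j
    have h1 := poincare hn (hR.trans (Metric.closedBall_subset_closedBall (le_abs_self R))) (hsub i j)
    have e1 : (hsub i j).mem0.toLp = (hφ i).mem0.toLp - (hφ j).mem0.toLp := MemLp.toLp_sub _ _
    have e2 : (hsub i j).memLp.toLp = q i - q j := by
      rw [← hq', ← hq', ← MemLp.toLp_sub]
      congr 1
      funext x
      simp only [Pi.sub_apply, gradient]
      rw [fderiv_fun_sub ((hφ i).1.differentiable (by simp) x) ((hφ j).1.differentiable (by simp) x), map_sub]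
    rwa [e1, e2] at h1
  have hC : CauchySeq (fun j => (hφ j).mem0.toLp) := by
    have h2 := hqp.cauchySeq
    rw [Metric.cauchySeq_iff] at h2 ⊢
    intro ε hε
    obtain ⟨N, hN⟩ := h2 (ε / (2 * |R| + 1)) (by positivity)
    refine ⟨N, fun a ha b hb => ?_⟩
    have h3 := hN a ha b hb
    rw [dist_eq_norm] at h3 ⊢
    have h4 := hP a b
    rw [lt_div_iff₀ (by positivity)] at h3
    nlinarith [norm_nonneg (q a - q b)]
  obtain ⟨V, hV⟩ := cauchySeq_tendsto_of_complete hC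
  refine ⟨V, fun ψ hψ hψc k => ?_⟩
  have m1 : MemLp (pd k ψ) 2 (volume.restrict Ω) := memLp_of_cont (contDiff_pd hψ k).continuous (cpt_pd hψc k) 2
  have m2 : MemLp (fun x => ψ x • EuclideanSpace.single k (1:ℝ)) 2 (volume.restrict Ω) :=
    memLp_of_cont (hψ.continuous.smul continuous_const) (hψc.smul_right) 2
  have t1 : Tendsto (fun j => inner ℝ m1.toLp (hφ j).mem0.toLp) atTop (𝓝 (inner ℝ m1.toLp V)) :=
    tendsto_const_nhds.inner hV
  have t2 : Tendsto (fun j => - inner ℝ m2.toLp (q j)) atTop (𝓝 (- inner ℝ m2.toLp p)) :=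
    (tendsto_const_nhds.inner hqp).neg
  have e1 : ∀ F : Lp ℝ 2 (volume.restrict Ω), inner ℝ m1.toLp F = ∫ x in Ω, F x * pd k ψ x := by
    intro F
    rw [L2.inner_def]
    refine integral_congr_ae ?_
    filter_upwards [m1.coeFn_toLp] with x hx
    rw [hx]; simp
  have e2 : ∀ F : Lp 𝔼 2 (volume.restrict Ω), inner ℝ m2.toLp F = ∫ x in Ω, F x k * ψ x := by
    intro F
    rw [L2.inner_def]
    refine integral_congr_ae ?_
    filter_upwards [m2.coeFn_toLp] with x hx
    rw [hx, real_inner_smul_left, EuclideanSpace.inner_single_left]; simp [mul_comm]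
  have e3 : (fun j => inner ℝ m1.toLp (hφ j).mem0.toLp) = fun j => - inner ℝ m2.toLp (q j) := by
    funext j
    rw [e1, e2]
    have a1 : ∫ x in Ω, (MemLp.toLp (φ j) (hφ j).mem0) x * pd k ψ x = ∫ x in Ω, φ j x * pd k ψ x := by
      refine integral_congr_ae ?_
      filter_upwards [(hφ j).mem0.coeFn_toLp] with x hx
      rw [hx]
    have a2 : ∫ x in Ω, q j x k * ψ x = ∫ x in Ω, pd k (φ j) x * ψ x := by
      refine integral_congr_ae ?_
      filter_upwards [hφq j] with x hx
      rw [hx, gradient_apply]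
    rw [a1, a2, set_int (fun x hx => by rw [(hφ j).zero hx]; simp), set_int (fun x hx => by rw [((hφ j).pd k).zero hx]; simp)]
    exact ibp isOpen_univ ⟨(hφ j).1, (hφ j).2.1, subset_univ _⟩ hψ.contDiffOn k
  rw [e3] at t1
  have := tendsto_nhds_unique t1 t2
  rwa [e1, e2] at this

end A1

section A1b
variable {n : ℕ} {Ω : Set (EuclideanSpace ℝ (Fin n))}
local notation "𝔼" => EuclideanSpace ℝ (Fin n)

theorem exists_weak (hn : 0 < n) (hΩ : IsOpen Ω) (hb : Bornology.IsBounded Ω) {G : 𝔼 → ℝ} (hG : ContDiff ℝ ∞ G)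
    (hGc : HasCompactSupport G) : ∃ v : 𝔼 → ℝ, ContDiffOn ℝ ∞ v Ω ∧ InV Ω v ∧
      (∀ φ, TestF Ω φ → ∫ x in Ω, inner ℝ (gradient v x + gradient G x) (gradient φ x) = 0) ∧
      (∀ x ∈ Ω, ∑ k, pd k (pd k v) x + ∑ k, pd k (pd k G) x = 0) ∧ IntegrableOn v Ω ∧
      ∀ ψ : 𝔼 → ℝ, ContDiff ℝ ∞ ψ → HasCompactSupport ψ → ∀ k, ∫ x in Ω, v x * pd k ψ x = - ∫ x in Ω, pd k v x * ψ x := by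
  have hfin : IsFiniteMeasure (volume.restrict Ω) := ⟨by rw [Measure.restrict_apply_univ]; exact hb.measure_lt_top⟩
  have hGt : TestF univ G := ⟨hG, hGc, subset_univ _⟩
  have hGm : MemLp (gradient G) 2 (volume.restrict Ω) := memLp_of_cont hGt.grad.1 hGt.grad.2 2
  let p : Lp 𝔼 2 (volume.restrict Ω) := - ((KK Ω).orthogonalProjectionOnto hGm.toLp : Lp 𝔼 2 (volume.restrict Ω))
  have hp : p ∈ KK Ω := (KK Ω).neg_mem (Subtype.coe_prop _)
  have hpw : ∀ φ, TestF Ω φ → ∫ x in Ω, inner ℝ (p x + gradient G x) (gradient φ x) = 0 := by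
    intro φ hφ
    have h1 := Submodule.starProjection_inner_eq_zero (K := KK Ω) hGm.toLp _ hφ.toLp_mem
    rw [← h1, L2.inner_def]
    refine integral_congr_ae ?_
    filter_upwards [hGm.coeFn_toLp, hφ.memLp.coeFn_toLp, Lp.coeFn_neg ((KK Ω).orthogonalProjectionOnto hGm.toLp : Lp 𝔼 2 (volume.restrict Ω)),
      Lp.coeFn_sub hGm.toLp ((KK Ω).orthogonalProjectionOnto hGm.toLp : Lp 𝔼 2 (volume.restrict Ω))] with x a1 a2 a3 a4
    have a3' : p x = - ((KK Ω).orthogonalProjectionOnto hGm.toLp : Lp 𝔼 2 (volume.restrict Ω)) x := a3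
    rw [Submodule.starProjection_apply, a4, Pi.sub_apply, a1, a2, a3']
    congr 1; abel
  obtain ⟨V, hV⟩ := exists_pot hn hb p hp
  have hVi : IntegrableOn V Ω := (Lp.memLp V).integrable (by norm_num)
  have hpi : ∀ k, IntegrableOn (fun x => p x k) Ω := by
    intro k
    have : Integrable (fun x => p x) (volume.restrict Ω) := (Lp.memLp p).integrable (by norm_num)
    exact (EuclideanSpace.proj (𝕜 := ℝ) k).integrable_comp this
  have bddi : ∀ {f g : 𝔼 → ℝ}, IntegrableOn f Ω → Continuous g → HasCompactSupport g → IntegrableOn (fun x => f x * g x) Ω := by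
    intro f g hf hg hgc
    obtain ⟨B, hB⟩ := hgc.exists_bound_of_continuous hg
    exact Integrable.mul_bdd (c := B) hf hg.aestronglyMeasurable (Eventually.of_forall hB)
  have hGi : IntegrableOn G Ω := (hG.continuous.integrable_of_hasCompactSupport hGc).integrableOn
  have hGi' : ∀ k, IntegrableOn (pd k G) Ω := fun k => ((contDiff_pd hG k).continuous.integrable_of_hasCompactSupport (cpt_pd hGc k)).integrableOn
  let u : 𝔼 → ℝ := Ω.indicator (fun x => V x + G x)
  have hu : Integrable u := (integrable_indicator_iff hΩ.measurableSet).2 (hVi.add hGi)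
  have hw : ∀ φ, TestF Ω φ → ∫ x, u x * ∑ k, pd k (pd k φ) x = 0 := by
    intro φ hφ
    have e1 : (fun x => u x * ∑ k, pd k (pd k φ) x) = Ω.indicator (fun x => (V x + G x) * ∑ k, pd k (pd k φ) x) := by
      funext x
      by_cases hx : x ∈ Ω <;> simp [u, hx]
    rw [e1, integral_indicator hΩ.measurableSet]
    have e2 : ∀ k, ∫ x in Ω, (V x * pd k (pd k φ) x + G x * pd k (pd k φ) x) = - ∫ x in Ω, (p x k * pd k φ x + pd k G x * pd k φ x) := by
      intro k
      have t := hφ.pd k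
      have t2 := t.pd k
      rw [integral_add (bddi hVi t2.1.continuous t2.2.1) (bddi hGi t2.1.continuous t2.2.1),
        integral_add (bddi (hpi k) t.1.continuous t.2.1) (bddi (hGi' k) t.1.continuous t.2.1), hV _ t.1 t.2.1 k,
        set_int (f := fun x => G x * pd k (pd k φ) x) (fun x hx => by rw [t2.zero hx]; simp),
        set_int (f := fun x => pd k G x * pd k φ x) (fun x hx => by rw [t.zero hx]; simp)]
      rw [ibp isOpen_univ hGt (contDiff_pd hφ.1 k).contDiffOn k]
      ring
    have e3 : ∫ x in Ω, (V x + G x) * ∑ k, pd k (pd k φ) x = ∑ k, ∫ x in Ω, (V x * pd k (pd k φ) x + G x * pd k (pd k φ) x) := by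
      rw [← integral_finsetSum]
      · simp only [Finset.mul_sum, add_mul]
      · intro k _
        have t2 := (hφ.pd k).pd k
        exact (bddi hVi t2.1.continuous t2.2.1).add (bddi hGi t2.1.continuous t2.2.1)
    rw [e3]
    simp only [e2]
    rw [Finset.sum_neg_distrib, ← integral_finsetSum, neg_eq_zero]
    · refine Eq.trans ?_ (hpw φ hφ)
      refine integral_congr_ae (Eventually.of_forall fun x => ?_)
      simp only [PiLp.inner_apply]
      refine Finset.sum_congr rfl fun k _ => ?_
      simp [gradient_apply]
      ring
    · intro k _
      have t := hφ.pd k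
      exact (bddi (hpi k) t.1.continuous t.2.1).add (bddi (hGi' k) t.1.continuous t.2.1)
  obtain ⟨w, hws, hwl, hwu⟩ := weyl hn hΩ hu hw
  let v : 𝔼 → ℝ := fun x => w x - G x
  have hvs : ContDiffOn ℝ ∞ v Ω := hws.sub hG.contDiffOn
  have hVv : ∀ᵐ x ∂(volume.restrict Ω), V x = v x := by
    rw [ae_restrict_iff' hΩ.measurableSet]
    filter_upwards [hwu] with x hx hxΩ
    have := hx hxΩ
    simp only [u, indicator_of_mem hxΩ] at this
    simp only [v]; linarith
  have hvi : IntegrableOn v Ω := Integrable.congr hVi hVv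
  have hvV : ∀ g : 𝔼 → ℝ, ∫ x in Ω, V x * g x = ∫ x in Ω, v x * g x := by
    intro g
    refine integral_congr_ae ?_
    filter_upwards [hVv] with x hx
    rw [hx]
  have hpk : ∀ k, ∀ᵐ x ∂(volume.restrict Ω), p x k = pd k v x := by
    intro k
    have h1 := hΩ.ae_eq_zero_of_integral_contDiff_smul_eq_zero (μ := volume) (f := fun x => Ω.indicator (fun x => p x k) x - pd k v x) ?_ ?_
    · rw [ae_restrict_iff' hΩ.measurableSet]
      filter_upwards [h1] with x hx hxΩ
      have := hx hxΩ
      rw [indicator_of_mem hxΩ] at this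
      linarith
    · refine LocallyIntegrableOn.sub ?_ ((contDiffOn_pd hΩ hvs k).continuousOn.locallyIntegrableOn hΩ.measurableSet)
      exact ((integrable_indicator_iff hΩ.measurableSet).2 (hpi k)).locallyIntegrable.locallyIntegrableOn _
    · intro g hg hgc hgs
      have hgt : TestF Ω g := ⟨hg, hgc, hgs⟩
      have a1 := hV g hg hgc k
      rw [hvV, set_int (fun x hx => by rw [(hgt.pd k).zero hx]; simp)] at a1
      have a2 := ibp hΩ hgt hvs k
      simp only [smul_eq_mul, mul_sub]
      have i1 : Integrable (fun x => g x * Ω.indicator (fun x => p x k) x) := by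
        have := (integrable_indicator_iff hΩ.measurableSet).2 (bddi (hpi k) hg.continuous hgc)
        refine this.congr (Eventually.of_forall fun x => ?_)
        by_cases hx : x ∈ Ω <;> simp [hx, mul_comm]
      rw [integral_sub i1 (test_int hΩ hg.continuous hgc hgs (contDiffOn_pd hΩ hvs k).continuousOn), a2]
      have a3 : ∫ x, g x * Ω.indicator (fun x => p x k) x = ∫ x in Ω, p x k * g x := by
        rw [← integral_indicator hΩ.measurableSet]
        refine integral_congr_ae (Eventually.of_forall fun x => ?_)
        by_cases hx : x ∈ Ω <;> simp [hx, mul_comm]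
      have a4 : ∫ x, pd k g x * v x = ∫ x, v x * pd k g x := by simp only [mul_comm]
      rw [a3, a4, a1]; ring
  have hpg : p =ᵐ[volume.restrict Ω] gradient v := by
    filter_upwards [ae_all_iff.2 hpk] with x hx
    ext k
    rw [hx k, gradient_apply]
  refine ⟨v, hvs, ⟨p, hp, hpg⟩, fun φ hφ => ?_, fun x hx => ?_, hvi, fun ψ hψ hψc k => ?_⟩
  · rw [← hpw φ hφ]
    refine integral_congr_ae ?_
    filter_upwards [hpg] with x hx
    rw [hx]
  · have h1 : ∀ k, pd k (pd k w) x = pd k (pd k v) x + pd k (pd k G) x := by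
      intro k
      have c1 : EqOn (pd k w) (fun y => pd k v y + pd k G y) Ω := by
        intro y hy
        beta_reduce
        rw [← pd_add ((hvs.contDiffAt (hΩ.mem_nhds hy)).differentiableAt (by simp)) (hG.differentiable (by simp) y)]
        simp [v]
      rw [pd_congr hΩ c1 k hx, pd_add (((contDiffOn_pd hΩ hvs k).contDiffAt (hΩ.mem_nhds hx)).differentiableAt (by simp))
        ((contDiff_pd hG k).differentiable (by simp) x)]
    rw [← Finset.sum_add_distrib, ← hwl x hx]
    exact Finset.sum_congr rfl fun k _ => (h1 k).symm
  · rw [← hvV, hV ψ hψ hψc k]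
    congr 1
    refine integral_congr_ae ?_
    filter_upwards [hpk k] with x hx
    rw [hx]

end A1b

section A6
variable {n : ℕ} {Ω : Set (EuclideanSpace ℝ (Fin n))}
local notation "𝔼" => EuclideanSpace ℝ (Fin n)

theorem ext_pts (hs : HasSmoothBoundary Ω) {x₀ : 𝔼} (hx₀ : x₀ ∈ frontier Ω) : x₀ ∈ closure (closure Ω)ᶜ := by
  obtain ⟨U, ρ, hU, hxU, hρ, hd, h1, h2⟩ := hs x₀ hx₀
  rw [mem_closure_iff_nhds]
  intro W hW
  by_contra hcon
  refine hd x₀ hxU ?_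
  have h0 : ρ x₀ = 0 := ((Set.ext_iff.1 h2 x₀).1 ⟨hx₀, hxU⟩).2
  have hmax : IsLocalMax ρ x₀ := by
    filter_upwards [hW, hU.mem_nhds hxU] with y hyW hyU
    rw [h0]
    have hy : y ∈ closure Ω := by
      by_contra hy
      exact hcon ⟨y, hyW, hy⟩
    rw [closure_eq_self_union_frontier] at hy
    rcases hy with hy | hy
    · exact ((Set.ext_iff.1 h1 y).1 ⟨hy, hyU⟩).2.le
    · exact ((Set.ext_iff.1 h2 y).1 ⟨hy, hyU⟩).2.le
  exact hmax.fderiv_eq_zero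

theorem norm_fderiv_le {g : 𝔼 → ℝ} {x : 𝔼} {M : ℝ} (h : ∀ k, ‖pd k g x‖ ≤ M) (hM : 0 ≤ M) : ‖fderiv ℝ g x‖ ≤ n * M := by
  refine ContinuousLinearMap.opNorm_le_bound _ (by positivity) fun v => ?_
  rw [fderiv_eq_pd]
  refine (norm_sum_le _ _).trans ?_
  calc ∑ k, ‖v k * pd k g x‖ ≤ ∑ _k : Fin n, ‖v‖ * M := by
        refine Finset.sum_le_sum fun k _ => ?_
        rw [norm_mul]
        have := PiLp.norm_apply_le v k
        have := h k
        gcongr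
    _ = _ := by simp; ring

theorem bdry_zero (hn : 0 < n) (hΩ : IsOpen Ω) (hs : HasSmoothBoundary Ω) {x₀ : 𝔼} (hx₀ : x₀ ∈ frontier Ω) {v : 𝔼 → ℝ}
    (hv : ContDiffOn ℝ ∞ v Ω) (hvi : IntegrableOn v Ω)
    (hw : ∀ ψ : 𝔼 → ℝ, ContDiff ℝ ∞ ψ → HasCompactSupport ψ → ∀ k, ∫ x in Ω, v x * pd k ψ x = - ∫ x in Ω, pd k v x * ψ x)
    {U : Set 𝔼} (hU : IsOpen U) (hxU : x₀ ∈ U) {M : ℝ} (hM : ∀ x ∈ Ω ∩ U, ‖fderiv ℝ v x‖ ≤ M) :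
    Tendsto v (𝓝[Ω] x₀) (𝓝 0) := by
  obtain ⟨r, hr, hrU⟩ := Metric.isOpen_iff.1 hU x₀ hxU
  wlog hM0 : 0 ≤ M generalizing M
  · exact this (M := |M|) (fun x hx => (hM x hx).trans (le_abs_self M)) (abs_nonneg M)
  let u : 𝔼 → ℝ := Ω.indicator v
  have hu : Integrable u := (integrable_indicator_iff hΩ.measurableSet).2 hvi
  let K : ℝ → 𝔼 → ℝ := fun s z => (kc n)⁻¹ * Kern n s z
  have hKs : ∀ s, ContDiff ℝ ∞ (K s) := fun s => contDiff_const.mul (Kern_smooth s)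
  have hKc : ∀ s, 0 < s → HasCompactSupport (K s) := fun s hs => (Kern_cpt hs).mul_left
  have hK0 : ∀ s, 0 < s → ∀ z, 0 ≤ K s z := fun s hs z =>
    mul_nonneg (inv_nonneg.2 (kc_pos hn).le) (mul_nonneg (by positivity) (gg_nonneg _))
  let F : ℝ → 𝔼 → ℝ := fun s x => ∫ y, u y * K s (x - y)
  have hF : ∀ s, 0 < s → ContDiff ℝ ∞ (F s) := fun s hs => cv_smooth hu.locallyIntegrable (hKs s) (hKc s hs)
  have hpd : ∀ s, 0 < s → s < r / 2 → ∀ x ∈ Metric.ball x₀ (r / 2), ∀ k, ‖pd k (F s) x‖ ≤ M := by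
    intro s hs0 hsr x hx k
    have hcx : HasCompactSupport (fun y => K s (x - y)) := (hKc s hs0).comp_homeomorph (Homeomorph.subLeft x)
    have hsx : ContDiff ℝ ∞ (fun y => K s (x - y)) := (hKs s).comp (contDiff_const.sub contDiff_id)
    have e1 : pd k (F s) x = ∫ y in Ω, pd k v y * K s (x - y) := by
      have a := congrFun (cv_pd hu.locallyIntegrable (hKs s) (hKc s hs0) k) x
      refine a.trans ?_
      have b := hw _ hsx hcx k
      rw [← neg_eq_iff_eq_neg] at b
      rw [← b, pd_refl ((hKs s).differentiable (by simp)), ← integral_neg, ← integral_indicator hΩ.measurableSet]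
      refine integral_congr_ae (Eventually.of_forall fun y => ?_)
      by_cases hy : y ∈ Ω <;> simp [u, hy]
    have hKi : Integrable (fun y => K s (x - y)) := hsx.continuous.integrable_of_hasCompactSupport hcx
    rw [e1]
    have e2 : ‖∫ y in Ω, pd k v y * K s (x - y)‖ ≤ ∫ y in Ω, M * K s (x - y) := by
      refine norm_integral_le_of_norm_le (hKi.const_mul M).integrableOn ?_
      rw [ae_restrict_iff' hΩ.measurableSet]
      refine Eventually.of_forall fun y hy => ?_
      rw [norm_mul, Real.norm_of_nonneg (hK0 s hs0 _)]
      by_cases hxy : s ≤ ‖x - y‖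
      · simp only [K, Kern_supp hs0 hxy, mul_zero, le_refl]
      · have hyU : y ∈ U := by
          refine hrU ?_
          rw [Metric.mem_ball] at hx ⊢
          rw [← dist_eq_norm, dist_comm] at hxy
          linarith [dist_triangle y x x₀]
        refine mul_le_mul_of_nonneg_right ?_ (hK0 s hs0 _)
        refine ((fderiv ℝ v y).le_opNorm _).trans ?_
        rw [PiLp.norm_single, norm_one, mul_one]
        exact hM y ⟨hy, hyU⟩
    refine e2.trans ?_
    refine (setIntegral_le_integral (hKi.const_mul M) (Eventually.of_forall fun y => mul_nonneg hM0 (hK0 s hs0 _))).trans ?_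
    rw [integral_const_mul, integral_const_mul, Kern_int hs0, inv_mul_cancel₀ (kc_pos hn).ne', mul_one]
  have hLip : ∀ s, 0 < s → s < r / 2 → ∀ x ∈ Metric.ball x₀ (r / 2), ∀ y ∈ Metric.ball x₀ (r/2), ‖F s x - F s y‖ ≤ n * M * ‖x - y‖ := by
    intro s hs0 hsr x hx y hy
    exact (convex_ball x₀ (r/2)).norm_image_sub_le_of_norm_fderiv_le (fun z _ => (hF s hs0).differentiable (by simp) z)
      (fun z hz => norm_fderiv_le (hpd s hs0 hsr z hz) hM0) hy hx
  have hae : ∀ᵐ x, x ∈ Ω ∩ Metric.ball x₀ (r / 2) → |v x| ≤ n * M * ‖x - x₀‖ := by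
    filter_upwards [Kern_ae hu hn] with x hx hxΩ
    have ht : Tendsto (fun s => F s x) (𝓝[>] 0) (𝓝 (v x)) := by
      have : u x = v x := indicator_of_mem hxΩ.1 _
      rw [← this]
      refine hx.congr fun s => integral_congr_ae (Eventually.of_forall fun y => ?_)
      simp only [K]; ring
    have key : ∀ y ∈ (closure Ω)ᶜ ∩ Metric.ball x₀ (r/2), |v x| ≤ n * M * ‖x - y‖ := by
      intro y hy
      obtain ⟨ε, hε, hεs⟩ := Metric.isOpen_iff.1 isClosed_closure.isOpen_compl y hy.1
      refine le_of_tendsto ht.abs ?_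
      filter_upwards [Ioo_mem_nhdsGT (lt_min hε (by linarith : 0 < r / 2))] with s hs
      have hs1 := hs.2.trans_le (min_le_left _ _)
      have h1 := hLip s hs.1 (hs.2.trans_le (min_le_right _ _)) x hxΩ.2 y hy.2
      have h2 : F s y = 0 := by
        refine integral_eq_zero_of_ae (Eventually.of_forall fun z => ?_)
        by_cases hz : z ∈ Ω
        · have : s ≤ ‖y - z‖ := by
            by_contra hcon
            refine hεs (?_ : z ∈ Metric.ball y ε) (subset_closure hz)
            rw [Metric.mem_ball, dist_comm, dist_eq_norm]; linarith
          simp [K, Kern_supp hs.1 this]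
        · simp [u, hz]
      rwa [h2, sub_zero] at h1
    have hcl : x₀ ∈ closure ((closure Ω)ᶜ ∩ Metric.ball x₀ (r/2)) := by
      rw [inter_comm]
      exact Metric.isOpen_ball.inter_closure ⟨Metric.mem_ball_self (by linarith), ext_pts hs hx₀⟩
    have hcl2 : IsClosed {y : 𝔼 | |v x| ≤ n * M * ‖x - y‖} := isClosed_le continuous_const (by fun_prop)
    exact (closure_minimal key hcl2) hcl
  have hall : ∀ x ∈ Ω ∩ Metric.ball x₀ (r / 2), |v x| ≤ n * M * ‖x - x₀‖ := by
    have ho : IsOpen (Ω ∩ Metric.ball x₀ (r / 2) ∩ (fun x => |v x| - n * M * ‖x - x₀‖) ⁻¹' Ioi 0) := by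
      refine ContinuousOn.isOpen_inter_preimage ?_ (hΩ.inter Metric.isOpen_ball) isOpen_Ioi
      exact ((hv.continuousOn.mono inter_subset_left).abs).sub (by fun_prop)
    have hz : volume (Ω ∩ Metric.ball x₀ (r / 2) ∩ (fun x => |v x| - n * M * ‖x - x₀‖) ⁻¹' Ioi 0) = 0 := by
      refine measure_mono_null ?_ hae
      rintro x ⟨hx, hx2⟩ hcon
      have hx2' : 0 < |v x| - n * M * ‖x - x₀‖ := hx2
      linarith [hcon hx]
    have he := ho.eq_empty_of_measure_zero hz
    intro x hx
    by_contra hcon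
    have : x ∈ (∅ : Set 𝔼) := he ▸ ⟨hx, by simp only [mem_preimage, mem_Ioi]; linarith⟩
    exact this
  have hlim : Tendsto (fun x => n * M * ‖x - x₀‖) (𝓝[Ω] x₀) (𝓝 0) := by
    have : Tendsto (fun x => n * M * ‖x - x₀‖) (𝓝 x₀) (𝓝 (n * M * ‖x₀ - x₀‖)) := (by fun_prop : Continuous (fun x => n * M * ‖x - x₀‖)).tendsto x₀
    simp only [sub_self, norm_zero, mul_zero] at this
    exact this.mono_left nhdsWithin_le_nhds
  refine squeeze_zero_norm' ?_ hlim
  filter_upwards [self_mem_nhdsWithin, mem_nhdsWithin_of_mem_nhds (Metric.ball_mem_nhds x₀ (by linarith : 0 < r / 2))] with x h1 h2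
  exact hall x ⟨h1, h2⟩

end A6

section ThA
variable {n : ℕ} {Ω : Set (EuclideanSpace ℝ (Fin n))}
local notation "𝔼" => EuclideanSpace ℝ (Fin n)

theorem dirichlet (hn : 0 < n) (hΩ : IsOpen Ω) (hb : Bornology.IsBounded Ω) (hs : HasSmoothBoundary Ω) {G : 𝔼 → ℝ}
    (hG : ContDiff ℝ ∞ G) (hGc : HasCompactSupport G) :
    ∃ w : 𝔼 → ℝ, ContDiffOn ℝ ∞ w (closure Ω) ∧ IsHarmonicOn w Ω ∧ ∀ x ∈ frontier Ω, w x = G x := by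
  obtain ⟨v, hv, hV, hw, hl, hvi, hvw⟩ := exists_weak hn hΩ hb hG hGc
  have heq : EqOn (extendFrom Ω v) v Ω := fun x hx =>
    extendFrom_eq (subset_closure hx) (hv.continuousOn x hx)
  refine ⟨fun x => extendFrom Ω v x + G x, ?_, ⟨?_, ?_⟩, ?_⟩
  · refine ContDiffOn.add ?_ hG.contDiffOn
    intro x hx
    rw [closure_eq_self_union_frontier] at hx
    rcases hx with hx | hx
    · refine ContDiffAt.contDiffWithinAt ?_
      exact (hv.contDiffAt (hΩ.mem_nhds hx)).congr_of_eventuallyEq (heq.eventuallyEq_of_mem (hΩ.mem_nhds hx))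
    · obtain ⟨i, e, hc⟩ := exists_bchart hs hx
      obtain ⟨U, hU, hxU, ⟨V, hVs, hVv⟩, -⟩ := hc.extend hΩ hb hv hV hG hGc hw hl
      have he : EqOn (extendFrom Ω v) V (closure Ω ∩ U) := by
        intro y hy
        refine extendFrom_eq hy.1 ?_
        have h1 : Tendsto V (𝓝[Ω ∩ U] y) (𝓝 (V y)) :=
          (hVs.continuousOn y hy).mono_left (nhdsWithin_mono _ (inter_subset_inter_left _ subset_closure))
        have h2 : Tendsto v (𝓝[Ω ∩ U] y) (𝓝 (V y)) := by
          refine h1.congr' ?_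
          filter_upwards [self_mem_nhdsWithin] with z hz using hVv hz
        rwa [nhdsWithin_inter_of_mem' (mem_nhdsWithin_of_mem_nhds (hU.mem_nhds hy.2))] at h2
      have hx' : x ∈ closure Ω ∩ U := ⟨frontier_subset_closure hx, hxU⟩
      have h3 := (hVs x hx').congr he (he hx')
      exact (contDiffWithinAt_inter (hU.mem_nhds hxU)).1 h3
  · refine ContDiffOn.add ?_ (hG.of_le two_le_infty).contDiffOn
    exact (hv.of_le two_le_infty).congr heq
  · intro x hx
    have hwv : EqOn (fun x => extendFrom Ω v x + G x) (fun x => v x + G x) Ω := fun y hy => by simp only [heq hy]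
    have hwc : ContDiffOn ℝ ∞ (fun x => v x + G x) Ω := hv.add hG.contDiffOn
    rw [lap_eq_pd (((hwc.contDiffAt (hΩ.mem_nhds hx)).congr_of_eventuallyEq (hwv.eventuallyEq_of_mem (hΩ.mem_nhds hx))).of_le two_le_infty)]
    rw [← hl x hx, ← Finset.sum_add_distrib]
    refine Finset.sum_congr rfl fun k _ => ?_
    have c1 : EqOn (pd k (fun x => extendFrom Ω v x + G x)) (fun y => pd k v y + pd k G y) Ω := by
      intro y hy
      rw [pd_congr hΩ hwv k hy]
      exact pd_add ((hv.contDiffAt (hΩ.mem_nhds hy)).differentiableAt (by simp)) (hG.differentiable (by simp) y) k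
    rw [pd_congr hΩ c1 k hx]
    exact pd_add (((contDiffOn_pd hΩ hv k).contDiffAt (hΩ.mem_nhds hx)).differentiableAt (by simp))
        ((contDiff_pd hG k).differentiable (by simp) x) k
  · intro x hx
    obtain ⟨i, e, hc⟩ := exists_bchart hs hx
    obtain ⟨U, hU, hxU, -, ⟨M, hM⟩⟩ := hc.extend hΩ hb hv hV hG hGc hw hl
    have := extendFrom_eq (frontier_subset_closure hx) (bdry_zero hn hΩ hs hx hv hvi hvw hU hxU hM)
    simp only [this, zero_add]

end ThA

section MaxP
variable {n : ℕ} {Ω : Set (EuclideanSpace ℝ (Fin n))}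
local notation "𝔼" => EuclideanSpace ℝ (Fin n)

theorem pd2_le {g : 𝔼 → ℝ} (hΩ : IsOpen Ω) (hg : ContDiffOn ℝ ∞ g Ω) {x : 𝔼} (hx : x ∈ Ω) (hm : IsLocalMax g x) (k : Fin n) :
    pd k (pd k g) x ≤ 0 := by
  by_contra hcon
  rw [not_le] at hcon
  let ℓ : ℝ → 𝔼 := fun t => x + t • EuclideanSpace.single k (1:ℝ)
  have hℓ : ∀ t, HasDerivAt ℓ (EuclideanSpace.single k (1:ℝ)) t := fun t => by
    exact (((hasDerivAt_id t).smul_const (EuclideanSpace.single k (1:ℝ))).const_add x).congr_deriv (one_smul _ _)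
  have hℓc : Continuous ℓ := by fun_prop
  have hd : ∀ {f : 𝔼 → ℝ}, ContDiffOn ℝ ∞ f Ω → ∀ t, ℓ t ∈ Ω → HasDerivAt (fun t => f (ℓ t)) (pd k f (ℓ t)) t := fun hf t ht =>
    ((hf.contDiffAt (hΩ.mem_nhds ht)).differentiableAt (by simp)).hasFDerivAt.comp_hasDerivAt t (hℓ t)
  have h0 : ℓ 0 = x := by simp [ℓ]
  have hev : ∀ᶠ t in 𝓝 (0:ℝ), ℓ t ∈ Ω := hℓc.continuousAt.eventually_mem (by rw [h0]; exact hΩ.mem_nhds hx)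
  have e1 : deriv (fun t => g (ℓ t)) =ᶠ[𝓝 0] fun t => pd k g (ℓ t) := by
    filter_upwards [hev] with t ht using (hd hg t ht).deriv
  have e2 : deriv (deriv (fun t => g (ℓ t))) 0 = pd k (pd k g) x := by
    rw [e1.deriv_eq, (hd (contDiffOn_pd hΩ hg k) 0 (h0 ▸ hx)).deriv, h0]
  have hmax : IsLocalMax (fun t => g (ℓ t)) 0 := by
    have : Tendsto ℓ (𝓝 0) (𝓝 x) := by
      have := hℓc.tendsto 0
      rwa [h0] at this
    have := this.eventually hm
    simpa [IsLocalMax, IsMaxFilter, h0] using this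
  have hmin := isLocalMin_of_deriv_deriv_pos (e2 ▸ hcon) hmax.deriv_eq_zero (hd hg 0 (h0 ▸ hx)).continuousAt
  have hcst : (fun t => g (ℓ t)) =ᶠ[𝓝 0] fun _ => g (ℓ 0) := by
    filter_upwards [hmin, hmax] with t a b using le_antisymm b a
  have : deriv (deriv (fun t => g (ℓ t))) 0 = 0 := by
    rw [hcst.deriv.deriv_eq]; simp
  rw [e2] at this
  linarith

theorem maxp (hn : 0 < n) (hΩ : IsOpen Ω) (hb : Bornology.IsBounded Ω) {w : 𝔼 → ℝ} (hw : ContDiffOn ℝ ∞ w (closure Ω))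
    (hh : IsHarmonicOn w Ω) {B : ℝ} (hB : ∀ x ∈ frontier Ω, w x ≤ B) : ∀ x ∈ closure Ω, w x ≤ B := by
  obtain ⟨R, hR⟩ := hb.closure.subset_closedBall 0
  have hwΩ : ContDiffOn ℝ ∞ w Ω := hw.mono subset_closure
  intro x hx
  refine le_of_forall_pos_le_add fun δ hδ => ?_
  obtain ⟨ε, hε, hεδ⟩ : ∃ ε : ℝ, 0 < ε ∧ R ^ 2 * ε ≤ δ := by
    refine ⟨δ / (R ^ 2 + 1), by positivity, ?_⟩
    rw [mul_div_assoc', div_le_iff₀ (by positivity)]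
    nlinarith
  let q : 𝔼 → ℝ := fun y => ‖0 - y‖ ^ 2 * ε
  have hq : ContDiff ℝ ∞ q := sq_smooth 0 ε
  have hgs : ContDiffOn ℝ ∞ (fun y => w y + q y) Ω := hwΩ.add hq.contDiffOn
  obtain ⟨z, hz, hzm⟩ := hb.isCompact_closure.exists_isMaxOn (f := fun y => w y + q y) ⟨x, hx⟩
    (hw.continuousOn.add hq.continuous.continuousOn)
  have hzf : z ∈ frontier Ω := by
    rw [closure_eq_self_union_frontier] at hz
    refine hz.resolve_left fun hzΩ => ?_
    have hloc : IsLocalMax (fun y => w y + q y) z := hzm.isLocalMax (mem_of_superset (hΩ.mem_nhds hzΩ) subset_closure)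
    have h1 : ∀ k, pd k (pd k w) z + 2 * ε ≤ 0 := by
      intro k
      have h2 := pd2_le hΩ hgs hzΩ hloc k
      have e1 : EqOn (pd k (fun y => w y + q y)) (fun y => pd k w y + (-2 * ε * ((0:𝔼) k - y k))) Ω := by
        intro y hy
        refine (pd_add ((hwΩ.contDiffAt (hΩ.mem_nhds hy)).differentiableAt (by simp)) (hq.differentiable (by simp) y) k).trans ?_
        beta_reduce
        rw [congrFun (pd_sq 0 ε k) y]
      rw [pd_congr hΩ e1 k hzΩ, pd_add (((contDiffOn_pd hΩ hwΩ k).contDiffAt (hΩ.mem_nhds hzΩ)).differentiableAt (by simp)) (by fun_prop)] at h2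
      rwa [pd_lin (0:𝔼) ε k z] at h2
    have h3 := hh.2 z hzΩ
    rw [lap_eq_pd ((hwΩ.contDiffAt (hΩ.mem_nhds hzΩ)).of_le two_le_infty)] at h3
    have h4 := Finset.sum_le_sum fun k (_ : k ∈ Finset.univ) => h1 k
    rw [Finset.sum_add_distrib, h3] at h4
    simp at h4
    have : (0:ℝ) < n := by exact_mod_cast hn
    nlinarith [mul_pos this hε]
  have h5 : w x + q x ≤ w z + q z := hzm hx
  have h6 : 0 ≤ q x := by positivity
  have h7 : q z ≤ R ^ 2 * ε := by
    have := hR hz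
    simp only [Metric.mem_closedBall, dist_zero_right] at this
    simp only [q, zero_sub, norm_neg]
    gcongr
  linarith [hB z hzf]

theorem maxp_abs (hn : 0 < n) (hΩ : IsOpen Ω) (hb : Bornology.IsBounded Ω) {w : 𝔼 → ℝ} (hw : ContDiffOn ℝ ∞ w (closure Ω))
    (hh : IsHarmonicOn w Ω) {B : ℝ} (hB : ∀ x ∈ frontier Ω, |w x| ≤ B) : ∀ x ∈ closure Ω, |w x| ≤ B := by
  intro x hx
  have h2 : IsHarmonicOn (fun y => - w y) Ω := by
    refine ⟨hh.1.neg, fun y hy => ?_⟩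
    have hc := (hh.1.contDiffAt (hΩ.mem_nhds hy))
    have := hh.2 y hy
    rw [lap_eq_pd hc] at this
    rw [lap_eq_pd hc.neg]
    simp only [pd_neg, Finset.sum_neg_distrib, this, neg_zero]
  rw [abs_le']
  exact ⟨maxp hn hΩ hb hw hh (fun y hy => (le_abs_self _).trans (hB y hy)) x hx,
    maxp hn hΩ hb hw.neg h2 (fun y hy => (neg_le_abs _).trans (hB y hy)) x hx⟩
end MaxP

section Kelvin
variable {n : ℕ}
local notation "𝔼" => EuclideanSpace ℝ (Fin n)

def YY (p e : 𝔼) (c : ℝ) (x : 𝔼) : ℝ := inner ℝ e (x - p) / ‖x - p‖ ^ 2 - c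

def hU (p e e' : 𝔼) (c s θ : ℝ) (x : 𝔼) : ℝ :=
  Real.exp ((1 - n / 2) * Real.log (‖x - p‖ ^ 2) + s * YY p e c x) * Real.cos (s * YY p e' 0 x + θ)

theorem nsq_pos {p x : 𝔼} (hx : x ≠ p) : 0 < ‖x - p‖ ^ 2 := by
  have := norm_pos_iff.2 (sub_ne_zero.2 hx)
  positivity

theorem YY_smooth (p e : 𝔼) (c : ℝ) : ContDiffOn ℝ ∞ (YY p e c) {p}ᶜ := by
  refine ContDiffOn.sub (ContDiffOn.div ?_ ?_ fun x hx => (nsq_pos hx).ne') contDiffOn_const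
  · exact (contDiff_const.inner ℝ (contDiff_id.sub contDiff_const)).contDiffOn
  · exact ((contDiff_id.sub contDiff_const).norm_sq ℝ).contDiffOn

theorem log_smooth (p : 𝔼) : ContDiffOn ℝ ∞ (fun x => (1 - n / 2) * Real.log (‖x - p‖ ^ 2)) {p}ᶜ := by
  refine contDiffOn_const.mul (ContDiffOn.log ?_ fun x hx => (nsq_pos hx).ne')
  exact ((contDiff_id.sub contDiff_const).norm_sq ℝ).contDiffOn

theorem hU_smooth (p e e' : 𝔼) (c s θ : ℝ) : ContDiffOn ℝ ∞ (hU p e e' c s θ) {p}ᶜ := by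
  refine ContDiffOn.mul ?_ ?_
  · exact Real.contDiff_exp.comp_contDiffOn ((log_smooth p).add (contDiffOn_const.mul (YY_smooth p e c)))
  · exact Real.contDiff_cos.comp_contDiffOn ((contDiffOn_const.mul (YY_smooth p e' 0)).add contDiffOn_const)

theorem pd_of {g : 𝔼 → ℝ} {x : 𝔼} {k : Fin n} {c : ℝ} (hg : DifferentiableAt ℝ g x)
    (h : HasDerivAt (fun t : ℝ => g (x + t • EuclideanSpace.single k (1:ℝ))) c 0) : pd k g x = c := by
  have h0 : x + (0:ℝ) • EuclideanSpace.single k (1:ℝ) = x := by simp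
  have h1 : HasDerivAt (fun t : ℝ => x + t • EuclideanSpace.single k (1:ℝ)) (EuclideanSpace.single k (1:ℝ)) 0 :=
    (((hasDerivAt_id (0:ℝ)).smul_const (EuclideanSpace.single k (1:ℝ))).const_add x).congr_deriv (one_smul _ _)
  have h2 : HasFDerivAt g (fderiv ℝ g x) (x + (0:ℝ) • EuclideanSpace.single k (1:ℝ)) := by rw [h0]; exact hg.hasFDerivAt
  exact (h2.comp_hasDerivAt (0:ℝ) h1).unique h

def Ak (p e : 𝔼) (s a : ℝ) (k : Fin n) (x : 𝔼) : ℝ :=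
  a * (2 * (x k - p k) / ‖x - p‖ ^ 2) + s * (e k / ‖x - p‖ ^ 2 - 2 * inner ℝ e (x - p) * (x k - p k) / (‖x - p‖ ^ 2) ^ 2)

theorem hU_harm (p e e' : 𝔼) (he : inner ℝ e e = (1:ℝ)) (he' : inner ℝ e' e' = (1:ℝ)) (hee : inner ℝ e e' = (0:ℝ)) (c s θ : ℝ) {x : 𝔼} (hx : x ≠ p) :
    ∑ k, pd k (pd k (hU p e e' c s θ)) x = 0 := by
  have ho : IsOpen ({p}ᶜ : Set 𝔼) := isOpen_compl_singleton
  -- basic derivatives along coordinate lines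
  have b0 : ∀ (x : 𝔼) (k : Fin n), HasDerivAt (fun t : ℝ => x + t • EuclideanSpace.single k (1:ℝ) - p) (EuclideanSpace.single k (1:ℝ)) 0 := fun x k =>
    ((((hasDerivAt_id (0:ℝ)).smul_const (EuclideanSpace.single k (1:ℝ))).const_add x).sub_const p).congr_deriv (one_smul _ _)
  have b1 : ∀ (x : 𝔼) (k : Fin n), HasDerivAt (fun t : ℝ => ‖x + t • EuclideanSpace.single k (1:ℝ) - p‖ ^ 2) (2 * (x k - p k)) 0 := by
    intro x k
    refine (b0 x k).norm_sq.congr_deriv ?_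
    simp [EuclideanSpace.inner_single_right]
  have b2 : ∀ (e x : 𝔼) (k : Fin n), HasDerivAt (fun t : ℝ => inner ℝ e (x + t • EuclideanSpace.single k (1:ℝ) - p)) (e k) 0 := by
    intro e x k
    refine ((hasDerivAt_const (0:ℝ) e).inner ℝ (b0 x k)).congr_deriv ?_
    simp [EuclideanSpace.inner_single_right]
  have b3 : ∀ (x : 𝔼) (k : Fin n), HasDerivAt (fun t : ℝ => (x + t • EuclideanSpace.single k (1:ℝ)) k - p k) 1 0 := by
    intro x k
    have : (fun t : ℝ => (x + t • EuclideanSpace.single k (1:ℝ)) k - p k) = fun t => x k + t - p k := by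
      funext t; simp
    rw [this]
    exact ((hasDerivAt_id (0:ℝ)).const_add _).sub_const _
  have z0 : ∀ (x : 𝔼) (k : Fin n), x + (0:ℝ) • EuclideanSpace.single k (1:ℝ) = x := by intro x k; simp
  have dA : ∀ (e : 𝔼) (s a c : ℝ) (x : 𝔼), x ≠ p → ∀ k : Fin n, HasDerivAt (fun t : ℝ => a * Real.log (‖x + t • EuclideanSpace.single k (1:ℝ) - p‖ ^ 2) +
      s * YY p e c (x + t • EuclideanSpace.single k (1:ℝ))) (Ak p e s a k x) 0 := by
    intro e s a c x hx k
    have hne : ‖x + (0:ℝ) • EuclideanSpace.single k (1:ℝ) - p‖ ^ 2 ≠ 0 := by rw [z0]; exact (nsq_pos hx).ne'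
    have hp := (nsq_pos hx).ne'
    refine ((((b1 x k).log hne).const_mul a).add ((((b2 e x k).div (b1 x k) hne).sub_const c).const_mul s)).congr_deriv ?_
    simp only [z0, Ak]
    field_simp
  have dAk : ∀ (e : 𝔼) (s a : ℝ) (k : Fin n), HasDerivAt (fun t : ℝ => Ak p e s a k (x + t • EuclideanSpace.single k (1:ℝ)))
      (a * (2 / ‖x - p‖ ^ 2 - 4 * (x k - p k) ^ 2 / (‖x - p‖ ^ 2) ^ 2) + s * (- 4 * (e k * (x k - p k)) / (‖x - p‖ ^ 2) ^ 2
        - 2 * inner ℝ e (x - p) / (‖x - p‖ ^ 2) ^ 2 + 8 * inner ℝ e (x - p) * (x k - p k) ^ 2 / (‖x - p‖ ^ 2) ^ 3)) 0 := by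
    intro e s a k
    have hne : ‖x + (0:ℝ) • EuclideanSpace.single k (1:ℝ) - p‖ ^ 2 ≠ 0 := by rw [z0]; exact (nsq_pos hx).ne'
    have hp := (nsq_pos hx).ne'
    refine (((((b3 x k).const_mul 2).fun_div (b1 x k) hne).const_mul a).fun_add ((((hasDerivAt_const (0:ℝ) (e k)).fun_div (b1 x k) hne).fun_sub
      (((((b2 e x k).const_mul 2).fun_mul (b3 x k))).fun_div ((b1 x k).fun_pow 2) (pow_ne_zero 2 hne))).const_mul s)).congr_deriv ?_
    simp only [z0, Nat.add_one_sub_one, pow_one, show 2 - 1 = 1 from rfl]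
    clear hne
    generalize ‖x - p‖ ^ 2 = R at hp ⊢
    push_cast
    field_simp
    ring
  let B : 𝔼 → ℝ := fun x => s * YY p e' 0 x + θ
  let A : 𝔼 → ℝ := fun x => (1 - n / 2) * Real.log (‖x - p‖ ^ 2) + s * YY p e c x
  have dB : ∀ (x : 𝔼), x ≠ p → ∀ k : Fin n, HasDerivAt (fun t : ℝ => B (x + t • EuclideanSpace.single k (1:ℝ))) (Ak p e' s 0 k x) 0 := by
    intro x hx k
    refine ((dA e' s 0 0 x hx k).add_const θ).congr_of_eventuallyEq (Eventually.of_forall fun t => ?_)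
    simp [B]
  have p1 : ∀ k, EqOn (pd k (hU p e e' c s θ)) (fun x => Real.exp (A x) * (Ak p e s (1 - n / 2) k x * Real.cos (B x) - Ak p e' s 0 k x * Real.sin (B x))) {p}ᶜ := by
    intro k y hy
    refine pd_of (((hU_smooth p e e' c s θ).contDiffAt (ho.mem_nhds hy)).differentiableAt (by simp)) ?_
    refine ((dA e s (1 - n / 2) c y hy k).exp.fun_mul (dB y hy k).cos).congr_deriv ?_
    simp only [z0, A]
    ring
  have p2 : ∀ k, pd k (pd k (hU p e e' c s θ)) x = Real.exp (A x) * (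
      (Ak p e s (1 - n / 2) k x ^ 2 + ((1 - n / 2) * (2 / ‖x - p‖ ^ 2 - 4 * (x k - p k) ^ 2 / (‖x - p‖ ^ 2) ^ 2) + s * (- 4 * (e k * (x k - p k)) / (‖x - p‖ ^ 2) ^ 2
        - 2 * inner ℝ e (x - p) / (‖x - p‖ ^ 2) ^ 2 + 8 * inner ℝ e (x - p) * (x k - p k) ^ 2 / (‖x - p‖ ^ 2) ^ 3)) - Ak p e' s 0 k x ^ 2) * Real.cos (B x)
      - (2 * Ak p e s (1 - n / 2) k x * Ak p e' s 0 k x + s * (- 4 * (e' k * (x k - p k)) / (‖x - p‖ ^ 2) ^ 2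
        - 2 * inner ℝ e' (x - p) / (‖x - p‖ ^ 2) ^ 2 + 8 * inner ℝ e' (x - p) * (x k - p k) ^ 2 / (‖x - p‖ ^ 2) ^ 3)) * Real.sin (B x)) := by
    intro k
    have hs := contDiffOn_pd ho (hU_smooth p e e' c s θ) k
    have hd := (hs.contDiffAt (ho.mem_nhds hx)).differentiableAt (by simp)
    refine pd_of hd ?_
    have hev : ∀ᶠ t in 𝓝 (0:ℝ), x + t • EuclideanSpace.single k (1:ℝ) ∈ ({p}ᶜ : Set 𝔼) := by
      refine ContinuousAt.eventually_mem (by fun_prop) ?_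
      rw [z0]; exact ho.mem_nhds hx
    have h1 := (dA e s (1 - n / 2) c x hx k).exp.fun_mul
      (((dAk e s (1 - n / 2) k).fun_mul (dB x hx k).cos).fun_sub ((dAk e' s 0 k).fun_mul (dB x hx k).sin))
    refine (h1.congr_of_eventuallyEq ?_).congr_deriv ?_
    · filter_upwards [hev] with t ht using p1 k ht
    · simp only [z0, A]
      ring
  have hp := nsq_pos hx
  have s1 : ∑ k, (x k - p k) ^ 2 = ‖x - p‖ ^ 2 := by rw [EuclideanSpace.norm_sq_eq]; simp
  have s2 : ∀ e : 𝔼, ∑ k, e k * (x k - p k) = inner ℝ e (x - p) := by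
    intro e; rw [PiLp.inner_apply]; simp [mul_comm]
  have s3 : ∀ e e' : 𝔼, ∑ k, e k * e' k = inner ℝ e e' := by
    intro e e'; rw [PiLp.inner_apply]; simp [mul_comm]
  have cross : ∀ (e e' : 𝔼) (a a' : ℝ), ∑ k, Ak p e s a k x * Ak p e' s a' k x = 4 * a * a' / ‖x - p‖ ^ 2 + s ^ 2 * inner ℝ e e' / (‖x - p‖ ^ 2) ^ 2
      - 2 * s * (a * inner ℝ e' (x - p) + a' * inner ℝ e (x - p)) / (‖x - p‖ ^ 2) ^ 2 := by
    intro e e' a a'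
    have e1 : ∀ k, Ak p e s a k x * Ak p e' s a' k x = (2 * a / ‖x - p‖ ^ 2 - s * 2 * inner ℝ e (x - p) / (‖x - p‖ ^ 2) ^ 2) * (2 * a' / ‖x - p‖ ^ 2 - s * 2 * inner ℝ e' (x - p) / (‖x - p‖ ^ 2) ^ 2) * (x k - p k) ^ 2
        + (2 * a / ‖x - p‖ ^ 2 - s * 2 * inner ℝ e (x - p) / (‖x - p‖ ^ 2) ^ 2) * (s / ‖x - p‖ ^ 2) * (e' k * (x k - p k))
        + (2 * a' / ‖x - p‖ ^ 2 - s * 2 * inner ℝ e' (x - p) / (‖x - p‖ ^ 2) ^ 2) * (s / ‖x - p‖ ^ 2) * (e k * (x k - p k))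
        + (s / ‖x - p‖ ^ 2) ^ 2 * (e k * e' k) := by
      intro k; simp only [Ak]; ring
    simp only [e1, Finset.sum_add_distrib, ← Finset.mul_sum, s1, s2, s3]
    have hp := hp.ne'
    generalize ‖x - p‖ ^ 2 = R at hp ⊢
    field_simp
    ring
  have div1 : ∀ (e : 𝔼) (a : ℝ), ∑ k, (a * (2 / ‖x - p‖ ^ 2 - 4 * (x k - p k) ^ 2 / (‖x - p‖ ^ 2) ^ 2) + s * (- 4 * (e k * (x k - p k)) / (‖x - p‖ ^ 2) ^ 2
        - 2 * inner ℝ e (x - p) / (‖x - p‖ ^ 2) ^ 2 + 8 * inner ℝ e (x - p) * (x k - p k) ^ 2 / (‖x - p‖ ^ 2) ^ 3)) =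
      a * (2 * n - 4) / ‖x - p‖ ^ 2 + s * inner ℝ e (x - p) * (4 - 2 * n) / (‖x - p‖ ^ 2) ^ 2 := by
    intro e a
    have e1 : ∀ k, (a * (2 / ‖x - p‖ ^ 2 - 4 * (x k - p k) ^ 2 / (‖x - p‖ ^ 2) ^ 2) + s * (- 4 * (e k * (x k - p k)) / (‖x - p‖ ^ 2) ^ 2
        - 2 * inner ℝ e (x - p) / (‖x - p‖ ^ 2) ^ 2 + 8 * inner ℝ e (x - p) * (x k - p k) ^ 2 / (‖x - p‖ ^ 2) ^ 3)) =
        (a * 2 / ‖x - p‖ ^ 2 - s * 2 * inner ℝ e (x - p) / (‖x - p‖ ^ 2) ^ 2) + (- 4 * a / (‖x - p‖ ^ 2) ^ 2 + s * 8 * inner ℝ e (x - p) / (‖x - p‖ ^ 2) ^ 3) * (x k - p k) ^ 2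
        + (- 4 * s / (‖x - p‖ ^ 2) ^ 2) * (e k * (x k - p k)) := by
      intro k; ring
    simp only [e1, Finset.sum_add_distrib, ← Finset.mul_sum, s1, s2, Finset.sum_const, Finset.card_univ, Fintype.card_fin, nsmul_eq_mul]
    have hp := hp.ne'
    generalize ‖x - p‖ ^ 2 = R at hp ⊢
    field_simp
    ring
  have d2 := div1 e' 0
  simp only [zero_mul, zero_add] at d2
  have c1 := cross e e (1 - n / 2) (1 - n / 2)
  have c2 := cross e' e' 0 0
  have c3 := cross e e' (1 - n / 2) 0
  have d1 := div1 e (1 - n / 2)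
  rw [he] at c1
  rw [he'] at c2
  rw [hee] at c3
  have S : ∀ (P Q R T D : Fin n → ℝ) (E cB sB : ℝ), ∑ k, P k * P k + ∑ k, D k - ∑ k, Q k * Q k = 0 →
      2 * ∑ k, P k * Q k + ∑ k, T k = 0 → ∑ k, E * ((P k ^ 2 + D k - Q k ^ 2) * cB - (2 * P k * Q k + T k) * sB) = 0 := by
    intro P Q R T D E cB sB h1 h2
    have : ∀ k, E * ((P k ^ 2 + D k - Q k ^ 2) * cB - (2 * P k * Q k + T k) * sB) =
        E * cB * (P k * P k) + E * cB * D k - E * cB * (Q k * Q k) - 2 * E * sB * (P k * Q k) - E * sB * T k := by intro k; ring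
    simp only [this, Finset.sum_sub_distrib, Finset.sum_add_distrib, ← Finset.mul_sum]
    linear_combination E * cB * h1 - E * sB * h2
  simp only [p2]
  refine S (fun k => Ak p e s (1 - n / 2) k x) (fun k => Ak p e' s 0 k x) 0 _ _ _ _ _ ?_ ?_
  · rw [c1, c2, d1]
    ring
  · rw [c3, d2]
    ring
end Kelvin

section ExtB
variable {n : ℕ}
local notation "𝔼" => EuclideanSpace ℝ (Fin n)

theorem ext_ball {Ω : Set 𝔼} (hΩ : IsOpen Ω) (hs : HasSmoothBoundary Ω) {x₀ : 𝔼} (hx₀ : x₀ ∈ frontier Ω) :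
    ∃ (p : 𝔼) (r : ℝ), 0 < r ∧ ‖x₀ - p‖ = r ∧ ∀ x ∈ closure Ω, x ≠ x₀ → r < ‖x - p‖ := by
  obtain ⟨U, ρ, hU, hxU, hρ, hd, h1, h2⟩ := hs x₀ hx₀
  have hle : ∀ x ∈ closure Ω, x ∈ U → ρ x ≤ 0 := by
    intro x hx hxU
    by_cases h : x ∈ Ω
    · have : x ∈ Ω ∩ U := ⟨h, hxU⟩
      rw [h1] at this; exact this.2.le
    · have : x ∈ frontier Ω ∩ U := ⟨by rw [hΩ.frontier_eq]; exact ⟨hx, h⟩, hxU⟩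
      rw [h2] at this; exact this.2.le
  have h0 : ρ x₀ = 0 := by
    have : x₀ ∈ frontier Ω ∩ U := ⟨hx₀, hxU⟩
    rw [h2] at this; exact this.2
  have hdiff : ∀ x ∈ U, DifferentiableAt ℝ ρ x := fun x hx => (hρ.contDiffAt (hU.mem_nhds hx)).differentiableAt (by simp)
  have hc : ContDiffAt ℝ 1 (fderiv ℝ ρ) x₀ :=
    ((hρ.contDiffAt (hU.mem_nhds hxU)).of_le two_le_infty).fderiv_right (by norm_num)
  obtain ⟨K, t, ht, hK⟩ := hc.exists_lipschitzOnWith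
  obtain ⟨ε, hε, hεt⟩ := Metric.mem_nhds_iff.1 (Filter.inter_mem ht (hU.mem_nhds hxU))
  have tay : ∀ x ∈ Metric.ball x₀ ε, fderiv ℝ ρ x₀ (x - x₀) - K * ‖x - x₀‖ ^ 2 ≤ ρ x := by
    intro x hx
    have hsub : Metric.closedBall x₀ ‖x - x₀‖ ⊆ Metric.ball x₀ ε :=
      Metric.closedBall_subset_ball (by rwa [← dist_eq_norm])
    have := (convex_closedBall x₀ ‖x - x₀‖).norm_image_sub_le_of_norm_hasFDerivWithin_le' (f := ρ) (f' := fderiv ℝ ρ) (φ := fderiv ℝ ρ x₀) (C := K * ‖x - x₀‖)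
      (fun y hy => (hdiff y (hεt (hsub hy)).2).hasFDerivAt.hasFDerivWithinAt) (fun y hy => by
        rw [← dist_eq_norm]
        refine (hK.dist_le_mul _ (hεt (hsub hy)).1 _ (hεt (Metric.mem_ball_self hε)).1).trans ?_
        gcongr
        exact hy) (Metric.mem_closedBall_self (norm_nonneg _)) (y := x) (by rw [Metric.mem_closedBall, dist_eq_norm])
    rw [h0, Real.norm_eq_abs] at this
    have := (abs_le.1 this).1
    nlinarith
  set g := (InnerProductSpace.toDual ℝ 𝔼).symm (fderiv ℝ ρ x₀) with hg
  have hgi : ∀ y, fderiv ℝ ρ x₀ y = inner ℝ g y := by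
    intro y; rw [hg, InnerProductSpace.toDual_symm_apply]
  have hg0 : 0 < ‖g‖ := by
    rw [norm_pos_iff, hg]
    intro h
    exact hd x₀ hxU (by simpa using h)
  let L : ℝ := min (ε / 4) (‖g‖ / (4 * (K + 1)))
  have hK1 : (0:ℝ) < K + 1 := by positivity
  have hL : 0 < L := lt_min (by positivity) (by positivity)
  refine ⟨x₀ + (L / ‖g‖) • g, L, hL, ?_, ?_⟩
  · simp [norm_smul, abs_of_pos hL, hg0.ne']
  intro x hx hne
  have hdp : 0 < ‖x - x₀‖ := norm_pos_iff.2 (sub_ne_zero.2 hne)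
  by_cases hb : x ∈ Metric.ball x₀ ε
  · have h3 := (tay x hb).trans (hle x hx (hεt hb).2)
    rw [hgi] at h3
    have h4 : ‖x - (x₀ + (L / ‖g‖) • g)‖ ^ 2 = ‖x - x₀‖ ^ 2 - 2 * (L / ‖g‖) * inner ℝ g (x - x₀) + L ^ 2 := by
      rw [← sub_sub, norm_sub_sq_real, inner_smul_right, norm_smul, real_inner_comm]
      rw [Real.norm_eq_abs, abs_of_pos (by positivity)]
      field_simp
    refine lt_of_pow_lt_pow_left₀ 2 (norm_nonneg _) ?_
    rw [h4]
    have h5 : L / ‖g‖ ≤ 1 / (4 * (K + 1)) := by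
      rw [div_le_div_iff₀ hg0 (by positivity)]
      have : L ≤ ‖g‖ / (4 * (K + 1)) := min_le_right _ _
      rw [le_div_iff₀ (by positivity)] at this
      linarith
    have h6 : (L / ‖g‖) * inner ℝ g (x - x₀) ≤ 1 / (4 * (K + 1)) * (K * ‖x - x₀‖ ^ 2) := by
      calc _ ≤ (L / ‖g‖) * (K * ‖x - x₀‖ ^ 2) := by gcongr; linarith
        _ ≤ _ := by gcongr
    have h7 : 1 / (4 * ((K:ℝ) + 1)) * K ≤ 1 / 4 := by
      rw [one_div_mul_eq_div, div_le_div_iff₀ (by positivity) (by norm_num)]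
      linarith
    nlinarith
  · have h3 : ε ≤ ‖x - x₀‖ := by simpa [dist_eq_norm] using hb
    have h4 : ‖x - x₀‖ ≤ ‖x - (x₀ + (L / ‖g‖) • g)‖ + L := by
      have : ‖(L / ‖g‖) • g‖ = L := by simp [norm_smul, abs_of_pos hL, hg0.ne']
      calc _ = ‖(x - (x₀ + (L / ‖g‖) • g)) + (L / ‖g‖) • g‖ := by congr 1; abel
        _ ≤ _ := (norm_add_le _ _).trans (by rw [this])
    have : L ≤ ε / 4 := min_le_left _ _
    linarith

/-- geometry package: Y is nonpositive on the closure, and negative away from x₀ -/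
theorem YY_neg {Ω : Set 𝔼} {x₀ p : 𝔼} {r : ℝ} (hr : 0 < r) (hp : ‖x₀ - p‖ = r) (h : ∀ x ∈ closure Ω, x ≠ x₀ → r < ‖x - p‖) :
    (∀ x ∈ closure Ω, x ≠ p) ∧ (∀ x ∈ closure Ω, YY p (r⁻¹ • (x₀ - p)) r⁻¹ x ≤ 0) ∧
    (∀ x ∈ closure Ω, x ≠ x₀ → YY p (r⁻¹ • (x₀ - p)) r⁻¹ x < 0) ∧ YY p (r⁻¹ • (x₀ - p)) r⁻¹ x₀ = 0 := by
  have a1 : ∀ x ∈ closure Ω, x ≠ x₀ → YY p (r⁻¹ • (x₀ - p)) r⁻¹ x < 0 := by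
    intro x hx hne
    have h1 := h x hx hne
    have h2 : inner ℝ (r⁻¹ • (x₀ - p)) (x - p) ≤ ‖x - p‖ := by
      refine (real_inner_le_norm _ _).trans ?_
      rw [norm_smul, hp, Real.norm_eq_abs, abs_of_pos (by positivity), inv_mul_cancel₀ hr.ne', one_mul]
    have h3 : 0 < ‖x - p‖ := hr.trans h1
    rw [YY, sub_neg]
    calc _ ≤ ‖x - p‖ / ‖x - p‖ ^ 2 := by gcongr
      _ = ‖x - p‖⁻¹ := by field_simp
      _ < _ := inv_strictAnti₀ hr h1
  have a2 : YY p (r⁻¹ • (x₀ - p)) r⁻¹ x₀ = 0 := by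
    rw [YY, inner_smul_left, real_inner_self_eq_norm_sq, hp]
    simp only [conj_trivial]
    field_simp
    ring
  refine ⟨?_, ?_, a1, a2⟩
  · rintro x hx rfl
    by_cases hh : x = x₀
    · rw [hh, sub_self, norm_zero] at hp; linarith
    · have := h x hx hh
      rw [sub_self, norm_zero] at this; linarith
  · intro x hx
    by_cases hh : x = x₀
    · rw [hh, a2]
    · exact (a1 x hx hh).le
end ExtB

section Cgo
variable {n : ℕ}
local notation "𝔼" => EuclideanSpace ℝ (Fin n)

theorem glob_ext {Ω : Set 𝔼} (hb : Bornology.IsBounded Ω) {p : 𝔼} {r : ℝ} (hr : 0 < r) (hrp : ∀ x ∈ closure Ω, r ≤ ‖x - p‖)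
    {h : 𝔼 → ℝ} (hh : ContDiffOn ℝ ∞ h {p}ᶜ) : ∃ G : 𝔼 → ℝ, ContDiff ℝ ∞ G ∧ HasCompactSupport G ∧ ∀ x ∈ closure Ω, G x = h x := by
  obtain ⟨R, hR⟩ := hb.closure.subset_closedBall p
  let b1 : ContDiffBump p := ⟨max R 1, max R 1 + 1, by positivity, by linarith⟩
  let b2 : ContDiffBump p := ⟨r / 3, r / 2, by positivity, by linarith⟩
  refine ⟨fun x => b1 x * ((1 - b2 x) * h x), ?_, b1.hasCompactSupport.mul_right, ?_⟩
  · rw [contDiff_iff_contDiffAt]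
    intro x
    by_cases hx : x = p
    · have : (fun x => b1 x * ((1 - b2 x) * h x)) =ᶠ[𝓝 x] fun _ => 0 := by
        rw [hx]
        filter_upwards [b2.eventuallyEq_one] with y hy
        rw [hy]; simp
      exact contDiffAt_const.congr_of_eventuallyEq this
    · exact (b1.contDiff.contDiffAt).mul ((contDiffAt_const.sub b2.contDiff.contDiffAt).mul
        (hh.contDiffAt (isOpen_compl_singleton.mem_nhds hx)))
  · intro x hx
    have h1 : b1 x = 1 := b1.one_of_mem_closedBall (Metric.closedBall_subset_closedBall (le_max_left _ _) (hR hx))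
    have h2 : b2 x = 0 := b2.zero_of_le_dist (by
      rw [dist_eq_norm]
      exact le_trans (by show r / 2 ≤ r; linarith) (hrp x hx))
    simp [h1, h2]

theorem IsHarmonicOn.sub' {Ω : Set 𝔼} (hΩ : IsOpen Ω) {u v : 𝔼 → ℝ} (hu : IsHarmonicOn u Ω) (hv : IsHarmonicOn v Ω) :
    IsHarmonicOn (u - v) Ω := by
  refine ⟨hu.1.sub hv.1, fun x hx => ?_⟩
  have h1 := hu.2 x hx
  have h2 := hv.2 x hx
  have e := iteratedFDeriv_sub_apply (i := 2) (hu.1.contDiffAt (hΩ.mem_nhds hx)) (hv.1.contDiffAt (hΩ.mem_nhds hx))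
  simp only [lap] at h1 h2 ⊢
  rw [e]
  simp only [sub_apply, Finset.sum_sub_distrib, h1, h2, sub_zero]

def mM (p x : EuclideanSpace ℝ (Fin n)) : ℝ := Real.exp ((1 - n / 2) * Real.log (‖x - p‖ ^ 2))

theorem hU_eq (p e e' : 𝔼) (c s θ : ℝ) (x : 𝔼) : hU p e e' c s θ x = mM p x * Real.exp (s * YY p e c x) * Real.cos (s * YY p e' 0 x + θ) := by
  rw [hU, mM, Real.exp_add]

theorem cgo (hn : 0 < n) {Ω : Set 𝔼} (hΩ : IsOpen Ω) (hb : Bornology.IsBounded Ω) (hs : HasSmoothBoundary Ω) {p e e' : 𝔼} {r c c0 M : ℝ} (hr : 0 < r)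
    (hrp : ∀ x ∈ closure Ω, r ≤ ‖x - p‖) (he : inner ℝ e e = (1:ℝ)) (he' : inner ℝ e' e' = (1:ℝ)) (hee : inner ℝ e e' = (0:ℝ)) (hc : 0 < c)
    {Γ : Set 𝔼} (hΓ : Γ ⊆ frontier Ω) (hΓY : ∀ x ∈ Γ, YY p e c0 x ≤ - 2 * c) (hM : ∀ x ∈ closure Ω, mM p x ≤ M) {s : ℝ} (hs0 : 0 ≤ s) (θ : ℝ) :
    ∃ u : 𝔼 → ℝ, ContDiffOn ℝ ∞ u (closure Ω) ∧ IsHarmonicOn u Ω ∧ (∀ x ∈ Γ, u x = 0) ∧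
      ∀ x ∈ closure Ω, |hU p e e' c0 s θ x - u x| ≤ M * Real.exp (- c * s) := by
  have hne : closure Ω ⊆ {p}ᶜ := by
    rintro x hx rfl
    have := hrp x hx
    simp at this; linarith
  have hsm : ContDiffOn ℝ ∞ (fun x => Real.smoothTransition ((- c - YY p e c0 x) / c) * hU p e e' c0 s θ x) {p}ᶜ :=
    (Real.smoothTransition.contDiff.comp_contDiffOn ((contDiffOn_const.sub (YY_smooth p e c0)).div_const c)).mul (hU_smooth _ _ _ _ _ _)
  obtain ⟨G, hG, hGc, hGe⟩ := glob_ext hb hr hrp hsm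
  obtain ⟨w, hw, hwh, hwG⟩ := dirichlet hn hΩ hb hs hG hGc
  have hbd : ∀ x ∈ frontier Ω, |w x| ≤ M * Real.exp (- c * s) := by
    intro x hx
    have hxc := frontier_subset_closure hx
    have hM0 : 0 ≤ M := (Real.exp_pos _).le.trans (hM x hxc)
    rw [hwG x hx, hGe x hxc]
    by_cases hY : - c ≤ YY p e c0 x
    · rw [Real.smoothTransition.zero_of_nonpos (div_nonpos_of_nonpos_of_nonneg (by linarith) hc.le), zero_mul, abs_zero]
      positivity
    · rw [abs_mul, hU_eq, abs_mul, abs_mul, abs_of_nonneg (Real.smoothTransition.nonneg _), abs_of_pos (Real.exp_pos _), abs_of_pos (by exact Real.exp_pos _)]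
      have h1 : Real.exp (s * YY p e c0 x) ≤ Real.exp (- c * s) := by
        apply Real.exp_le_exp.2; nlinarith
      have h2 := Real.abs_cos_le_one (s * YY p e' 0 x + θ)
      have h3 := Real.smoothTransition.le_one ((-c - YY p e c0 x) / c)
      calc _ ≤ 1 * (M * Real.exp (- c * s) * 1) := by
            gcongr
            · exact mul_nonneg (mul_nonneg (Real.exp_pos _).le (Real.exp_pos _).le) (abs_nonneg _)
            · exact hM x hxc
        _ = _ := by ring
  have hw2 := maxp_abs hn hΩ hb hw hwh hbd
  have hhar : IsHarmonicOn (hU p e e' c0 s θ) Ω := by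
    have hcd : ∀ x ∈ Ω, ContDiffAt ℝ 2 (hU p e e' c0 s θ) x := fun x hx =>
      ((hU_smooth p e e' c0 s θ).contDiffAt (isOpen_compl_singleton.mem_nhds (hne (subset_closure hx)))).of_le two_le_infty
    refine ⟨fun x hx => (hcd x hx).contDiffWithinAt, fun x hx => ?_⟩
    rw [lap_eq_pd (hcd x hx)]
    exact hU_harm p e e' he he' hee c0 s θ (hne (subset_closure hx))
  refine ⟨hU p e e' c0 s θ - w, ((hU_smooth _ _ _ _ _ _).mono hne).sub hw, hhar.sub' hΩ hwh, ?_, ?_⟩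
  · intro x hx
    have hxf := hΓ hx
    rw [Pi.sub_apply, hwG x hxf, hGe x (frontier_subset_closure hxf), Real.smoothTransition.one_of_one_le, one_mul, sub_self]
    rw [one_le_div hc]
    linarith [hΓY x hx]
  · intro x hx
    simpa using hw2 x hx
end Cgo

section Est
variable {n : ℕ}
local notation "𝔼" => EuclideanSpace ℝ (Fin n)

theorem int_mul_cont {Ω : Set 𝔼} (hΩ : IsOpen Ω) (hb : Bornology.IsBounded Ω) {f g : 𝔼 → ℝ} (hf : IntegrableOn f Ω) (hg : ContinuousOn g (closure Ω)) :
    IntegrableOn (fun x => f x * g x) Ω := by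
  obtain ⟨B, hB⟩ := (Metric.isCompact_of_isClosed_isBounded isClosed_closure hb.closure).exists_bound_of_continuousOn hg
  refine hf.mul_bdd (c := B) ((hg.mono subset_closure).aestronglyMeasurable hΩ.measurableSet) ?_
  filter_upwards [ae_restrict_mem hΩ.measurableSet] with x hx using hB x (subset_closure hx)

theorem int_mul_cont2 {Ω : Set 𝔼} (hΩ : IsOpen Ω) (hb : Bornology.IsBounded Ω) {f g h : 𝔼 → ℝ} (hf : IntegrableOn f Ω) (hg : ContinuousOn g (closure Ω))
    (hh : ContinuousOn h (closure Ω)) : IntegrableOn (fun x => f x * (g x * h x)) Ω := int_mul_cont hΩ hb hf (hg.mul hh)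

theorem est (hn : 0 < n) {Ω : Set 𝔼} (hΩ : IsOpen Ω) (hb : Bornology.IsBounded Ω) (hs : HasSmoothBoundary Ω) {p e e' : 𝔼} {r c c0 M : ℝ} (hr : 0 < r)
    (hrp : ∀ x ∈ closure Ω, r ≤ ‖x - p‖) (he : inner ℝ e e = (1:ℝ)) (he' : inner ℝ e' e' = (1:ℝ)) (hee : inner ℝ e e' = (0:ℝ)) (hc : 0 < c)
    {Γ : Set 𝔼} (hΓ : Γ ⊆ frontier Ω) (hΓY : ∀ x ∈ Γ, YY p e c0 x ≤ - 2 * c) (hM : ∀ x ∈ closure Ω, mM p x ≤ M)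
    (hY0 : ∀ x ∈ closure Ω, YY p e c0 x ≤ 0) {f : 𝔼 → ℝ} (hf : MemLp f ⊤ (volume.restrict Ω))
    (horth : ∀ u v : 𝔼 → ℝ,
        ContDiffOn ℝ ∞ u (closure Ω) → IsHarmonicOn u Ω → (∀ x ∈ Γ, u x = 0) →
        ContDiffOn ℝ ∞ v (closure Ω) → IsHarmonicOn v Ω → (∀ x ∈ Γ, v x = 0) →
        ∫ x in Ω, f x * u x * v x = 0) (κ : ℝ) :
    ∃ C : ℝ, ∀ a ≥ |κ|, ∀ θ : ℝ, |∫ x in Ω, f x * mM p x ^ 2 * Real.cos (κ * YY p e' 0 x + θ) * Real.exp (a * YY p e c0 x)| ≤ C * Real.exp (- (c / 2) * a) := by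
  have hfin : IsFiniteMeasure (volume.restrict Ω) := ⟨by rw [Measure.restrict_apply_univ]; exact hb.measure_lt_top⟩
  have hfi : IntegrableOn f Ω := hf.integrable le_top
  obtain ⟨F, hF0, hF⟩ : ∃ F : ℝ, 0 ≤ F ∧ ∀ᵐ x ∂(volume.restrict Ω), ‖f x‖ ≤ F := by
    refine ⟨(eLpNormEssSup f (volume.restrict Ω)).toReal, ENNReal.toReal_nonneg, ?_⟩
    have h1 := hf.2
    rw [eLpNorm_exponent_top] at h1
    filter_upwards [ae_le_eLpNormEssSup (f := f) (μ := volume.restrict Ω)] with x hx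
    have := ENNReal.toReal_mono h1.ne hx
    simpa using this
  have hne : closure Ω ⊆ {p}ᶜ := by
    rintro x hx rfl
    have := hrp x hx
    simp at this; linarith
  have hUc : ∀ s θ, ContinuousOn (hU p e e' c0 s θ) (closure Ω) := fun s θ => ((hU_smooth _ _ _ _ _ _).mono hne).continuousOn
  have hUb : ∀ s θ, 0 ≤ s → ∀ x ∈ closure Ω, |hU p e e' c0 s θ x| ≤ M := by
    intro s θ hs x hx
    have hm : 0 < mM p x := Real.exp_pos _
    rw [hU_eq, abs_mul, abs_mul, abs_of_pos hm, abs_of_pos (Real.exp_pos _)]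
    calc _ ≤ mM p x * 1 * 1 := by
          gcongr
          · exact Real.exp_le_one_iff.2 (mul_nonpos_of_nonneg_of_nonpos hs (hY0 x hx))
          · exact Real.abs_cos_le_one _
      _ ≤ M := by simpa using hM x hx
  set V := (volume.restrict Ω).real univ
  have key : ∀ s t θ θ', 0 ≤ s → 0 ≤ t → |∫ x in Ω, f x * (hU p e e' c0 s θ x * hU p e e' c0 t θ' x)| ≤
      F * (2 * M ^ 2 * (Real.exp (- c * s) + Real.exp (- c * t))) * V := by
    intro s t θ θ' hs0 ht0
    obtain ⟨u, hu, huh, huΓ, hub⟩ := cgo hn hΩ hb hs hr hrp he he' hee hc hΓ hΓY hM hs0 θ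
    obtain ⟨v, hv, hvh, hvΓ, hvb⟩ := cgo hn hΩ hb hs hr hrp he he' hee hc hΓ hΓY hM ht0 θ'
    have h0 := horth u v hu huh huΓ hv hvh hvΓ
    have e1 : ∫ x in Ω, f x * (hU p e e' c0 s θ x * hU p e e' c0 t θ' x) =
        ∫ x in Ω, (f x * (hU p e e' c0 s θ x * hU p e e' c0 t θ' x) - f x * (u x * v x)) := by
      rw [integral_sub (int_mul_cont2 hΩ hb hfi (hUc _ _) (hUc _ _)) (int_mul_cont2 hΩ hb hfi hu.continuousOn hv.continuousOn)]
      simp only [← mul_assoc] at h0 ⊢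
      rw [h0, sub_zero]
    rw [e1, ← Real.norm_eq_abs]
    refine norm_integral_le_of_norm_le_const ?_
    filter_upwards [hF, ae_restrict_mem hΩ.measurableSet] with x hfx hx
    have hx := subset_closure hx
    rw [← mul_sub, norm_mul]
    gcongr
    rw [Real.norm_eq_abs]
    have hM0 : 0 ≤ M := (Real.exp_pos _).le.trans (hM x hx)
    have a1 := hub x hx
    have a2 := hvb x hx
    have a3 := hUb s θ hs0 x hx
    have a4 := hUb t θ' ht0 x hx
    have a5 : |v x| ≤ 2 * M := by
      have : Real.exp (- c * t) ≤ 1 := Real.exp_le_one_iff.2 (by nlinarith)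
      have : M * Real.exp (- c * t) ≤ M := by nlinarith
      rw [abs_le] at a2 a4 ⊢
      constructor <;> linarith
    calc _ = |hU p e e' c0 s θ x * (hU p e e' c0 t θ' x - v x) + (hU p e e' c0 s θ x - u x) * v x| := by congr 1; ring
      _ ≤ |hU p e e' c0 s θ x| * |hU p e e' c0 t θ' x - v x| + |hU p e e' c0 s θ x - u x| * |v x| := by
        refine (abs_add_le _ _).trans ?_
        rw [abs_mul, abs_mul]
      _ ≤ M * (M * Real.exp (- c * t)) + (M * Real.exp (- c * s)) * (2 * M) := by gcongr
      _ ≤ _ := by nlinarith [Real.exp_pos (- c * t), Real.exp_pos (- c * s), mul_nonneg (sq_nonneg M) (Real.exp_pos (- c * t)).le]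
  refine ⟨2 * (F * (2 * M ^ 2 * (Real.exp (- c * κ / 2) + Real.exp (c * κ / 2))) * V), fun a ha θ => ?_⟩
  have h1 := abs_le.1 ha
  have hs0 : 0 ≤ (a + κ) / 2 := by linarith
  have ht0 : 0 ≤ (a - κ) / 2 := by linarith
  have e1 : ∀ x, f x * mM p x ^ 2 * Real.cos (κ * YY p e' 0 x + θ) * Real.exp (a * YY p e c0 x) =
      f x * (hU p e e' c0 ((a + κ) / 2) θ x * hU p e e' c0 ((a - κ) / 2) 0 x) +
      f x * (hU p e e' c0 ((a + κ) / 2) (θ - Real.pi / 2) x * hU p e e' c0 ((a - κ) / 2) (0 - Real.pi / 2) x) := by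
    intro x
    simp only [hU_eq]
    have h2 : Real.exp (a * YY p e c0 x) = Real.exp ((a + κ) / 2 * YY p e c0 x) * Real.exp ((a - κ) / 2 * YY p e c0 x) := by
      rw [← Real.exp_add]; congr 1; ring
    have h3 : κ * YY p e' 0 x + θ = ((a + κ) / 2 * YY p e' 0 x + θ) - ((a - κ) / 2 * YY p e' 0 x + 0) := by ring
    rw [h2, h3, Real.cos_sub, ← add_sub_assoc, ← add_sub_assoc, Real.cos_sub_pi_div_two, Real.cos_sub_pi_div_two]
    ring
  simp only [e1]
  rw [integral_add (int_mul_cont2 hΩ hb hfi (hUc _ _) (hUc _ _)) (int_mul_cont2 hΩ hb hfi (hUc _ _) (hUc _ _))]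
  refine (abs_add_le _ _).trans ?_
  refine (add_le_add (key _ _ _ _ hs0 ht0) (key _ _ _ _ hs0 ht0)).trans (le_of_eq ?_)
  have h4 : Real.exp (- c * ((a + κ) / 2)) = Real.exp (- c * κ / 2) * Real.exp (- (c / 2) * a) := by
    rw [← Real.exp_add]; congr 1; ring
  have h5 : Real.exp (- c * ((a - κ) / 2)) = Real.exp (c * κ / 2) * Real.exp (- (c / 2) * a) := by
    rw [← Real.exp_add]; congr 1; ring
  rw [h4, h5]
  ring
end Est

section LapS
variable {X : Type*} [MeasurableSpace X]

theorem cexp_int_bd {μ : Measure X} {g W : X → ℝ} (hg : Integrable g μ) (hW : Measurable W) {B : ℝ} (hB : ∀ᵐ x ∂μ, |W x| ≤ B) (z : ℂ) :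
    Integrable (fun x => (g x : ℂ) * Complex.exp (z * W x)) μ ∧ Integrable (fun x => (g x : ℂ) * (Complex.exp (z * W x) * W x)) μ := by
  have h1 : ∀ᵐ x ∂μ, ‖Complex.exp (z * W x)‖ ≤ Real.exp (‖z‖ * B) := by
    filter_upwards [hB] with x hx
    refine (Complex.norm_exp_le_exp_norm _).trans (Real.exp_le_exp.2 ?_)
    rw [norm_mul, Complex.norm_real]
    gcongr
    exact hx
  constructor
  · exact hg.ofReal.mul_bdd (c := Real.exp (‖z‖ * B)) (by fun_prop) h1
  · refine hg.ofReal.mul_bdd (c := Real.exp (‖z‖ * B) * B) (by fun_prop) ?_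
    filter_upwards [hB, h1] with x hx h1
    rw [norm_mul, Complex.norm_real]
    gcongr
    exact hx

theorem cexp_entire {μ : Measure X} {g W : X → ℝ} (hg : Integrable g μ) (hW : Measurable W) {B : ℝ} (hB : ∀ᵐ x ∂μ, |W x| ≤ B) :
    Differentiable ℂ (fun z : ℂ => ∫ x, (g x : ℂ) * Complex.exp (z * W x) ∂μ) := by
  intro z
  refine (hasDerivAt_integral_of_dominated_loc_of_deriv_le (s := Metric.ball z 1) (Metric.ball_mem_nhds z one_pos)
    (F := fun z x => (g x : ℂ) * Complex.exp (z * W x)) (F' := fun z x => (g x : ℂ) * (Complex.exp (z * W x) * W x))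
    (bound := fun x => ‖g x‖ * (Real.exp ((‖z‖ + 1) * B) * B))
    (Eventually.of_forall fun w => (cexp_int_bd hg hW hB w).1.aestronglyMeasurable) (cexp_int_bd hg hW hB z).1
    (cexp_int_bd hg hW hB z).2.aestronglyMeasurable ?_ (hg.norm.mul_const _) ?_).2.differentiableAt
  · filter_upwards [hB] with x hx w hw
    have hB0 : 0 ≤ B := (abs_nonneg _).trans hx
    rw [norm_mul, norm_mul, Complex.norm_real, Complex.norm_real]
    gcongr
    · refine (Complex.norm_exp_le_exp_norm _).trans (Real.exp_le_exp.2 ?_)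
      rw [norm_mul, Complex.norm_real]
      have : ‖w‖ ≤ ‖z‖ + 1 := by
        rw [Metric.mem_ball, dist_eq_norm] at hw
        have := norm_add_le (w - z) z
        rw [sub_add_cancel] at this
        linarith
      gcongr
      exact hx
    · exact hx
  · refine Eventually.of_forall fun x w _ => ?_
    have := ((hasDerivAt_id w).mul_const (W x : ℂ)).cexp.const_mul (g x : ℂ)
    simpa using this

/-- one-sided Laplace transform uniqueness -/
theorem lap_uniq {μ : Measure X} {g Y : X → ℝ} (hg : Integrable g μ) (hY : Measurable Y) {B b C a0 : ℝ} (hB : ∀ᵐ x ∂μ, |Y x| ≤ B)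
    (h : ∀ a ≥ a0, |∫ x, g x * Real.exp (a * Y x) ∂μ| ≤ C * Real.exp (- b * a)) (z : ℂ) :
    ∫ x in {x | - b < Y x}, (g x : ℂ) * Complex.exp (z * Y x) ∂μ = 0 := by
  set S := {x | - b < Y x} with hSd
  have hS : MeasurableSet S := measurableSet_lt measurable_const hY
  let W : X → ℝ := fun x => Y x + b
  have hW : Measurable W := hY.add_const b
  have hWB : ∀ᵐ x ∂μ, |W x| ≤ B + |b| := by
    filter_upwards [hB] with x hx
    exact (abs_add_le _ _).trans (by linarith)
  have hWS : ∀ᵐ x ∂(μ.restrict S), |W x| ≤ B + |b| := ae_restrict_of_ae hWB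
  let H : ℂ → ℂ := fun z => ∫ x in S, (g x : ℂ) * Complex.exp (z * W x) ∂μ
  have hH : Differentiable ℂ H := cexp_entire hg.integrableOn hW hWS
  set L := ∫ x, ‖g x‖ ∂μ with hL
  have hL0 : 0 ≤ L := integral_nonneg fun x => norm_nonneg _
  have hLS : ∀ (T : Set X), ∫ x in T, ‖g x‖ ∂μ ≤ L := fun T => setIntegral_le_integral hg.norm (Eventually.of_forall fun x => norm_nonneg _)
  -- general growth bound
  have b1 : ∀ z, ‖H z‖ ≤ L * Real.exp (‖z‖ * (B + |b|)) := by
    intro z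
    calc ‖H z‖ ≤ ∫ x in S, ‖g x‖ * Real.exp (‖z‖ * (B + |b|)) ∂μ := by
          refine norm_integral_le_of_norm_le (hg.integrableOn.norm.mul_const _) ?_
          filter_upwards [hWS] with x hx
          rw [norm_mul, Complex.norm_real]
          gcongr
          refine (Complex.norm_exp_le_exp_norm _).trans (Real.exp_le_exp.2 ?_)
          rw [norm_mul, Complex.norm_real]
          gcongr
          exact hx
      _ = (∫ x in S, ‖g x‖ ∂μ) * Real.exp (‖z‖ * (B + |b|)) := integral_mul_const _ _
      _ ≤ _ := by gcongr; exact hLS S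
  -- left half plane
  have b2 : ∀ z : ℂ, z.re ≤ 0 → ‖H z‖ ≤ L := by
    intro z hz
    refine (norm_integral_le_of_norm_le hg.integrableOn.norm ?_).trans (hLS S)
    filter_upwards [ae_restrict_mem hS] with x hx
    rw [norm_mul, Complex.norm_real, Complex.norm_exp]
    have h0 : 0 ≤ W x := by
      have : - b < Y x := hx
      simp only [W]; linarith
    have : Real.exp (z * W x).re ≤ 1 := by
      rw [Real.exp_le_one_iff, Complex.re_mul_ofReal]
      exact mul_nonpos_of_nonpos_of_nonneg hz h0
    exact mul_le_of_le_one_right (norm_nonneg _) this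
  -- positive real axis
  have b3 : ∀ a : ℝ, 0 ≤ a → a0 ≤ a → ‖H a‖ ≤ |C| + L := by
    intro a ha haa
    have e1 : ∀ T : Set X, ∫ x in T, (g x : ℂ) * Complex.exp ((a:ℂ) * W x) ∂μ = ((∫ x in T, g x * Real.exp (a * W x) ∂μ : ℝ) : ℂ) := by
      intro T
      rw [← integral_complex_ofReal]
      refine integral_congr_ae (Eventually.of_forall fun x => ?_)
      simp only [Complex.ofReal_mul, Complex.ofReal_exp]
    have e2 : H a = ((∫ x in S, g x * Real.exp (a * W x) ∂μ : ℝ) : ℂ) := e1 S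
    rw [e2, Complex.norm_real]
    have hint : Integrable (fun x => g x * Real.exp (a * W x)) μ := by
      have := (cexp_int_bd hg hW hWB a).1.re
      refine this.congr (Eventually.of_forall fun x => ?_)
      have : (g x : ℂ) * Complex.exp ((a:ℂ) * W x) = ((g x * Real.exp (a * W x) : ℝ) : ℂ) := by push_cast; rfl
      simp only [this]
      exact Complex.ofReal_re _
    have e3 := integral_add_compl hS hint
    have e4 : ∫ x, g x * Real.exp (a * W x) ∂μ = (∫ x, g x * Real.exp (a * Y x) ∂μ) * Real.exp (a * b) := by
      rw [← integral_mul_const]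
      congr 1 with x
      simp only [W]
      rw [mul_add, Real.exp_add]; ring
    have e5 : |∫ x, g x * Real.exp (a * W x) ∂μ| ≤ |C| := by
      rw [e4, abs_mul, abs_of_pos (Real.exp_pos _)]
      calc _ ≤ C * Real.exp (- b * a) * Real.exp (a * b) := by gcongr; exact h a haa
        _ = C := by rw [mul_assoc, ← Real.exp_add]; ring_nf; simp
        _ ≤ _ := le_abs_self _
    have e6 : |∫ x in Sᶜ, g x * Real.exp (a * W x) ∂μ| ≤ L := by
      rw [← Real.norm_eq_abs]
      refine (norm_integral_le_of_norm_le hg.integrableOn.norm ?_).trans (hLS Sᶜ)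
      filter_upwards [ae_restrict_mem hS.compl] with x hx
      rw [norm_mul, Real.norm_eq_abs (Real.exp _), abs_of_pos (Real.exp_pos _)]
      have h0 : W x ≤ 0 := by
        have : ¬ (- b < Y x) := hx
        simp only [W]; linarith
      exact mul_le_of_le_one_right (norm_nonneg _) (Real.exp_le_one_iff.2 (mul_nonpos_of_nonneg_of_nonpos ha h0))
    rw [Real.norm_eq_abs]
    rw [abs_le] at e5 e6 ⊢
    constructor <;> linarith
  set D := |C| + L + L * Real.exp (|a0| * (max (B + |b|) 0)) with hD
  have hDL : L ≤ D := by
    have : 0 ≤ L * Real.exp (|a0| * (max (B + |b|) 0)) := by positivity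
    have := abs_nonneg C
    linarith
  have b4 : ∀ a : ℝ, 0 ≤ a → ‖H a‖ ≤ D := by
    intro a ha
    by_cases haa : a0 ≤ a
    · refine (b3 a ha haa).trans ?_
      have : 0 ≤ L * Real.exp (|a0| * (max (B + |b|) 0)) := by positivity
      linarith
    · refine (b1 a).trans ?_
      have : L * Real.exp (‖(a:ℂ)‖ * (B + |b|)) ≤ L * Real.exp (|a0| * (max (B + |b|) 0)) := by
        rw [Complex.norm_real, Real.norm_eq_abs]
        have h1 : |a| ≤ |a0| := by
          rw [abs_of_nonneg ha]; exact (not_le.1 haa).le.trans (le_abs_self _)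
        refine mul_le_mul_of_nonneg_left (Real.exp_le_exp.2 ?_) hL0
        calc _ ≤ |a| * (max (B + |b|) 0) := by gcongr; exact le_max_left _ _
          _ ≤ _ := by gcongr
      have := abs_nonneg C
      linarith
  have hO : ∀ l : Filter ℂ, H =O[l] fun z => Real.exp ((B + |b|) * ‖z‖ ^ (1:ℝ)) := by
    intro l
    refine Asymptotics.IsBigO.of_bound L (Eventually.of_forall fun z => ?_)
    rw [Real.norm_eq_abs, abs_of_pos (Real.exp_pos _), Real.rpow_one, mul_comm (B + |b|)]
    exact b1 z
  have him : ∀ x : ℝ, ‖H (x * Complex.I)‖ ≤ D := fun x => (b2 _ (by simp)).trans hDL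
  have b5 : ∀ z, ‖H z‖ ≤ D := by
    intro z
    rcases le_total z.re 0 with hz | hz
    · exact (b2 z hz).trans hDL
    rcases le_total 0 z.im with hi | hi
    · exact PhragmenLindelof.quadrant_I hH.diffContOnCl ⟨1, by norm_num, _, hO _⟩ b4 (fun x _ => him x) hz hi
    · exact PhragmenLindelof.quadrant_IV hH.diffContOnCl ⟨1, by norm_num, _, hO _⟩ b4 (fun x _ => him x) hz hi
  have hbd : Bornology.IsBounded (range H) := by
    rw [isBounded_iff_forall_norm_le]
    exact ⟨D, by rintro _ ⟨z, rfl⟩; exact b5 z⟩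
  have hlim : Tendsto (fun k : ℕ => H (-(k:ℂ))) atTop (𝓝 (∫ x in S, (0:ℂ) ∂μ)) := by
    refine tendsto_integral_of_dominated_convergence (fun x => ‖g x‖) (fun k => (cexp_int_bd hg.integrableOn hW hWS _).1.aestronglyMeasurable)
      hg.integrableOn.norm (fun k => ?_) ?_
    · filter_upwards [ae_restrict_mem hS] with x hx
      rw [norm_mul, Complex.norm_real, Complex.norm_exp]
      have h0 : 0 ≤ W x := by
        have : - b < Y x := hx
        simp only [W]; linarith
      refine mul_le_of_le_one_right (norm_nonneg _) (Real.exp_le_one_iff.2 ?_)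
      rw [Complex.re_mul_ofReal]
      exact mul_nonpos_of_nonpos_of_nonneg (by simp) h0
    · filter_upwards [ae_restrict_mem hS] with x hx
      have h0 : 0 < W x := by
        have : - b < Y x := hx
        simp only [W]; linarith
      rw [← mul_zero (g x : ℂ)]
      refine Tendsto.const_mul _ ?_
      rw [tendsto_zero_iff_norm_tendsto_zero]
      have : ∀ k : ℕ, ‖Complex.exp (-(k:ℂ) * W x)‖ = Real.exp (- ((k:ℝ) * W x)) := by
        intro k
        rw [Complex.norm_exp, Complex.re_mul_ofReal]; simp
      simp only [this]
      exact Real.tendsto_exp_neg_atTop_nhds_zero.comp (tendsto_natCast_atTop_atTop.atTop_mul_const h0)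
  have hconst : ∀ w, H w = 0 := by
    intro w
    have : (fun k : ℕ => H (-(k:ℂ))) = fun _ => H w := by
      funext k; exact hH.apply_eq_apply_of_bounded hbd _ _
    rw [this] at hlim
    simpa using tendsto_nhds_unique tendsto_const_nhds hlim
  have e : ∫ x in S, (g x : ℂ) * Complex.exp (z * Y x) ∂μ = H z * Complex.exp (- (z * b)) := by
    simp only [H]
    rw [← integral_mul_const]
    congr 1 with x
    rw [mul_assoc, ← Complex.exp_add]
    simp only [W]
    push_cast; ring_nf
  rw [e, hconst, zero_mul]
end LapS

section Four
variable {n : ℕ}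
local notation "𝔼" => EuclideanSpace ℝ (Fin n)

theorem charFun_wd {μ : Measure 𝔼} {F : 𝔼 → ℝ} (hF : Integrable F μ) {J : 𝔼 → 𝔼} (hJ : Measurable J) (ξ : 𝔼) :
    charFun ((μ.withDensity fun x => ENNReal.ofReal (F x)).map J) ξ = ∫ x, (max (F x) 0 : ℝ) * Complex.exp (inner ℝ (J x) ξ * Complex.I) ∂μ := by
  rw [charFun_apply, integral_map hJ.aemeasurable (Measurable.aestronglyMeasurable (by fun_prop)),
    integral_withDensity_eq_integral_toReal_smul₀ hF.aestronglyMeasurable.aemeasurable.ennreal_ofReal (Eventually.of_forall fun x => ENNReal.ofReal_lt_top)]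
  refine integral_congr_ae (Eventually.of_forall fun x => ?_)
  simp only [ENNReal.toReal_ofReal']
  rw [Complex.real_smul]

theorem four_uniq {μ : Measure 𝔼} {F : 𝔼 → ℝ} (hF : Integrable F μ) {J K : 𝔼 → 𝔼} (hJ : Measurable J) (hK : Measurable K)
    (hKJ : ∀ x, K (J x) = x) (h : ∀ ξ : 𝔼, ∫ x, (F x : ℂ) * Complex.exp (inner ℝ (J x) ξ * Complex.I) ∂μ = 0) : F =ᵐ[μ] 0 := by
  have h1 : IsFiniteMeasure (μ.withDensity fun x => ENNReal.ofReal (F x)) := isFiniteMeasure_withDensity_ofReal hF.2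
  have hFn : Integrable (fun x => - F x) μ := hF.neg
  have h2 : IsFiniteMeasure (μ.withDensity fun x => ENNReal.ofReal (- F x)) := isFiniteMeasure_withDensity_ofReal hF.neg.2
  have hbd : ∀ {G : 𝔼 → ℝ} (ξ : 𝔼), Integrable G μ → Integrable (fun x => (G x : ℂ) * Complex.exp (inner ℝ (J x) ξ * Complex.I)) μ := by
    intro G ξ hG
    refine hG.ofReal.mul_bdd (c := 1) (Measurable.aestronglyMeasurable (by fun_prop)) (Eventually.of_forall fun x => ?_)
    rw [Complex.norm_exp_ofReal_mul_I]
  have e1 : (μ.withDensity fun x => ENNReal.ofReal (F x)).map J = (μ.withDensity fun x => ENNReal.ofReal (- F x)).map J := by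
    refine Measure.ext_of_charFun (funext fun ξ => ?_)
    rw [charFun_wd hF hJ, charFun_wd hFn hJ, ← sub_eq_zero, ← integral_sub (hbd ξ hF.pos_part) (hbd ξ hF.neg_part), ← h ξ]
    refine integral_congr_ae (Eventually.of_forall fun x => ?_)
    simp only
    rw [← sub_mul, ← Complex.ofReal_sub]
    congr 2
    rcases le_total (F x) 0 with h | h
    · rw [max_eq_right h, max_eq_left (by linarith)]; ring
    · rw [max_eq_left h, max_eq_right (by linarith)]; ring
  have e2 := congrArg (Measure.map K) e1
  have hid : K ∘ J = id := funext hKJ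
  rw [Measure.map_map hK hJ, Measure.map_map hK hJ, hid, Measure.map_id, Measure.map_id] at e2
  have e3 := (withDensity_eq_iff hF.aestronglyMeasurable.aemeasurable.ennreal_ofReal hFn.aestronglyMeasurable.aemeasurable.ennreal_ofReal
    (hF.lintegral_lt_top.ne)).1 e2
  filter_upwards [e3] with x hx
  have := congrArg ENNReal.toReal hx
  simp only [ENNReal.toReal_ofReal', Pi.neg_apply] at this
  rcases le_total (F x) 0 with h | h
  · rw [max_eq_right h, max_eq_left (by linarith)] at this
    simp only [Pi.zero_apply]; linarith
  · rw [max_eq_left h, max_eq_right (by linarith)] at this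
    exact this

theorem orth_dec (hn : 2 ≤ n) {e : 𝔼} (he : inner ℝ e e = (1:ℝ)) (ξ : 𝔼) :
    ∃ (e' : 𝔼) (κ : ℝ), inner ℝ e' e' = (1:ℝ) ∧ inner ℝ e e' = (0:ℝ) ∧ ξ = (inner ℝ e ξ : ℝ) • e + κ • e' := by
  have nrm : ∀ v : 𝔼, v ≠ 0 → inner ℝ (‖v‖⁻¹ • v) (‖v‖⁻¹ • v) = (1:ℝ) := by
    intro v hv
    have := norm_pos_iff.2 hv
    rw [real_inner_self_eq_norm_sq, norm_smul, norm_inv, norm_norm, inv_mul_cancel₀ this.ne']; norm_num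
  by_cases h : ξ - (inner ℝ e ξ : ℝ) • e = 0
  · have hne : (Submodule.span ℝ {e})ᗮ ≠ ⊥ := by
      intro hbot
      have h2 := (Submodule.orthogonal_eq_bot_iff).1 hbot
      have h3 := finrank_span_le_card (R := ℝ) ({e} : Set 𝔼)
      rw [h2, finrank_top, finrank_euclideanSpace_fin] at h3
      simp at h3
      omega
    obtain ⟨v, hv, hv0⟩ := Submodule.exists_mem_ne_zero_of_ne_bot hne
    refine ⟨‖v‖⁻¹ • v, 0, nrm v hv0, ?_, ?_⟩
    · rw [inner_smul_right, Submodule.mem_orthogonal_singleton_iff_inner_right.1 hv, mul_zero]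
    · rw [zero_smul, add_zero]; exact sub_eq_zero.1 h
  · refine ⟨‖ξ - (inner ℝ e ξ : ℝ) • e‖⁻¹ • (ξ - (inner ℝ e ξ : ℝ) • e), ‖ξ - (inner ℝ e ξ : ℝ) • e‖, nrm _ h, ?_, ?_⟩
    · rw [inner_smul_right, inner_sub_right, inner_smul_right, he]; ring
    · rw [smul_smul, mul_inv_cancel₀ (norm_ne_zero_iff.2 h), one_smul]; abel

theorem YY_meas (p e : 𝔼) (c : ℝ) : Measurable (YY p e c) := by
  unfold YY
  fun_prop

end Four

theorem linearized_calderon_local {n : ℕ} (hn : 2 ≤ n)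
    (Ω : Set (EuclideanSpace ℝ (Fin n))) (hΩopen : IsOpen Ω)
    (hΩbdd : Bornology.IsBounded Ω) (hΩsmooth : HasSmoothBoundary Ω)
    (x₀ : EuclideanSpace ℝ (Fin n)) (hx₀ : x₀ ∈ frontier Ω)
    (Sig : Set (EuclideanSpace ℝ (Fin n))) (hSigx₀ : x₀ ∈ Sig)
    (hSigopen : ∃ U : Set (EuclideanSpace ℝ (Fin n)), IsOpen U ∧ Sig = frontier Ω ∩ U)
    (Γ : Set (EuclideanSpace ℝ (Fin n))) (hΓ : Γ = frontier Ω \ Sig) :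
    ∃ δ > 0, ∀ f : EuclideanSpace ℝ (Fin n) → ℝ, MemLp f ⊤ (volume.restrict Ω) →
      (∀ u v : EuclideanSpace ℝ (Fin n) → ℝ,
        ContDiffOn ℝ (⊤ : ℕ∞) u (closure Ω) → IsHarmonicOn u Ω → (∀ x ∈ Γ, u x = 0) →
        ContDiffOn ℝ (⊤ : ℕ∞) v (closure Ω) → IsHarmonicOn v Ω → (∀ x ∈ Γ, v x = 0) →
        ∫ x in Ω, f x * u x * v x = 0) →
      f =ᵐ[volume.restrict (Metric.ball x₀ δ ∩ Ω)] 0 := by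
  obtain ⟨p, r, hr, hpr, hext⟩ := ext_ball hΩopen hΩsmooth hx₀
  obtain ⟨hne, hY0, hYneg, hYx⟩ := YY_neg hr hpr hext
  set e := r⁻¹ • (x₀ - p) with he_def
  have he : inner ℝ e e = (1:ℝ) := by
    rw [real_inner_self_eq_norm_sq, he_def, norm_smul, hpr, norm_inv, Real.norm_eq_abs, abs_of_pos hr, inv_mul_cancel₀ hr.ne']; norm_num
  clear_value e
  have hrp : ∀ x ∈ closure Ω, r ≤ ‖x - p‖ := by
    intro x hx
    by_cases h : x = x₀
    · rw [h, hpr]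
    · exact (hext x hx h).le
  have hcomp : IsCompact (closure Ω) := Metric.isCompact_of_isClosed_isBounded isClosed_closure hΩbdd.closure
  have hYc : ∀ (e : EuclideanSpace ℝ (Fin n)) c, ContinuousOn (YY p e c) (closure Ω) := fun e c => ((YY_smooth p e c).mono hne).continuousOn
  have hΓsub : Γ ⊆ frontier Ω := by rw [hΓ]; exact sdiff_subset
  have hΓx : x₀ ∉ Γ := by rw [hΓ]; exact fun h => h.2 hSigx₀
  have hΓc : IsCompact Γ := by
    obtain ⟨U, hU, hSU⟩ := hSigopen
    have : Γ = frontier Ω ∩ Uᶜ := by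
      rw [hΓ, hSU]; ext x; simp only [Set.mem_sdiff, mem_inter_iff, mem_compl_iff]; tauto
    rw [this]
    exact hcomp.of_isClosed_subset (isClosed_frontier.inter hU.isClosed_compl) (inter_subset_left.trans frontier_subset_closure)
  obtain ⟨c, hc, hΓY⟩ : ∃ c : ℝ, 0 < c ∧ ∀ x ∈ Γ, YY p e r⁻¹ x ≤ - 2 * c := by
    rcases Γ.eq_empty_or_nonempty with h | h
    · exact ⟨1, one_pos, by simp [h]⟩
    · obtain ⟨y, hy, hmax⟩ := hΓc.exists_isMaxOn h ((hYc e r⁻¹).mono (hΓsub.trans frontier_subset_closure))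
      have := hYneg y (frontier_subset_closure (hΓsub hy)) (fun hh => hΓx (hh ▸ hy))
      refine ⟨- YY p e r⁻¹ y / 2, by linarith, fun x hx => ?_⟩
      have : YY p e r⁻¹ x ≤ YY p e r⁻¹ y := hmax hx
      linarith
  have hmc : ContinuousOn (mM p) (closure Ω) := Real.continuous_exp.comp_continuousOn (((log_smooth p).mono hne).continuousOn)
  obtain ⟨M, hM'⟩ := hcomp.exists_bound_of_continuousOn hmc
  have hM : ∀ x ∈ closure Ω, mM p x ≤ M := fun x hx => (le_abs_self _).trans (hM' x hx)
  obtain ⟨B, hB⟩ := hcomp.exists_bound_of_continuousOn (hYc e r⁻¹)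
  have hcat : ContinuousAt (YY p e r⁻¹) x₀ :=
    (((YY_smooth p e r⁻¹).contDiffAt (isOpen_compl_singleton.mem_nhds (hne x₀ (frontier_subset_closure hx₀))))).continuousAt
  obtain ⟨δ, hδ, hball⟩ := Metric.mem_nhds_iff.1 (hcat.eventually_mem (Ioi_mem_nhds (show - (c / 2) < YY p e r⁻¹ x₀ by rw [hYx]; linarith)))
  refine ⟨δ, hδ, fun f hf horth => ?_⟩
  have hfin : IsFiniteMeasure (volume.restrict Ω) := ⟨by rw [Measure.restrict_apply_univ]; exact hΩbdd.measure_lt_top⟩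
  have hfi : IntegrableOn f Ω := hf.integrable le_top
  let S : Set (EuclideanSpace ℝ (Fin n)) := {x | - (c / 2) < YY p e r⁻¹ x}
  have hFi : Integrable (fun x => f x * mM p x ^ 2) (volume.restrict Ω) := int_mul_cont hΩopen hΩbdd hfi (hmc.pow 2)
  have hBae : ∀ᵐ x ∂(volume.restrict Ω), |YY p e r⁻¹ x| ≤ B := by
    filter_upwards [ae_restrict_mem hΩopen.measurableSet] with x hx using hB x (subset_closure hx)
  have hgi : ∀ (e' : EuclideanSpace ℝ (Fin n)) (κ θ : ℝ), Integrable (fun x => f x * mM p x ^ 2 * Real.cos (κ * YY p e' 0 x + θ)) (volume.restrict Ω) := by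
    intro e' κ θ
    refine hFi.mul_bdd (c := 1) (Measurable.aestronglyMeasurable (((Real.measurable_cos.comp (((YY_meas p e' 0).const_mul κ).add_const θ))))) ?_
    exact Eventually.of_forall fun x => Real.abs_cos_le_one _
  have hz : ∀ (e' : EuclideanSpace ℝ (Fin n)), inner ℝ e' e' = (1:ℝ) → inner ℝ e e' = (0:ℝ) → ∀ (κ θ : ℝ) (z : ℂ),
      ∫ x in S, ((f x * mM p x ^ 2 * Real.cos (κ * YY p e' 0 x + θ) : ℝ) : ℂ) * Complex.exp (z * YY p e r⁻¹ x) ∂(volume.restrict Ω) = 0 := by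
    intro e' he' hee κ θ z
    obtain ⟨C, hC⟩ := est (by omega) hΩopen hΩbdd hΩsmooth hr hrp he he' hee hc hΓsub hΓY hM hY0 hf horth κ
    exact lap_uniq (hgi e' κ θ) (YY_meas p e r⁻¹) hBae (fun a ha => hC a ha θ) z
  let J : EuclideanSpace ℝ (Fin n) → EuclideanSpace ℝ (Fin n) := fun x => (‖x - p‖ ^ 2)⁻¹ • (x - p)
  let K : EuclideanSpace ℝ (Fin n) → EuclideanSpace ℝ (Fin n) := fun y => p + (‖y‖ ^ 2)⁻¹ • y
  have hJ : Measurable J := by fun_prop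
  have hK : Measurable K := by fun_prop
  have hKJ : ∀ x, K (J x) = x := by
    intro x
    by_cases h : x = p
    · simp [K, J, h]
    · have h1 : ‖x - p‖ ≠ 0 := norm_ne_zero_iff.2 (sub_ne_zero.2 h)
      simp only [K, J, norm_smul, smul_smul, norm_inv, norm_pow, norm_norm]
      have : ((((‖x - p‖ ^ 2)⁻¹ * ‖x - p‖) ^ 2)⁻¹ * (‖x - p‖ ^ 2)⁻¹) = 1 := by field_simp
      rw [this, one_smul]; abel
  have hF0 : (fun x => f x * mM p x ^ 2) =ᵐ[(volume.restrict Ω).restrict S] 0 := by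
    refine four_uniq hFi.integrableOn hJ hK hKJ fun ξ => ?_
    obtain ⟨e', κ, he', hee, hξ⟩ := orth_dec hn he ξ
    generalize (inner ℝ e ξ : ℝ) = τ at hξ
    have hin : ∀ x, inner ℝ (J x) ξ = τ * (YY p e r⁻¹ x + r⁻¹) + κ * YY p e' 0 x := by
      intro x
      rw [hξ, inner_add_right, inner_smul_right, inner_smul_right]
      simp only [J, inner_smul_left, conj_trivial, YY]
      rw [real_inner_comm e (x - p), real_inner_comm e' (x - p)]
      ring
    have h1 := hz e' he' hee κ 0 (τ * Complex.I)
    have h2 := hz e' he' hee κ (- (Real.pi / 2)) (τ * Complex.I)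
    have hBS := ae_restrict_of_ae (s := S) hBae
    have i1 := (cexp_int_bd (hgi e' κ 0).integrableOn (YY_meas p e r⁻¹) hBS (τ * Complex.I)).1
    have i2 := (cexp_int_bd (hgi e' κ (- (Real.pi / 2))).integrableOn (YY_meas p e r⁻¹) hBS (τ * Complex.I)).1
    have e1 : ∀ x, ((f x * mM p x ^ 2 : ℝ) : ℂ) * Complex.exp (inner ℝ (J x) ξ * Complex.I) = Complex.exp (τ * r⁻¹ * Complex.I) *
        (((f x * mM p x ^ 2 * Real.cos (κ * YY p e' 0 x + 0) : ℝ) : ℂ) * Complex.exp (τ * Complex.I * YY p e r⁻¹ x) + Complex.I *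
        (((f x * mM p x ^ 2 * Real.cos (κ * YY p e' 0 x + - (Real.pi / 2)) : ℝ) : ℂ) * Complex.exp (τ * Complex.I * YY p e r⁻¹ x))) := by
      intro x
      rw [hin, ← sub_eq_add_neg, Real.cos_sub_pi_div_two, add_zero]
      have : ((τ * (YY p e r⁻¹ x + r⁻¹) + κ * YY p e' 0 x : ℝ) : ℂ) * Complex.I = τ * r⁻¹ * Complex.I + τ * Complex.I * YY p e r⁻¹ x + ((κ * YY p e' 0 x : ℝ) : ℂ) * Complex.I := by
        push_cast; ring
      rw [this, Complex.exp_add, Complex.exp_add, Complex.exp_mul_I ((κ * YY p e' 0 x : ℝ) : ℂ)]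
      generalize κ * YY p e' 0 x = q
      push_cast
      ring
    simp only [e1]
    rw [integral_const_mul, integral_add i1 (i2.const_mul _), integral_const_mul, h1, h2]
    simp
  have hf0 : f =ᵐ[(volume.restrict Ω).restrict S] 0 := by
    filter_upwards [hF0] with x hx
    have : mM p x ^ 2 ≠ 0 := pow_ne_zero 2 (Real.exp_pos _).ne'
    simpa [this] using hx
  refine ae_mono ?_ hf0
  rw [Measure.restrict_restrict (measurableSet_lt measurable_const (YY_meas p e r⁻¹))]
  exact Measure.restrict_mono (inter_subset_inter_left _ hball) le_rfl

end
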